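/- Let q be a prime power and d ≥ 2 an integer with gcd(q, d!) = 1. For each integer j ≥ 1, let P(q,d,j) be the average, over all polynomials φ ∈ F_{q^j}[X] of degree exactly d, of |Per(F_{q^j}, φ)| / (q^j + 1), where Per(F_{q^j}, φ) is the set of periodic points of the evaluation map x ↦ φ(x) on F_{q^j}. Then lim_{j→∞} P(q,d,j) = 0; that is, for every ε > 0 there exists J such that P(q,d,j) < ε for all j ≥ J. -/

import Mathlib

namespace PerAvg
open Finset

section GroupLemma
variable {G Ω : Type} [Group G] [Fintype G] [MulAction G Ω] [DecidableEq Ω]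

/-- killing the fixed points of `g ∘ F` on `Y` by an element supported over the fixed points in `X` -/
lemma exists_derange (X Y : Finset Ω) (f F : Ω → Ω)
    (hGY : ∀ (g : G), ∀ y ∈ Y, g • y ∈ Y) (hFY : ∀ y ∈ Y, F y ∈ Y) (hFinj : Function.Injective F)
    (hfF : ∀ y ∈ Y, f (F y) = F (f y)) (hfG : ∀ (g : G), ∀ y ∈ Y, f (g • y) = g • f y)
    (hfX : ∀ x ∈ X, ∃ y ∈ Y, f y = x) (hfY : ∀ y ∈ Y, f y ∈ X)
    (hFX : ∀ x ∈ X, F x ∈ X)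
    (hsw : ∀ a ∈ Y, ∃ b ∈ Y, a ≠ b ∧ f a = f b ∧ ∃ s : G, s • a = b ∧ s • b = a ∧
      ∀ y ∈ Y, y ≠ a → y ≠ b → s • y = y) :
    ∀ (n : ℕ) (g : G), (Y.filter (fun y => g • F y = y)).card = n →
      ∃ h : G, (∀ x ∈ X, h • x = x) ∧ (∀ y ∈ Y, g • F (f y) ≠ f y → h • y = y) ∧
        ∀ y ∈ Y, (h * g) • F y ≠ y := by
  intro n
  induction n using Nat.strong_induction_on with
  | _ n ih =>
  intro g hg
  by_cases hex : ∃ a ∈ Y, g • F a = a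
  · obtain ⟨a, haY, ha⟩ := hex
    obtain ⟨b, hbY, hab, hfab, s, hsa, hsb, hs⟩ := hsw a haY
    have hsX : ∀ x ∈ X, s • x = x := by
      intro x hx
      obtain ⟨y, hy, rfl⟩ := hfX x hx
      rw [← hfG s y hy]
      by_cases h1 : y = a
      · subst h1; rw [hsa, hfab]
      by_cases h2 : y = b
      · subst h2; rw [hsb, hfab]
      rw [hs y hy h1 h2]
    have hss : ∀ y ∈ Y, s • s • y = y := by
      intro y hy
      by_cases h1 : y = a
      · subst h1; rw [hsa, hsb]
      by_cases h2 : y = b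
      · subst h2; rw [hsb, hsa]
      rw [hs y hy h1 h2, hs y hy h1 h2]
    have hlt : (Y.filter (fun y => (s * g) • F y = y)).card < n := by
      rw [← hg]
      apply Finset.card_lt_card
      refine ⟨?_, ?_⟩
      · intro y hy
        simp only [Finset.mem_filter] at hy ⊢
        obtain ⟨hy, h⟩ := hy
        refine ⟨hy, ?_⟩
        rw [mul_smul] at h
        have h' : g • F y = s • y := by
          rw [← h, hss _ (hGY g _ (hFY y hy)), h]
        by_cases h1 : y = a
        · exact absurd (h1 ▸ ha) (by subst h1; rw [h', hsa]; exact fun h => hab h.symm)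
        by_cases h2 : y = b
        · subst h2
          rw [hsb, ← ha, smul_left_cancel_iff] at h'
          have := hFinj h'
          exact absurd this.symm hab
        rw [h', hs y hy h1 h2]
      · intro hsub
        have : a ∈ Y.filter (fun y => (s * g) • F y = y) := hsub (by simp [haY, ha])
        simp only [Finset.mem_filter, mul_smul, ha, hsa] at this
        exact hab this.2.symm
    obtain ⟨h, h1, h2, h3⟩ := ih _ hlt (s * g) rfl
    refine ⟨h * s, ?_, ?_, ?_⟩
    · intro x hx; rw [mul_smul, hsX x hx, h1 x hx]
    · intro y hy hne
      have hne' : y ≠ a := by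
        rintro rfl
        apply hne
        rw [← hfF y hy, ← hfG g _ (hFY y hy), ha]
      have hne'' : y ≠ b := by
        rintro rfl
        apply hne
        rw [← hfab, ← hfF a haY, ← hfG g _ (hFY a haY), ha]
      rw [mul_smul, hs y hy hne' hne'']
      apply h2 y hy
      rw [mul_smul]
      intro hc
      apply hne
      have : g • F (f y) ∈ X := by
        rw [← hfF y hy, ← hfG g _ (hFY y hy)]
        exact hfY _ (hGY g _ (hFY y hy))
      rwa [hsX _ this] at hc
    · intro y hy; rw [mul_assoc]; exact h3 y hy
  · push Not at hex
    exact ⟨1, by simp, by simp, by simpa using hex⟩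

/-- average number of fixed points -/
lemma sum_fix (X : Finset Ω) (F : Ω → Ω) (hX : X.Nonempty)
    (hGX : ∀ (g : G), ∀ y ∈ X, g • y ∈ X) (hFX : ∀ x ∈ X, F x ∈ X)
    (htr : ∀ x ∈ X, ∀ y ∈ X, ∃ g : G, g • x = y) :
    ∑ g : G, (X.filter (fun x => g • F x = x)).card = Fintype.card G := by
  classical
  obtain ⟨x0, hx0⟩ := hX
  have hc : ∀ u ∈ X, ∀ v ∈ X, ∀ u' ∈ X, ∀ v' ∈ X,
      (univ.filter (fun g : G => g • u = v)).card = (univ.filter (fun g : G => g • u' = v')).card := by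
    intro u hu v hv u' hu' v' hv'
    obtain ⟨a, ha⟩ := htr u' hu' u hu
    obtain ⟨b, hb⟩ := htr v hv v' hv'
    apply Finset.card_bij (fun g _ => b * g * a)
    · intro g hg
      simp only [mem_filter, mem_univ, true_and] at hg ⊢
      rw [mul_smul, mul_smul, ha, hg, hb]
    · intro g _ g' _ h
      simpa using h
    · intro g hg
      simp only [mem_filter, mem_univ, true_and] at hg
      refine ⟨b⁻¹ * g * a⁻¹, ?_, by group⟩
      simp only [mem_filter, mem_univ, true_and]
      rw [mul_smul, mul_smul, ← ha, inv_smul_smul, hg, ← hb, inv_smul_smul]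
  calc ∑ g : G, (X.filter (fun x => g • F x = x)).card
      = ∑ x ∈ X, (univ.filter (fun g : G => g • F x = x)).card := by
        simp only [Finset.card_filter]
        rw [Finset.sum_comm]
    _ = ∑ x ∈ X, (univ.filter (fun g : G => g • x0 = x)).card :=
        Finset.sum_congr rfl (fun x hx => hc _ (hFX x hx) x hx _ hx0 x hx)
    _ = Fintype.card G := by
        rw [← Finset.card_univ, Finset.card_eq_sum_card_fiberwise (f := fun g : G => g • x0) (t := X)]
        intro g _
        exact hGX g _ hx0

lemma group_step (X Y : Finset Ω) (f F : Ω → Ω) (d K : ℕ)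
    (hGY : ∀ (g : G), ∀ y ∈ Y, g • y ∈ Y) (hFY : ∀ y ∈ Y, F y ∈ Y) (hFinj : Function.Injective F)
    (hfF : ∀ y ∈ Y, f (F y) = F (f y)) (hfG : ∀ (g : G), ∀ y ∈ Y, f (g • y) = g • f y)
    (hfX : ∀ x ∈ X, ∃ y ∈ Y, f y = x) (hfY : ∀ y ∈ Y, f y ∈ X) (hFX : ∀ x ∈ X, F x ∈ X)
    (hYne : Y.Nonempty)
    (hd : ∀ x ∈ X, (Y.filter (fun y => f y = x)).card ≤ d)
    (h2 : ∀ y ∈ Y, ∃ y' ∈ Y, y' ≠ y ∧ f y' = f y)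
    (htr : ∀ x ∈ Y, ∀ y ∈ Y, ∃ g : G, g • x = y)
    (hsw : ∃ a ∈ Y, ∃ b ∈ Y, a ≠ b ∧ ∃ s : G, s • a = b ∧ s • b = a ∧
      ∀ y ∈ Y, y ≠ a → y ≠ b → s • y = y) :
    (univ.filter (fun g : G => ∃ y ∈ Y, g • F y = y)).card * K ≤ Fintype.card G +
      K * (d * K) ^ (d * K) * ((univ.filter (fun g : G => ∃ x ∈ X, g • F x = x)).card -
        (univ.filter (fun g : G => ∃ y ∈ Y, g • F y = y)).card) ∧
    (univ.filter (fun g : G => ∃ y ∈ Y, g • F y = y)).card ≤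
      (univ.filter (fun g : G => ∃ x ∈ X, g • F x = x)).card := by
  classical
  have hGX : ∀ (g : G), ∀ y ∈ X, g • y ∈ X := by
    intro g x hx
    obtain ⟨y, hy, rfl⟩ := hfX x hx
    rw [← hfG g y hy]; exact hfY _ (hGY g y hy)
  have htrX : ∀ x ∈ X, ∀ y ∈ X, ∃ g : G, g • x = y := by
    intro x hx y hy
    obtain ⟨a, ha, rfl⟩ := hfX x hx
    obtain ⟨b, hb, rfl⟩ := hfX y hy
    obtain ⟨g, hg⟩ := htr a ha b hb
    exact ⟨g, by rw [← hfG g a ha, hg]⟩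
  have hXne : X.Nonempty := ⟨_, hfY _ hYne.choose_spec⟩
  -- every point can be swapped with a sibling
  have hsw' : ∀ a ∈ Y, ∃ b ∈ Y, a ≠ b ∧ f a = f b ∧ ∃ s : G, s • a = b ∧ s • b = a ∧
      ∀ y ∈ Y, y ≠ a → y ≠ b → s • y = y := by
    intro a' ha'
    obtain ⟨a, ha, b, hb, hab, s, hsa, hsb, hs⟩ := hsw
    obtain ⟨g, hg⟩ := htr a ha a' ha'
    have hfab : f a = f b := by
      by_contra hne
      obtain ⟨c, hc, hca, hfc⟩ := h2 a ha
      have hcb : c ≠ b := by rintro rfl; exact hne hfc.symm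
      have h1 := hfG s c hc
      rw [hs c hc hca hcb, hfc, ← hfG s a ha, hsa] at h1
      exact hne h1
    refine ⟨g • b, hGY g b hb, ?_, ?_, g * s * g⁻¹, ?_, ?_, ?_⟩
    · rw [← hg]; simpa using hab
    · rw [← hg, hfG g a ha, hfG g b hb, hfab]
    · rw [← hg, mul_smul, mul_smul, inv_smul_smul, hsa]
    · rw [mul_smul, mul_smul, inv_smul_smul, hsb, hg]
    · intro y hy h1 h2
      have h3 : g⁻¹ • y ≠ a := by
        intro h; apply h1; rw [← hg, ← h, smul_inv_smul]
      have h4 : g⁻¹ • y ≠ b := by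
        intro h; apply h2; rw [← h, smul_inv_smul]
      rw [mul_smul, mul_smul, hs _ (hGY _ y hy) h3 h4, smul_inv_smul]
  set NY := univ.filter (fun g : G => ∃ y ∈ Y, g • F y = y) with hNY
  set NX := univ.filter (fun g : G => ∃ x ∈ X, g • F x = x) with hNX
  have hsub : NY ⊆ NX := by
    intro g hg
    simp only [hNY, hNX, mem_filter, mem_univ, true_and] at hg ⊢
    obtain ⟨y, hy, h⟩ := hg
    exact ⟨f y, hfY y hy, by rw [← hfF y hy, ← hfG g _ (hFY y hy), h]⟩
  refine ⟨?_, Finset.card_le_card hsub⟩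
  rw [← Finset.card_sdiff_of_subset hsub]
  -- few fixed points
  set fx : G → Finset Ω := fun g => X.filter (fun x => g • F x = x) with hfx
  set S := NY.filter (fun g => (fx g).card ≤ K) with hS
  have hmarkov : (NY \ S).card * K ≤ Fintype.card G := by
    rw [← sum_fix (G := G) X F hXne hGX hFX htrX, ← smul_eq_mul]
    calc (NY \ S).card • K ≤ ∑ g ∈ NY \ S, (fx g).card := by
          apply Finset.card_nsmul_le_sum
          intro g hg
          simp only [hS, mem_sdiff, mem_filter, not_and, not_le] at hg
          exact (hg.2 hg.1).le
      _ ≤ _ := Finset.sum_le_sum_of_subset (Finset.subset_univ _)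
  -- the section
  have hrep : ∀ g : G, ∃ h : G, (∀ x ∈ X, h • x = x) ∧ (∀ y ∈ Y, g • F (f y) ≠ f y → h • y = y) ∧
        ∀ y ∈ Y, (h * g) • F y ≠ y := fun g =>
    exists_derange X Y f F hGY hFY hFinj hfF hfG hfX hfY hFX hsw' _ g rfl
  choose h0 h01 h02 h03 using hrep
  let act : G → (Y → Ω) := fun g y => g • (y : Ω)
  let rr : (Y → Ω) → G := fun u => if h : ∃ g, act g = u then h.choose else 1
  have hrr : ∀ g, act (rr (act g)) = act g := by
    intro g
    have h : ∃ g', act g' = act g := ⟨g, rfl⟩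
    simp only [rr, dif_pos h]; exact h.choose_spec
  let h : G → G := fun g => rr (act (h0 g))
  have hh : ∀ g, ∀ y ∈ Y, h g • y = h0 g • y := fun g y hy => congrFun (hrr (h0 g)) ⟨y, hy⟩
  have hhX : ∀ g, ∀ x ∈ X, h g • x = x := by
    intro g x hx
    obtain ⟨y, hy, rfl⟩ := hfX x hx
    rw [← hfG _ y hy, hh g y hy, hfG _ y hy, h01 g _ hx]
  have hfxh : ∀ g, fx (h g * g) = fx g := by
    intro g
    apply Finset.filter_congr
    intro x hx
    rw [mul_smul, hhX g _ (hGX g _ (hFX x hx))]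
  have hmap : ∀ g ∈ S, h g * g ∈ NX \ NY := by
    intro g hg
    simp only [hS, hNY, hNX, mem_sdiff, mem_filter, mem_univ, true_and] at hg ⊢
    obtain ⟨⟨y, hy, hgy⟩, hcard⟩ := hg
    refine ⟨⟨f y, hfY y hy, ?_⟩, ?_⟩
    · rw [mul_smul, hhX g _ (hGX g _ (hFX _ (hfY y hy))), ← hfF y hy, ← hfG g _ (hFY y hy), hgy]
    · rintro ⟨z, hz, hgz⟩
      apply h03 g z hz
      rw [mul_smul, hh g _ (hGY g _ (hFY z hz)), ← mul_smul] at hgz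
      exact hgz
  have hfib : ∀ g' ∈ NX \ NY, (S.filter (fun g => h g * g = g')).card ≤ (d * K) ^ (d * K) := by
    intro g' _
    set B : Finset Ω := Y.filter (fun y => f y ∈ fx g') with hB
    by_cases hKc : (fx g').card ≤ K
    · have hBc : B.card ≤ d * K := by
        calc B.card = ∑ x ∈ fx g', (B.filter (fun y => f y = x)).card :=
              Finset.card_eq_sum_card_fiberwise (fun y hy => (Finset.mem_filter.1 hy).2)
          _ ≤ ∑ x ∈ fx g', d := by
              apply Finset.sum_le_sum
              intro x hx
              refine le_trans (Finset.card_le_card ?_) (hd x (Finset.mem_filter.1 hx).1)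
              exact Finset.filter_subset_filter _ (Finset.filter_subset _ _)
          _ = (fx g').card * d := by simp
          _ ≤ d * K := by rw [mul_comm]; exact Nat.mul_le_mul_left _ hKc
      have hmem : ∀ g, h g * g = g' → ∀ y ∈ B, h g • y ∈ B := by
        intro g hgg y hy
        rw [hB, mem_filter] at hy ⊢
        refine ⟨hGY _ _ hy.1, ?_⟩
        rw [hfG _ _ hy.1, hhX g _ (hfY y hy.1)]; exact hy.2
      have hinj : (S.filter (fun g => h g * g = g')).card ≤ (Finset.univ : Finset (B → B)).card := by
        apply Finset.card_le_card_of_injOn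
          (fun g => if hg : h g * g = g' then (fun y : B => (⟨h g • (y : Ω), hmem g hg y y.2⟩ : B))
            else fun y => y)
        · intro g _; simp
        · intro g1 hg1 g2 hg2 heq
          have e1 : h g1 * g1 = g' := (Finset.mem_filter.1 hg1).2
          have e2 : h g2 * g2 = g' := (Finset.mem_filter.1 hg2).2
          simp only [e1, e2, dif_pos] at heq
          have hact : act (h0 g1) = act (h0 g2) := by
            funext y
            obtain ⟨y, hy⟩ := y
            change h0 g1 • y = h0 g2 • y
            by_cases hyB : y ∈ B
            · rw [← hh g1 y hy, ← hh g2 y hy]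
              have := congrFun heq ⟨y, hyB⟩
              exact congrArg Subtype.val this
            · have : ∀ g, h g * g = g' → g • F (f y) ≠ f y := by
                intro g hgg hc
                apply hyB
                rw [hB, mem_filter]
                refine ⟨hy, ?_⟩
                rw [← hgg, hfxh]
                exact Finset.mem_filter.2 ⟨hfY y hy, hc⟩
              rw [h02 g1 y hy (this g1 e1), h02 g2 y hy (this g2 e2)]
          have hheq : h g1 = h g2 := by simp only [h, hact]
          rw [hheq] at e1
          exact mul_left_cancel (e1.trans e2.symm)
      refine hinj.trans ?_
      rw [Finset.card_univ, Fintype.card_fun, Fintype.card_coe]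
      rcases Nat.eq_zero_or_pos B.card with h0 | hpos
      · rw [h0]; simp; 
        rcases Nat.eq_zero_or_pos (d*K) with h1 | h1
        · rw [h1]; simp
        · exact Nat.one_le_pow _ _ h1
      · exact (Nat.pow_le_pow_left hBc _).trans (Nat.pow_le_pow_right (hpos.trans_le hBc) hBc)
    · rw [Finset.filter_eq_empty_iff.2]
      · simp
      · intro g hg hgg
        apply hKc
        rw [← hgg, hfxh]
        exact (Finset.mem_filter.1 hg).2
  have hScard : S.card ≤ (d * K) ^ (d * K) * (NX \ NY).card :=
    Finset.card_le_mul_card_image_of_maps_to hmap _ hfib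
  have hsplit : NY.card = (NY \ S).card + S.card := by
    rw [Finset.card_sdiff_add_card_eq_card (Finset.filter_subset _ _)]
  rw [hsplit, add_mul]
  refine Nat.add_le_add hmarkov ?_
  calc S.card * K ≤ (d * K) ^ (d * K) * (NX \ NY).card * K := Nat.mul_le_mul_right _ hScard
    _ = _ := by ring

end GroupLemma

lemma numeric_iter (g K C : ℕ) (n : ℕ → ℕ) (h0 : n 0 ≤ g) (N : ℕ) (hN : K * C ≤ N) (hN1 : 1 ≤ N)
    (h1 : ∀ m < N, n (m + 1) * K ≤ g + K * C * (n m - n (m + 1)))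
    (h2 : ∀ m < N, n (m + 1) ≤ n m) : n N * K ≤ 2 * g := by
  by_contra hcon
  push Not at hcon
  have hmono : ∀ i, i ≤ N → n N ≤ n (N - i) := by
    intro i
    induction i with
    | zero => intro _; simp
    | succ i ih =>
      intro hi
      have := h2 (N - (i + 1)) (by omega)
      rw [show N - (i + 1) + 1 = N - i by omega] at this
      exact (ih (by omega)).trans this
  have hmono' : ∀ m, m ≤ N → n N ≤ n m := by
    intro m hm
    have := hmono (N - m) (by omega)
    rwa [show N - (N - m) = m by omega] at this
  have key : ∀ m, m ≤ N → m * (g + 1) + K * C * n m ≤ K * C * n 0 := by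
    intro m
    induction m with
    | zero => intro _; simp
    | succ m ih =>
      intro hm
      have a1 := ih (by omega)
      have a2 := h1 m (by omega)
      have a3 := h2 m (by omega)
      have a4 : n N * K ≤ n (m + 1) * K := Nat.mul_le_mul_right _ (hmono' _ hm)
      obtain ⟨t, ht⟩ := Nat.exists_eq_add_of_le a3
      rw [ht, Nat.add_sub_cancel_left] at a2
      rw [ht] at a1
      nlinarith
  have := key N le_rfl
  have h5 : K * C * n 0 ≤ N * g := Nat.mul_le_mul hN h0
  nlinarith [Nat.zero_le (K * C * n N)]
end PerAvg


set_option linter.unusedSectionVars false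
namespace PerAvg
open Finset

section Ord
variable {k : Type} [Field k]

/-- order at least `n` -/
def OrdGe (n : ℤ) (f : LaurentSeries k) : Prop := f = 0 ∨ n ≤ f.order

lemma OrdGe.add {n : ℤ} {f g : LaurentSeries k} (hf : OrdGe n f) (hg : OrdGe n g) :
    OrdGe n (f + g) := by
  rcases hf with rfl | hf
  · simpa using hg
  rcases hg with rfl | hg
  · rw [add_zero]; exact Or.inr hf
  by_cases h : f + g = 0
  · exact Or.inl h
  · exact Or.inr ((le_min hf hg).trans (HahnSeries.min_order_le_order_add h))

lemma OrdGe.neg {n : ℤ} {f : LaurentSeries k} (hf : OrdGe n f) : OrdGe n (-f) := by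
  rcases hf with rfl | hf
  · left; simp
  · right; rwa [HahnSeries.order_neg]

lemma OrdGe.mul {m n : ℤ} {f g : LaurentSeries k} (hf : OrdGe m f) (hg : OrdGe n g) :
    OrdGe (m + n) (f * g) := by
  by_cases h1 : f = 0
  · left; simp [h1]
  by_cases h2 : g = 0
  · left; simp [h2]
  right
  rw [HahnSeries.order_mul h1 h2]
  exact add_le_add (hf.resolve_left h1) (hg.resolve_left h2)

lemma OrdGe.mono {m n : ℤ} {f : LaurentSeries k} (hmn : m ≤ n) (hf : OrdGe n f) : OrdGe m f :=
  hf.imp id (hmn.trans)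

lemma ordGe_C (c : k) : OrdGe 0 (HahnSeries.C c : LaurentSeries k) :=
  Or.inr (by rw [HahnSeries.order_C])

lemma OrdGe.smul {n : ℤ} {f : LaurentSeries k} (c : k) (hf : OrdGe n f) :
    OrdGe n (HahnSeries.C c * f) := by
  simpa using (ordGe_C c).mul hf

lemma OrdGe.sum {ι : Type} {n : ℤ} (s : Finset ι) (f : ι → LaurentSeries k)
    (hf : ∀ i ∈ s, OrdGe n (f i)) : OrdGe n (∑ i ∈ s, f i) := by
  classical
  induction s using Finset.induction_on with
  | empty => left; simp
  | insert a s ha ih =>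
    rw [Finset.sum_insert ha]
    exact (hf a (by simp)).add (ih (fun i hi => hf i (by simp [hi])))

lemma OrdGe.pow {n : ℤ} {f : LaurentSeries k} (hf : OrdGe n f) (e : ℕ) :
    OrdGe (e * n) (f ^ e) := by
  induction e with
  | zero => simpa using ordGe_C (1 : k)
  | succ e ih =>
    rw [pow_succ]
    exact (ih.mul hf).mono (by push_cast; linarith)

lemma exists_leading {f g : LaurentSeries k} (hg : g ≠ 0) (hf : OrdGe g.order f) :
    ∃ c : k, OrdGe (g.order + 1) (f - HahnSeries.C c * g) := by
  have hg' : g.coeff g.order ≠ 0 := fun h => hg (HahnSeries.coeff_order_eq_zero.1 h)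
  refine ⟨f.coeff g.order / g.coeff g.order, ?_⟩
  set c := f.coeff g.order / g.coeff g.order with hc
  by_cases h : f - HahnSeries.C c * g = 0
  · exact Or.inl h
  right
  by_contra hlt
  push Not at hlt
  have h0 : (f - HahnSeries.C c * g).coeff (f - HahnSeries.C c * g).order ≠ 0 := fun h' => h (HahnSeries.coeff_order_eq_zero.1 h')
  set n := (f - HahnSeries.C c * g).order
  apply h0
  rcases (show n ≤ g.order by omega).lt_or_eq with hn | hn
  · have h1 : f.coeff n = 0 := by
      rcases hf with rfl | hf
      · simp
      · exact HahnSeries.coeff_eq_zero_of_lt_order (hn.trans_le hf)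
    have h2 : g.coeff n = 0 := HahnSeries.coeff_eq_zero_of_lt_order hn
    simp [h1, h2]
  · simp [hn, hc, hg']

end Ord

section Stepanov
variable {k A : Type} [Field k] [CommRing A] [IsDomain A] [Algebra k A]

lemma one_mem_pow_span {s : Set A} (h1 : (1 : A) ∈ s) (T : ℕ) :
    (1 : A) ∈ (Submodule.span k s) ^ T := by
  have := Submodule.pow_mem_pow (Submodule.span k s) (Submodule.subset_span h1) T
  simpa using this

lemma pow_span_mono {s : Set A} (h1 : (1 : A) ∈ s) {T T' : ℕ} (h : T ≤ T') :
    (Submodule.span k s) ^ T ≤ (Submodule.span k s) ^ T' := by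
  obtain ⟨e, rfl⟩ := Nat.exists_eq_add_of_le h
  intro x hx
  rw [pow_add]
  have := Submodule.mul_mem_mul hx (one_mem_pow_span (k := k) h1 e)
  simpa using this

lemma exists_mem_pow {s : Set A} (h1 : (1 : A) ∈ s) (hgen : Algebra.adjoin k s = ⊤) (x : A) :
    ∃ T, x ∈ (Submodule.span k s) ^ T := by
  have hx : x ∈ Algebra.adjoin k s := by rw [hgen]; trivial
  induction hx using Algebra.adjoin_induction with
  | mem x hx => exact ⟨1, by simpa using Submodule.subset_span hx⟩
  | algebraMap r =>
    exact ⟨0, by rw [pow_zero]; exact Submodule.algebraMap_mem r⟩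
  | add x y _ _ hx hy =>
    obtain ⟨a, ha⟩ := hx
    obtain ⟨b, hb⟩ := hy
    exact ⟨max a b, add_mem (pow_span_mono h1 (le_max_left a b) ha)
      (pow_span_mono h1 (le_max_right a b) hb)⟩
  | mul x y _ _ hx hy =>
    obtain ⟨a, ha⟩ := hx
    obtain ⟨b, hb⟩ := hy
    exact ⟨a + b, by rw [pow_add]; exact Submodule.mul_mem_mul ha hb⟩

open scoped Pointwise in
lemma finite_set_pow {s : Set A} (hs : s.Finite) (T : ℕ) : (s ^ T).Finite := by
  induction T with
  | zero => rw [pow_zero]; exact Set.finite_one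
  | succ T ih => rw [pow_succ]; exact ih.mul hs

open scoped Pointwise in
lemma finite_pow_span {s : Set A} (hs : s.Finite) (T : ℕ) :
    Module.Finite k ↥((Submodule.span k s) ^ T) := by
  rw [Submodule.span_pow]
  exact FiniteDimensional.span_of_finite k (finite_set_pow hs T)

/-- evaluation at distinct points is surjective -/
lemma exists_interp {s : Set A} (h1 : (1 : A) ∈ s) (hgen : Algebra.adjoin k s = ⊤)
    (Z : Finset (A →ₐ[k] k)) : ∃ T0, ∀ T, T0 ≤ T → ∀ u : Z → k,
      ∃ x ∈ (Submodule.span k s) ^ T, ∀ P : Z, P.1 x = u P := by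
  classical
  let ev : A →ₗ[k] (Z → k) := LinearMap.pi (fun P => P.1.toLinearMap)
  have hsurj : Function.Surjective ev := by
    rw [← LinearMap.range_eq_top]
    by_contra hne
    obtain ⟨f, hf, hle⟩ := Submodule.exists_le_ker_of_lt_top _ (lt_top_iff_ne_top.2 hne)
    have hli := linearIndependent_algHom_toLinearMap k A k
    have hli' : LinearIndependent k (fun P : Z => (P.1.toLinearMap : A →ₗ[k] k)) :=
      hli.comp (fun P : Z => P.1) Subtype.val_injective
    rw [Fintype.linearIndependent_iff] at hli'
    have h0 := hli' (fun P => f (Pi.single P 1)) (by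
      ext x
      have hx : f (ev x) = 0 := hle ⟨x, rfl⟩
      rw [LinearMap.pi_apply_eq_sum_univ f] at hx
      rw [LinearMap.sum_apply]
      have e : ∀ i : Z, (fun j => if i = j then (1 : k) else 0) = Pi.single i 1 := by
        intro i; ext j; simp [Pi.single_apply, eq_comm]
      simp only [e] at hx
      simpa [ev, mul_comm] using hx)
    apply hf
    apply LinearMap.pi_ext'
    intro P
    ext
    simpa using h0 P
  have hch : ∀ P : Z, ∃ x, ev x = Pi.single P 1 := fun P => hsurj _
  choose e he using hch
  have hT : ∀ P : Z, ∃ T, e P ∈ (Submodule.span k s) ^ T := fun P => exists_mem_pow h1 hgen _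
  choose T hT using hT
  refine ⟨Finset.univ.sup T, fun T' hT' u => ⟨∑ P, u P • e P, ?_, ?_⟩⟩
  · refine Submodule.sum_mem _ (fun P _ => Submodule.smul_mem _ _ ?_)
    exact pow_span_mono h1 ((Finset.le_sup (Finset.mem_univ P)).trans hT') (hT P)
  · intro P
    have : ev (∑ P, u P • e P) = u := by
      rw [map_sum]
      simp only [map_smul, he]
      ext P
      simp [Finset.sum_apply, Pi.single_apply]
    exact congrFun this P

variable {s : Set A}

lemma zero_count (hs : s.Finite) (h1 : (1 : A) ∈ s)
    (hgen : Algebra.adjoin k s = ⊤) (g M w : ℕ)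
    (hlow : ∀ b, g * (b + 1) ≤ Module.finrank k ↥((Submodule.span k s) ^ (w + M * b)))
    (hup : ∀ T, M * Module.finrank k ↥((Submodule.span k s) ^ T) ≤ g * (T + w + M))
    (hM : 1 ≤ M) (Z : Finset (A →ₐ[k] k)) (T : ℕ) (h : A) (hh : h ∈ (Submodule.span k s) ^ T) (h0 : h ≠ 0)
    (hZ : ∀ P ∈ Z, P h = 0) : M * Z.card ≤ g * (T + 2 * w) := by
  classical
  obtain ⟨T0, hT0⟩ := exists_interp (k := k) h1 hgen Z
  set V := fun T : ℕ => (Submodule.span k s) ^ T with hV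
  have hfin : ∀ T, Module.Finite k ↥(V T) := fun T => finite_pow_span hs T
  set b := T0 with hb
  have hT' : T0 ≤ T + (w + M * b) := by nlinarith
  let ev : V (T + (w + M * b)) →ₗ[k] (Z → k) :=
    (LinearMap.pi (fun P : Z => P.1.toLinearMap)).comp (Submodule.subtype _)
  have hsurj : LinearMap.range ev = ⊤ := by
    rw [LinearMap.range_eq_top]
    intro u
    obtain ⟨x, hx, hxu⟩ := hT0 _ hT' u
    exact ⟨⟨x, hx⟩, funext hxu⟩
  have hrk := LinearMap.finrank_range_add_finrank_ker ev
  rw [hsurj, finrank_top, Module.finrank_fintype_fun_eq_card, Fintype.card_coe] at hrk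
  let mulh : V (w + M * b) →ₗ[k] LinearMap.ker ev :=
    LinearMap.codRestrict _ (LinearMap.codRestrict (V (T + (w + M * b)))
      ((LinearMap.mulLeft k h).comp (Submodule.subtype (V (w + M * b))))
      (fun x => by
        simp only [hV, pow_add]
        simp only [LinearMap.comp_apply, Submodule.subtype_apply, LinearMap.mulLeft_apply]
        have := Submodule.mul_mem_mul hh x.2
        simpa only [hV, pow_add] using this))
      (fun x => by
        rw [LinearMap.mem_ker]
        ext P
        simp [ev, hZ P.1 P.2])
  have hinj : Function.Injective mulh := by
    intro x y hxy
    have : h * x.1 = h * y.1 := congrArg (fun z => z.1.1) hxy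
    exact Subtype.ext (mul_left_cancel₀ h0 this)
  have hk := LinearMap.finrank_le_finrank_of_injective hinj
  have a1 := hlow b
  have a2 := hup (T + (w + M * b))
  change g * (b + 1) ≤ Module.finrank k (V (w + M * b)) at a1
  change M * Module.finrank k (V (T + (w + M * b))) ≤ _ at a2
  have a3 : M * Z.card + M * (g * (b + 1)) ≤ g * (T + (w + M * b) + w + M) := by
    rw [← mul_add]
    refine le_trans (Nat.mul_le_mul_left _ ?_) a2
    omega
  nlinarith

end Stepanov
end PerAvg

set_option linter.unusedSectionVars false

namespace PerAvg
open Finset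

section Stepanov
variable {k A : Type} [Field k] [CommRing A] [IsDomain A] [Algebra k A]

open scoped Pointwise in
lemma frob_monomial {s : Set A} (S : Set (A →ₐ[k] k)) (Q : ℕ) (τ : A → A)
    (hτ : ∀ r ∈ s, τ r ∈ s) (hS : ∀ P ∈ S, ∀ r ∈ s, (P r) ^ Q = P (τ r)) (m : ℕ) :
    ∀ x ∈ s ^ m, ∃ x' ∈ s ^ m, ∀ P ∈ S, (P x) ^ Q = P x' := by
  induction m with
  | zero =>
    intro x hx
    refine ⟨1, by simp, ?_⟩
    rw [pow_zero, Set.mem_one] at hx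
    simp [hx]
  | succ m ih =>
    intro x hx
    rw [pow_succ] at hx
    obtain ⟨y, hy, z, hz, rfl⟩ := hx
    obtain ⟨y', hy', h⟩ := ih y hy
    refine ⟨y' * τ z, ?_, ?_⟩
    · rw [pow_succ]; exact Set.mul_mem_mul hy' (hτ z hz)
    · intro P hP
      simp only [map_mul, mul_pow, h P hP, hS P hP z hz]

variable {s : Set A}

lemma ord_low (ι : A →+* LaurentSeries k) (hιC : ∀ c, ι (algebraMap k A c) = HahnSeries.C c)
    (hs1 : ∀ r ∈ s, OrdGe (-1) (ι r)) (T : ℕ) :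
    ∀ f ∈ (Submodule.span k s) ^ T, OrdGe (-(T : ℤ)) (ι f) := by
  have hsmul : ∀ (c : k) (x : A), ι (c • x) = HahnSeries.C c * ι x := by
    intro c x; rw [Algebra.smul_def, map_mul, hιC]
  have hW : ∀ f ∈ Submodule.span k s, OrdGe (-1) (ι f) := by
    intro f hf
    induction hf using Submodule.span_induction with
    | mem x hx => exact hs1 x hx
    | zero => left; simp
    | add x y _ _ hx hy => rw [map_add]; exact hx.add hy
    | smul c x _ hx => rw [hsmul]; exact hx.smul c
  induction T with
  | zero =>
    intro f hf
    rw [pow_zero, Submodule.mem_one] at hf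
    obtain ⟨c, rfl⟩ := hf
    rw [hιC]; simpa using ordGe_C c
  | succ T ih =>
    intro f hf
    rw [pow_succ] at hf
    induction hf using Submodule.mul_induction_on' with
    | mem_mul_mem x hx y hy =>
      rw [map_mul]
      exact ((ih x hx).mul (hW y hy)).mono (by push_cast; linarith)
    | add x _ y _ hx hy => rw [map_add]; exact hx.add hy

/-- the auxiliary function is nonzero -/
lemma aux_ne_zero {p : ℕ} [hp : Fact p.Prime] [CharP A p] (ν : ℕ)
    (ι : A →+* LaurentSeries k) (hι : Function.Injective ι)
    (hιC : ∀ c, ι (algebraMap k A c) = HahnSeries.C c)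
    (c l : ℕ) {n : ℕ} (a : Fin n → A) (V : Submodule k A) (haV : ∀ j, a j ∈ V)
    (hlo : ∀ f ∈ V, OrdGe (-(l : ℤ)) (ι f))
    (hhi : ∀ f ∈ V, f ≠ 0 → (ι f).order ≤ c * l)
    (hli : LinearIndependent k a) (G : Fin n → A) (hG : ∃ j, G j ≠ 0)
    (hQ : (c + 1) * l < p ^ ν) : ∑ j, a j * G j ^ (p ^ ν) ≠ 0 := by
  classical
  intro hzero
  -- minimal order
  obtain ⟨j0, hj0, hmin⟩ := Finset.exists_min_image (univ.filter (fun j => G j ≠ 0))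
    (fun j => (ι (G j)).order) (by obtain ⟨j, hj⟩ := hG; exact ⟨j, by simpa using hj⟩)
  simp only [mem_filter, mem_univ, true_and] at hj0 hmin
  have hιj0 : ι (G j0) ≠ 0 := fun h => hj0 (hι (by rw [h, map_zero]))
  set v := (ι (G j0)).order with hv
  have hge : ∀ j, OrdGe v (ι (G j)) := by
    intro j
    by_cases h : G j = 0
    · left; rw [h, map_zero]
    · right; exact hmin j h
  have hlead : ∀ j, ∃ c : k, OrdGe (v + 1) (ι (G j) - HahnSeries.C c * ι (G j0)) :=
    fun j => exists_leading hιj0 (hge j)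
  choose e he using hlead
  have he0 : e j0 ≠ 0 := by
    intro h
    have := he j0
    rw [h] at this
    simp only [map_zero, zero_mul, sub_zero] at this
    rcases this with h | h
    · exact hιj0 h
    · omega
  set f := ∑ j, (e j) ^ (p ^ ν) • a j with hf
  have hfV : f ∈ V := Submodule.sum_mem _ (fun j _ => Submodule.smul_mem _ _ (haV j))
  have hf0 : f ≠ 0 := by
    intro h
    have := Fintype.linearIndependent_iff.1 hli (fun j => (e j) ^ (p ^ ν)) h j0
    exact he0 (pow_eq_zero_iff (pow_pos hp.out.pos _).ne' |>.1 this)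
  have hid : G j0 ^ (p ^ ν) * f = - ∑ j, a j * (G j - algebraMap k A (e j) * G j0) ^ (p ^ ν) := by
    have : ∀ j, a j * (G j - algebraMap k A (e j) * G j0) ^ (p ^ ν) =
        a j * G j ^ (p ^ ν) - G j0 ^ (p ^ ν) * ((e j) ^ (p ^ ν) • a j) := by
      intro j
      rw [sub_pow_char_pow, Algebra.smul_def, mul_pow, map_pow]
      ring
    simp only [this]
    rw [Finset.sum_sub_distrib, hzero, zero_sub, neg_neg, hf, Finset.mul_sum]
  have hord1 : (ι (G j0 ^ (p ^ ν) * f)).order = (p ^ ν : ℕ) * v + (ι f).order := by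
    rw [map_mul, HahnSeries.order_mul, map_pow, HahnSeries.order_pow]
    · simp [hv]
    · rw [map_pow]; exact pow_ne_zero _ hιj0
    · exact fun h => hf0 (hι (by rw [h, map_zero]))
  have hord2 : OrdGe (-(l : ℤ) + (p ^ ν : ℕ) * (v + 1)) (ι (G j0 ^ (p ^ ν) * f)) := by
    rw [hid, map_neg, map_sum]
    refine (OrdGe.sum _ _ (fun j _ => ?_)).neg
    rw [map_mul, map_pow, map_sub, map_mul, hιC]
    exact (hlo _ (haV j)).mul ((he j).pow _)
  have hord3 := hhi f hfV hf0
  rcases hord2 with h | h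
  · have : G j0 ^ (p ^ ν) * f = 0 := hι (by rw [h, map_zero])
    exact mul_ne_zero (pow_ne_zero _ hj0) hf0 this
  · rw [hord1] at h
    have hQ' : ((c : ℤ) + 1) * l < (p ^ ν : ℕ) := by exact_mod_cast hQ
    nlinarith


open scoped Pointwise in
lemma stepanov_core (hs : s.Finite) (h1 : (1 : A) ∈ s)
    (hgen : Algebra.adjoin k s = ⊤) (g M w : ℕ) [IsAlgClosed k] {p : ℕ} [hp : Fact p.Prime] [CharP k p] (μ ν : ℕ)
    (ι : A →+* LaurentSeries k) (hι : Function.Injective ι)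
    (hιC : ∀ c, ι (algebraMap k A c) = HahnSeries.C c)
    (hs1 : ∀ r ∈ s, OrdGe (-1) (ι r))
    (hhi : ∀ (T : ℕ), ∀ f ∈ (Submodule.span k s) ^ T, f ≠ 0 → (ι f).order ≤ g * T)
    (hlow : ∀ b, g * (b + 1) ≤ Module.finrank k ↥((Submodule.span k s) ^ (w + M * b)))
    (hup : ∀ T, M * Module.finrank k ↥((Submodule.span k s) ^ T) ≤ g * (T + w + M))
    (hM : 1 ≤ M)
    (S : Finset (A →ₐ[k] k)) (τ : A → A)
    (hτ : ∀ r ∈ s, τ r ∈ s) (hS : ∀ P ∈ S, ∀ r ∈ s, (P r) ^ (p ^ (μ + ν)) = P (τ r))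
    (l m : ℕ)
    (hdim : Module.finrank k ↥((Submodule.span k s) ^ (l * p ^ μ + m)) <
      Module.finrank k ↥((Submodule.span k s) ^ l) * Module.finrank k ↥((Submodule.span k s) ^ m))
    (hQ : (g + 1) * l < p ^ ν) :
    M * S.card ≤ g * (l + m * p ^ ν + 2 * w) := by
  classical
  have : CharP A p := charP_of_injective_algebraMap (algebraMap k A).injective p
  have hfin : ∀ T, Module.Finite k ↥((Submodule.span k s) ^ T) := fun T => finite_pow_span hs T
  -- basis of `W^l`
  let a0 := Module.finBasis k ↥((Submodule.span k s) ^ l)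
  set nl := Module.finrank k ↥((Submodule.span k s) ^ l) with hnl
  let a : Fin nl → A := fun j => (a0 j : A)
  have haV : ∀ j, a j ∈ (Submodule.span k s) ^ l := fun j => (a0 j).2
  have hali : LinearIndependent k a :=
    a0.linearIndependent.map' (Submodule.subtype _) (Submodule.ker_subtype _)
  -- monomial basis of `W^m`
  obtain ⟨B, hBs, hBspan, hBli⟩ := exists_linearIndependent k (s ^ m)
  have hBfin : B.Finite := (finite_set_pow hs m).subset hBs
  have : Fintype B := hBfin.fintype
  have hBcard : Fintype.card B = Module.finrank k ↥((Submodule.span k s) ^ m) := by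
    rw [Submodule.span_pow, ← hBspan, ← finrank_span_eq_card hBli, Subtype.range_coe]
  have hb' : ∀ b : B, ∃ x' ∈ s ^ m, ∀ P ∈ (S : Set (A →ₐ[k] k)), (P (b : A)) ^ (p ^ (μ + ν)) = P x' :=
    fun b => frob_monomial (S : Set (A →ₐ[k] k)) _ τ hτ (fun P hP => hS P (by simpa using hP)) m b (hBs b.2)
  choose b' hb's hb' using hb'
  have hsW : ∀ x ∈ s ^ m, x ∈ (Submodule.span k s) ^ m := by
    intro x hx; rw [Submodule.span_pow]; exact Submodule.subset_span hx
  -- dependence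
  let vec : Fin nl × B → ↥((Submodule.span k s) ^ (l * p ^ μ + m)) := fun ij =>
    ⟨a ij.1 ^ (p ^ μ) * b' ij.2, by
      rw [pow_add, pow_mul]
      exact Submodule.mul_mem_mul (Submodule.pow_mem_pow _ (haV _) _) (hsW _ (hb's _))⟩
  have hdep : ¬ LinearIndependent k vec := by
    intro hli
    have := hli.fintype_card_le_finrank
    rw [Fintype.card_prod, Fintype.card_fin, hBcard] at this
    omega
  obtain ⟨z, hz0, ⟨ij0, hij0⟩⟩ := Fintype.not_linearIndependent_iff.1 hdep
  have hz0' : ∑ ij, z ij • (a ij.1 ^ (p ^ μ) * b' ij.2) = 0 := by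
    have := congrArg Subtype.val hz0
    simpa [vec] using this
  have hpp : 0 < p ^ (μ + ν) := pow_pos hp.out.pos _
  have hroot : ∀ ij, ∃ t : k, t ^ (p ^ (μ + ν)) = z ij := fun ij => IsAlgClosed.exists_pow_nat_eq _ hpp
  choose t ht using hroot
  let G : Fin nl → A := fun j => ∑ i : B, t (j, i) • (i : A)
  have hGne : ∃ j, G j ≠ 0 := by
    refine ⟨ij0.1, fun h => ?_⟩
    have := Fintype.linearIndependent_iff.1 hBli (fun i => t (ij0.1, i)) h ij0.2
    apply hij0
    rw [← ht ij0, show ij0 = (ij0.1, ij0.2) from rfl, this, zero_pow hpp.ne']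
  set h := ∑ j, a j * G j ^ (p ^ ν) with hh
  have hne : h ≠ 0 := aux_ne_zero ν ι hι hιC g l a _ haV (ord_low ι hιC hs1 l)
    (fun f hf hf0 => hhi l f hf hf0) hali G hGne hQ
  have hGW : ∀ j, G j ∈ (Submodule.span k s) ^ m := fun j =>
    Submodule.sum_mem _ (fun i _ => Submodule.smul_mem _ _ (hsW _ (hBs i.2)))
  have hmem : h ∈ (Submodule.span k s) ^ (l + m * p ^ ν) := by
    refine Submodule.sum_mem _ (fun j _ => ?_)
    rw [pow_add, pow_mul]
    exact Submodule.mul_mem_mul (haV j) (Submodule.pow_mem_pow _ (hGW j) _)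
  have hvan : ∀ P ∈ S, P h = 0 := by
    intro P hP
    have : (P h) ^ (p ^ μ) = 0 := by
      have e1 : (P h) ^ (p ^ μ) = P (∑ ij, z ij • (a ij.1 ^ (p ^ μ) * b' ij.2)) := by
        rw [hh, ← map_pow, sum_pow_char_pow p μ, map_sum, map_sum, Fintype.sum_prod_type]
        refine Finset.sum_congr rfl (fun j _ => ?_)
        rw [mul_pow, ← pow_mul, ← pow_add, add_comm ν μ, sum_pow_char_pow p (μ + ν), Finset.mul_sum, map_sum]
        refine Finset.sum_congr rfl (fun i _ => ?_)
        rw [smul_pow, ht]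
        have := hb' i P (by simpa using hP)
        simp only [map_mul, map_smul, map_pow, this, smul_eq_mul]
        ring
      rw [e1, hz0', map_zero]
    exact pow_eq_zero_iff (pow_pos hp.out.pos _).ne' |>.1 this
  exact zero_count hs h1 hgen g M w hlow hup hM S _ h hmem hne hvan

theorem stepanov (hs : s.Finite) (h1 : (1 : A) ∈ s)
    (hgen : Algebra.adjoin k s = ⊤) (g M w : ℕ) [IsAlgClosed k] {p : ℕ} [hp : Fact p.Prime] [CharP k p] (μ ν : ℕ)
    (ι : A →+* LaurentSeries k) (hι : Function.Injective ι)
    (hιC : ∀ c, ι (algebraMap k A c) = HahnSeries.C c)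
    (hs1 : ∀ r ∈ s, OrdGe (-1) (ι r))
    (hhi : ∀ (T : ℕ), ∀ f ∈ (Submodule.span k s) ^ T, f ≠ 0 → (ι f).order ≤ g * T)
    (hlow : ∀ b, g * (b + 1) ≤ Module.finrank k ↥((Submodule.span k s) ^ (w + M * b)))
    (hup : ∀ T, M * Module.finrank k ↥((Submodule.span k s) ^ T) ≤ g * (T + w + M))
    (hM : 1 ≤ M) (hg : 1 ≤ g)
    (S : Finset (A →ₐ[k] k)) (τ : A → A)
    (hτ : ∀ r ∈ s, τ r ∈ s) (hS : ∀ P ∈ S, ∀ r ∈ s, (P r) ^ (p ^ (μ + ν)) = P (τ r))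
    (hQ : (g + 1) * (w + M * (w * (p ^ μ + 2) + 1)) < p ^ ν) :
    S.card ≤ p ^ (μ + ν) + g * w * p ^ ν + g * (3 * w + M * (w * (p ^ μ + 2) + 1)) := by
  set P0 := p ^ μ with hP0
  set Q' := p ^ ν with hQ'
  set b := w * (P0 + 2) + 1 with hb
  set a := P0 / g with ha
  have ha1 : g * a ≤ P0 := Nat.mul_div_le _ _
  have ha2 : P0 + 1 ≤ g * (a + 1) := by
    have := Nat.lt_mul_div_succ P0 (show 0 < g by omega)
    exact this
  have key := stepanov_core hs h1 hgen g M w μ ν ι hι hιC hs1 hhi hlow hup hM S τ hτ hS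
    (w + M * b) (w + M * a) (by
      have u := hup ((w + M * b) * P0 + (w + M * a))
      have l1 := hlow b
      have l2 := hlow a
      have l3 := Nat.mul_le_mul l1 l2
      refine lt_of_lt_of_le ?_ l3
      refine lt_of_mul_lt_mul_left (lt_of_le_of_lt u ?_) (Nat.zero_le M)
      have e1 : (w + M * b) * P0 + (w + M * a) + w + M < M * ((b + 1) * (g * (a + 1))) := by
        have e2 : M * ((b + 1) * (g * (a + 1))) = M * b * (g * (a + 1)) + M * (g * (a + 1)) := by ring
        have e3 : M * b * (P0 + 1) ≤ M * b * (g * (a + 1)) := Nat.mul_le_mul_left _ ha2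
        have e4 : M * (a + 1) ≤ M * (g * (a + 1)) := Nat.mul_le_mul_left _ (by nlinarith)
        have e5 : b ≤ M * b := by nlinarith
        rw [e2]
        nlinarith
      calc g * ((w + M * b) * P0 + (w + M * a) + w + M)
          < g * (M * ((b + 1) * (g * (a + 1)))) := Nat.mul_lt_mul_of_pos_left e1 hg
        _ = M * (g * (b + 1) * (g * (a + 1))) := by ring) hQ
  have h3 : M * S.card ≤ M * (P0 * Q' + g * w * Q' + g * (3 * w + M * b)) := by
    refine key.trans ?_
    have f1 : M * (g * a) * Q' ≤ M * P0 * Q' := Nat.mul_le_mul_right _ (Nat.mul_le_mul_left _ ha1)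
    have f2 : g * w * Q' ≤ M * (g * w * Q') := Nat.le_mul_of_pos_left _ hM
    have f3 : g * (3 * w + M * b) ≤ M * (g * (3 * w + M * b)) := Nat.le_mul_of_pos_left _ hM
    calc g * (w + M * b + (w + M * a) * Q' + 2 * w)
        = g * (3 * w + M * b) + g * w * Q' + M * (g * a) * Q' := by ring
      _ ≤ M * (g * (3 * w + M * b)) + M * (g * w * Q') + M * P0 * Q' := by omega
      _ = _ := by ring
  have := Nat.le_of_mul_le_mul_left h3 (by omega)
  rwa [pow_add]

end Stepanov
end PerAvg

set_option linter.unusedSectionVars false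

namespace PerAvg
open Finset Polynomial

section PolyOrd
variable {k : Type} [Field k]

lemma order_add_of_lt {f g : LaurentSeries k} (hf : f ≠ 0) (hg : OrdGe (f.order + 1) g) :
    (f + g).order = f.order ∧ f + g ≠ 0 := by
  have h1 : f.coeff f.order ≠ 0 := fun h => hf (HahnSeries.coeff_order_eq_zero.1 h)
  have h2 : g.coeff f.order = 0 := by
    rcases hg with rfl | hg
    · simp
    · exact HahnSeries.coeff_eq_zero_of_lt_order (by omega)
  have h3 : (f + g).coeff f.order ≠ 0 := by simpa [h2] using h1
  have h4 : f + g ≠ 0 := fun h => h3 (by rw [h]; simp)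
  refine ⟨le_antisymm (HahnSeries.order_le_of_coeff_ne_zero h3) ?_, h4⟩
  have h5 : OrdGe f.order (f + g) := OrdGe.add (Or.inr le_rfl) (hg.mono (by omega))
  exact h5.resolve_left h4

lemma order_poly (κ : k[X] →+* LaurentSeries k) (hC : ∀ c, κ (C c) = HahnSeries.C c) (M : ℕ) (hM : 1 ≤ M)
    (hX : (κ X).order = -(M : ℤ)) :
    ∀ (n : ℕ) (P : k[X]), P.natDegree = n → P ≠ 0 → (κ P).order = -((M : ℤ) * n) ∧ κ P ≠ 0 := by
  have hX0 : κ X ≠ 0 := by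
    intro h; rw [h, HahnSeries.order_zero] at hX; omega
  intro n
  induction n with
  | zero =>
    intro P hP hP0
    rw [Polynomial.eq_C_of_natDegree_eq_zero hP, hC]
    refine ⟨by rw [HahnSeries.order_C]; simp, ?_⟩
    intro h
    apply hP0
    rw [Polynomial.eq_C_of_natDegree_eq_zero hP]
    rw [HahnSeries.C_injective (h.trans (map_zero HahnSeries.C).symm), map_zero]
  | succ n ih =>
    intro P hP hP0
    have hd : P.divX.natDegree = n := by rw [natDegree_divX_eq_natDegree_tsub_one, hP]; simp
    have hd0 : P.divX ≠ 0 := by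
      intro h
      have := Polynomial.divX_mul_X_add P
      rw [h, zero_mul, zero_add] at this
      rw [← this, natDegree_C] at hP
      omega
    obtain ⟨h1, h2⟩ := ih _ hd hd0
    have e : κ P = κ P.divX * κ X + HahnSeries.C (P.coeff 0) := by
      conv_lhs => rw [← Polynomial.divX_mul_X_add P, map_add, map_mul, hC]
    have h3 : (κ P.divX * κ X).order = -((M : ℤ) * (n + 1 : ℕ)) := by
      rw [HahnSeries.order_mul h2 hX0, h1, hX]; push_cast; ring
    have h4 := order_add_of_lt (mul_ne_zero h2 hX0) ((ordGe_C (P.coeff 0)).mono (show (κ P.divX * κ X).order + 1 ≤ 0 by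
      rw [h3]; push_cast; nlinarith))
    rw [e, ← h3]
    exact h4

end PolyOrd

section Dim
variable {k E K : Type} [Field k] [Field E] [Field K] [Algebra k[X] E] [IsFractionRing k[X] E]
  [Algebra k E] [IsScalarTower k k[X] E] [Algebra E K] [Algebra k[X] K] [Algebra k K]
  [IsScalarTower k[X] E K] [IsScalarTower k k[X] K] [IsScalarTower k E K]
  [FiniteDimensional E K] [IsGalois E K]

lemma fixed_poly {x : K} (hfix : ∀ σ : K ≃ₐ[E] K, σ x = x) (hint : IsIntegral k[X] x) :
    ∃ P : k[X], algebraMap k[X] K P = x := by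
  obtain ⟨e, rfl⟩ := (IsGalois.mem_range_algebraMap_iff_fixed x).2 hfix
  have : IsIntegral k[X] e := (isIntegral_algebraMap_iff (algebraMap E K).injective).1 hint
  obtain ⟨P, rfl⟩ := IsIntegrallyClosed.algebraMap_eq_of_integral this
  exact ⟨P, IsScalarTower.algebraMap_apply _ E _ _⟩

variable {L : Set K}

lemma pow_span_le_adjoin {R B : Type} [CommRing R] [CommRing B] [Algebra R B] (s : Set B) (T : ℕ) :
    ∀ x ∈ (Submodule.span R s) ^ T, x ∈ Algebra.adjoin R s := by
  induction T with
  | zero =>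
    intro x hx
    rw [pow_zero, Submodule.mem_one] at hx
    obtain ⟨c, rfl⟩ := hx
    exact Subalgebra.algebraMap_mem _ c
  | succ T ih =>
    intro x hx
    rw [pow_succ] at hx
    induction hx using Submodule.mul_induction_on' with
    | mem_mul_mem x hx y hy => exact mul_mem (ih x hx) (Algebra.span_le_adjoin R s hy)
    | add x _ y _ hx hy => exact add_mem hx hy

lemma integral_of_pow (hLint : ∀ r ∈ L, IsIntegral k[X] r) (T : ℕ) :
    ∀ x ∈ (Submodule.span k (insert 1 L)) ^ T, IsIntegral k[X] x := by
  intro x hx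
  have h1 := pow_span_le_adjoin _ T x hx
  have h2 : Algebra.adjoin k (insert 1 L) ≤ (integralClosure k[X] K).restrictScalars k := by
    rw [Algebra.adjoin_le_iff]
    rintro r (rfl | hr)
    · exact isIntegral_one
    · exact hLint r hr
  exact h2 h1

lemma aut_pow (hLG : ∀ σ : K ≃ₐ[E] K, ∀ r ∈ L, σ r ∈ L) (σ : K ≃ₐ[E] K) (T : ℕ) :
    ∀ x ∈ (Submodule.span k (insert 1 L)) ^ T, σ x ∈ (Submodule.span k (insert 1 L)) ^ T := by
  have hW : ∀ x ∈ Submodule.span k (insert 1 L), σ x ∈ Submodule.span k (insert 1 L) := by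
    intro x hx
    induction hx using Submodule.span_induction with
    | mem x hx =>
      rcases hx with rfl | hx
      · rw [map_one]; exact Submodule.subset_span (Set.mem_insert _ _)
      · exact Submodule.subset_span (Set.mem_insert_of_mem _ (hLG σ x hx))
    | zero => rw [map_zero]; exact zero_mem _
    | add x y _ _ hx hy => rw [map_add]; exact add_mem hx hy
    | smul c x _ hx =>
      rw [← algebraMap_smul E c x, map_smul, algebraMap_smul]
      exact Submodule.smul_mem _ _ hx
  induction T with
  | zero =>
    intro x hx
    rw [pow_zero, Submodule.mem_one] at hx ⊢
    obtain ⟨c, rfl⟩ := hx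
    refine ⟨c, ?_⟩
    rw [IsScalarTower.algebraMap_apply k E K, AlgEquiv.commutes]
  | succ T ih =>
    intro x hx
    rw [pow_succ] at hx ⊢
    induction hx using Submodule.mul_induction_on' with
    | mem_mul_mem x hx y hy => rw [map_mul]; exact Submodule.mul_mem_mul (ih x hx) (hW y hy)
    | add x _ y _ hx hy => rw [map_add]; exact add_mem hx hy

variable (ι : K →+* LaurentSeries k) (M : ℕ)

lemma order_prod {α : Type} (t : Finset α) (f : α → LaurentSeries k) (hf : ∀ i ∈ t, f i ≠ 0) :
    (∏ i ∈ t, f i).order = ∑ i ∈ t, (f i).order := by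
  classical
  induction t using Finset.induction_on with
  | empty => simp
  | insert a t ha ih =>
    rw [Finset.prod_insert ha, Finset.sum_insert ha, HahnSeries.order_mul (hf a (by simp))
      (Finset.prod_ne_zero_iff.2 (fun i hi => hf i (by simp [hi]))), ih (fun i hi => hf i (by simp [hi]))]

lemma dim_order_le (hLG : ∀ σ : K ≃ₐ[E] K, ∀ r ∈ L, σ r ∈ L) (hLint : ∀ r ∈ L, IsIntegral k[X] r)
    (hιC : ∀ c, ι (algebraMap k K c) = HahnSeries.C c) (hM : 1 ≤ M)
    (hιX : (ι (algebraMap k[X] K X)).order = -(M : ℤ))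
    (hL1 : ∀ r ∈ L, OrdGe (-1) (ι r)) (T : ℕ) (f : K)
    (hf : f ∈ (Submodule.span k (insert 1 L)) ^ T) (hf0 : f ≠ 0) :
    (ι f).order ≤ (Module.finrank E K : ℕ) * T := by
  classical
  have hs1 : ∀ r ∈ insert 1 L, OrdGe (-1) (ι r) := by
    rintro r (rfl | hr)
    · rw [map_one]; simpa using (ordGe_C (1 : k)).mono (show (-1 : ℤ) ≤ 0 by norm_num)
    · exact hL1 r hr
  have hι : Function.Injective ι := ι.injective
  have hge : ∀ σ : K ≃ₐ[E] K, -(T : ℤ) ≤ (ι (σ f)).order := by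
    intro σ
    have := ord_low ι hιC hs1 T _ (aut_pow hLG σ T f hf)
    refine this.resolve_left ?_
    rw [map_eq_zero]
    exact (map_ne_zero σ).2 hf0
  have hfix : ∀ τ : K ≃ₐ[E] K, τ (∏ σ : K ≃ₐ[E] K, σ f) = ∏ σ : K ≃ₐ[E] K, σ f := by
    intro τ
    rw [map_prod]
    exact Fintype.prod_equiv (Equiv.mulLeft τ) _ _ (fun σ => rfl)
  have hint : IsIntegral k[X] (∏ σ : K ≃ₐ[E] K, σ f) :=
    IsIntegral.prod _ (fun σ _ => integral_of_pow hLint T _ (aut_pow hLG σ T f hf))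
  obtain ⟨P, hP⟩ := fixed_poly hfix hint
  have hN0 : (∏ σ : K ≃ₐ[E] K, σ f) ≠ 0 :=
    Finset.prod_ne_zero_iff.2 (fun σ _ => (map_ne_zero σ).2 hf0)
  have hP0 : P ≠ 0 := by rintro rfl; rw [map_zero] at hP; exact hN0 hP.symm
  have ho := (order_poly (ι.comp (algebraMap k[X] K)) (fun c => by
    rw [RingHom.comp_apply, ← Polynomial.algebraMap_eq, ← IsScalarTower.algebraMap_apply, hιC]) M hM hιX _ P rfl hP0).1
  rw [RingHom.comp_apply, hP, map_prod, order_prod _ _ (fun σ _ => by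
    rw [Ne, map_eq_zero]; exact (map_ne_zero σ).2 hf0), ← Finset.add_sum_erase _ _ (mem_univ 1)] at ho
  have h2 : ∑ σ ∈ univ.erase (1 : K ≃ₐ[E] K), (-(T : ℤ)) ≤ ∑ σ ∈ univ.erase (1 : K ≃ₐ[E] K), (ι (σ f)).order :=
    Finset.sum_le_sum (fun σ _ => hge σ)
  rw [Finset.sum_const, Finset.card_erase_of_mem (mem_univ _), Finset.card_univ, ← Nat.card_eq_fintype_card,
    IsGalois.card_aut_eq_finrank] at h2
  have hpos : 1 ≤ Module.finrank E K := Module.finrank_pos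
  simp only [AlgEquiv.one_apply, nsmul_eq_mul] at ho h2
  rw [Nat.cast_sub hpos] at h2
  push_cast at h2
  have : (0 : ℤ) ≤ (M : ℤ) * P.natDegree := by positivity
  nlinarith

/-- powers of a generating space fill up -/
lemma span_pow_top (s : Set K) (h1 : (1 : K) ∈ s) (hgen : Algebra.adjoin E s = ⊤) :
    (Submodule.span E s) ^ (Module.finrank E K) = ⊤ := by
  have key : ∀ T : ℕ, (Submodule.span E s) ^ T = ⊤ ∨ T + 1 ≤ Module.finrank E ↥((Submodule.span E s) ^ T) := by
    intro T
    induction T with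
    | zero =>
      right
      rw [pow_zero, zero_add, Nat.one_le_iff_ne_zero]
      intro h
      rw [Submodule.finrank_eq_zero] at h
      have : (1 : K) ∈ (1 : Submodule E K) := Submodule.one_le.1 le_rfl
      rw [h, Submodule.mem_bot] at this
      exact one_ne_zero this
    | succ T ih =>
      rcases ih with h | h
      · left
        exact top_le_iff.1 (h ▸ pow_span_mono h1 (Nat.le_succ T))
      · by_cases heq : (Submodule.span E s) ^ T = (Submodule.span E s) ^ (T + 1)
        · left
          have hst : ∀ j, (Submodule.span E s) ^ (T + j) = (Submodule.span E s) ^ T := by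
            intro j
            induction j with
            | zero => rfl
            | succ j ih => rw [← add_assoc, pow_succ, ih, ← pow_succ, heq]
          rw [← heq, eq_top_iff]
          intro x _
          obtain ⟨j, hj⟩ := exists_mem_pow h1 hgen x
          rw [← hst j]
          exact pow_span_mono h1 (by omega) hj
        · right
          have := Submodule.finrank_lt_finrank_of_lt
            (lt_of_le_of_ne (pow_span_mono (k := E) h1 (Nat.le_add_right T 1)) heq)
          omega
  rcases key (Module.finrank E K) with h | h
  · exact h
  · have := Submodule.finrank_le ((Submodule.span E s) ^ (Module.finrank E K))
    omega

open scoped Pointwise in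
lemma exists_basis (hgenE : Algebra.adjoin E L = ⊤) :
    ∃ b : Fin (Module.finrank E K) → K, LinearIndependent E b ∧
      Submodule.span E (Set.range b) = ⊤ ∧
      ∀ i, b i ∈ (Submodule.span k (insert 1 L)) ^ (Module.finrank E K) := by
  have hgen' : Algebra.adjoin E (insert 1 L) = ⊤ :=
    top_le_iff.1 (hgenE ▸ Algebra.adjoin_mono (Set.subset_insert _ _))
  have h := span_pow_top (insert 1 L) (Set.mem_insert _ _) hgen'
  rw [Submodule.span_pow] at h
  obtain ⟨B, hBs, hBspan, hBli⟩ := exists_linearIndependent E ((insert 1 L) ^ (Module.finrank E K))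
  rw [h] at hBspan
  have hBfin : Finite B := hBli.finite
  let _ : Fintype B := Fintype.ofFinite B
  have hcard : Fintype.card B = Module.finrank E K := by
    rw [← finrank_span_eq_card hBli, Subtype.range_coe, hBspan, finrank_top]
  let e : Fin (Module.finrank E K) ≃ B := (Fintype.equivFinOfCardEq hcard).symm
  refine ⟨fun i => (e i : K), hBli.comp e e.injective, ?_, ?_⟩
  · rw [show Set.range (fun i => (e i : K)) = B by
      ext x; constructor
      · rintro ⟨i, rfl⟩; exact (e i).2
      · intro hx; exact ⟨e.symm ⟨x, hx⟩, by simp⟩]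
    exact hBspan
  · intro i
    rw [Submodule.span_pow]
    exact Submodule.subset_span (hBs (e i).2)

lemma dim_low (hLfin : L.Finite) (hgenE : Algebra.adjoin E L = ⊤)
    (hyW : algebraMap k[X] K X ∈ (Submodule.span k (insert 1 L)) ^ M) (b : ℕ) :
    Module.finrank E K * (b + 1) ≤
      Module.finrank k ↥((Submodule.span k (insert 1 L)) ^ (Module.finrank E K + M * b)) := by
  obtain ⟨B, hBli, -, hBW⟩ := exists_basis (k := k) hgenE
  have hfin : Module.Finite k ↥((Submodule.span k (insert 1 L)) ^ (Module.finrank E K + M * b)) :=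
    finite_pow_span (hLfin.insert 1) _
  have hB2 : LinearIndependent k[X] B := (LinearIndependent.iff_fractionRing k[X] E).2 hBli
  have hX : LinearIndependent k (fun j : Fin (b + 1) => (X : k[X]) ^ (j : ℕ)) := by
    have := (Polynomial.basisMonomials k).linearIndependent.comp (fun j : Fin (b + 1) => (j : ℕ)) Fin.val_injective
    convert this using 1
    ext j; simp [Polynomial.coe_basisMonomials, X_pow_eq_monomial]
  have hall := linearIndependent_smul hX hB2
  let vec : Fin (b + 1) × Fin (Module.finrank E K) →
      ↥((Submodule.span k (insert 1 L)) ^ (Module.finrank E K + M * b)) := fun p =>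
    ⟨(X : k[X]) ^ (p.1 : ℕ) • B p.2, by
      rw [Algebra.smul_def, map_pow]
      have h1 := Submodule.mul_mem_mul (Submodule.pow_mem_pow _ hyW p.1) (hBW p.2)
      rw [← pow_mul, ← pow_add] at h1
      refine pow_span_mono (Set.mem_insert _ _) ?_ h1
      have := p.1.2
      nlinarith⟩
  have hvec : LinearIndependent k vec := by
    apply LinearIndependent.of_comp (Submodule.subtype _)
    exact hall
  have := hvec.fintype_card_le_finrank
  simpa [mul_comm] using this

lemma dim_up (hLfin : L.Finite) (hLG : ∀ σ : K ≃ₐ[E] K, ∀ r ∈ L, σ r ∈ L) (hLint : ∀ r ∈ L, IsIntegral k[X] r)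
    (hgenE : Algebra.adjoin E L = ⊤)
    (hιC : ∀ c, ι (algebraMap k K c) = HahnSeries.C c) (hM : 1 ≤ M)
    (hιX : (ι (algebraMap k[X] K X)).order = -(M : ℤ))
    (hL1 : ∀ r ∈ L, OrdGe (-1) (ι r)) (T : ℕ) :
    M * Module.finrank k ↥((Submodule.span k (insert 1 L)) ^ T) ≤
      Module.finrank E K * (T + Module.finrank E K + M) := by
  classical
  have hs1 : ∀ r ∈ insert 1 L, OrdGe (-1) (ι r) := by
    rintro r (rfl | hr)
    · rw [map_one]; simpa using (ordGe_C (1 : k)).mono (show (-1 : ℤ) ≤ 0 by norm_num)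
    · exact hL1 r hr
  set n := Module.finrank E K with hn
  obtain ⟨B, hBli, hBspan, hBW⟩ := exists_basis (k := k) hgenE
  set D := (T + n) / M with hD
  let V : Submodule k E := Submodule.map ((Algebra.linearMap k[X] E).restrictScalars k) (degreeLT k (D + 1))
  have hdfin : Module.Finite k ↥(degreeLT k (D + 1)) := Module.Finite.equiv (degreeLTEquiv k (D + 1)).symm
  have hV : Module.finrank k V ≤ D + 1 := by
    refine (Submodule.finrank_map_le _ _).trans ?_
    rw [(degreeLTEquiv k (D + 1)).finrank_eq]; simp
  have htr : ∀ f ∈ (Submodule.span k (insert 1 L)) ^ T, ∀ i, Algebra.trace E K (f * B i) ∈ V := by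
    intro f hf i
    have hmem : f * B i ∈ (Submodule.span k (insert 1 L)) ^ (T + n) := by
      rw [pow_add]; exact Submodule.mul_mem_mul hf (hBW i)
    have hint := Algebra.isIntegral_trace (L := E) (integral_of_pow hLint (T + n) _ hmem)
    obtain ⟨P, hP⟩ := IsIntegrallyClosed.algebraMap_eq_of_integral hint
    refine ⟨P, ?_, hP⟩
    rw [SetLike.mem_coe, mem_degreeLT]
    by_cases hP0 : P = 0
    · rw [hP0, degree_zero]; exact WithBot.bot_lt_coe _
    rw [degree_eq_natDegree hP0]
    have ho := order_poly (ι.comp (algebraMap k[X] K)) (fun c => by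
      rw [RingHom.comp_apply, ← Polynomial.algebraMap_eq, ← IsScalarTower.algebraMap_apply, hιC]) M hM hιX _ P rfl hP0
    have hge : OrdGe (-((T + n : ℕ) : ℤ)) ((ι.comp (algebraMap k[X] K)) P) := by
      rw [RingHom.comp_apply, IsScalarTower.algebraMap_apply k[X] E K, hP, trace_eq_sum_automorphisms, map_sum]
      exact OrdGe.sum _ _ (fun σ _ => ord_low ι hιC hs1 (T + n) _ (aut_pow hLG σ _ _ hmem))
    have h3 := hge.resolve_left ho.2
    rw [ho.1] at h3
    have h4 : M * P.natDegree ≤ T + n := by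
      have : (M : ℤ) * P.natDegree ≤ (T + n : ℕ) := by linarith
      exact_mod_cast this
    have h5 : P.natDegree ≤ D := by
      rw [hD, Nat.le_div_iff_mul_le (by omega), mul_comm]; exact h4
    exact_mod_cast Nat.lt_succ_of_le h5
  let Φ : ↥((Submodule.span k (insert 1 L)) ^ T) →ₗ[k] (Fin n → V) :=
    LinearMap.pi (fun i => LinearMap.codRestrict V
      (((Algebra.trace E K).restrictScalars k).comp
        ((LinearMap.mulRight k (B i)).comp (Submodule.subtype _))) (fun f => htr f.1 f.2 i))
  have hΦ : Function.Injective Φ := by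
    rw [← LinearMap.ker_eq_bot, LinearMap.ker_eq_bot']
    intro f hf
    apply Subtype.ext
    have h0 : ∀ i, Algebra.trace E K (f.1 * B i) = 0 := fun i =>
      congrArg Subtype.val (congrFun hf i)
    have h1 : ∀ x : K, Algebra.trace E K (f.1 * x) = 0 := by
      intro x
      have hx : x ∈ Submodule.span E (Set.range B) := by rw [hBspan]; trivial
      induction hx using Submodule.span_induction with
      | mem x hx => obtain ⟨i, rfl⟩ := hx; exact h0 i
      | zero => simp
      | add x y _ _ hx hy => rw [mul_add, map_add, hx, hy, add_zero]
      | smul c x _ hx => rw [mul_smul_comm, map_smul, hx, smul_zero]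
    have hnd := traceForm_nondegenerate E K
    exact hnd.1 f.1 (fun x => by simpa [Algebra.traceForm_apply] using h1 x)
  have hfinal := LinearMap.finrank_le_finrank_of_injective hΦ
  rw [Module.finrank_pi_fintype, Finset.sum_const, Finset.card_univ, Fintype.card_fin, smul_eq_mul] at hfinal
  calc M * Module.finrank k ↥((Submodule.span k (insert 1 L)) ^ T)
      ≤ M * (n * (D + 1)) := Nat.mul_le_mul_left _ (hfinal.trans (Nat.mul_le_mul_left _ hV))
    _ = n * (M * D + M) := by ring
    _ ≤ n * (T + n + M) := Nat.mul_le_mul_left _ (by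
        have h9 : M * D ≤ T + n := Nat.mul_div_le (T + n) M
        exact Nat.add_le_add_right h9 M)

end Dim
end PerAvg

set_option linter.unusedSectionVars false

namespace PerAvg
open Finset Polynomial

section Dim
variable {k E K : Type} [Field k] [Field E] [Field K] [Algebra k[X] E] [IsFractionRing k[X] E]
  [Algebra k E] [IsScalarTower k k[X] E] [Algebra E K] [Algebra k[X] K] [Algebra k K]
  [IsScalarTower k[X] E K] [IsScalarTower k k[X] K] [IsScalarTower k E K]
  [FiniteDimensional E K] [IsGalois E K]

theorem stepanov_galois [IsAlgClosed k] {p : ℕ} [hp : Fact p.Prime] [CharP k p] (μ ν : ℕ)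
    {L : Set K} (hLfin : L.Finite) (ι : K →+* LaurentSeries k) (M : ℕ)
    (hLG : ∀ σ : K ≃ₐ[E] K, ∀ r ∈ L, σ r ∈ L) (hLint : ∀ r ∈ L, IsIntegral k[X] r)
    (hgenE : Algebra.adjoin E L = ⊤)
    (hyW : algebraMap k[X] K X ∈ (Submodule.span k (insert 1 L)) ^ M)
    (hιC : ∀ c, ι (algebraMap k K c) = HahnSeries.C c) (hM : 1 ≤ M)
    (hιX : (ι (algebraMap k[X] K X)).order = -(M : ℤ))
    (hL1 : ∀ r ∈ L, OrdGe (-1) (ι r)) (g : ℕ) (hg : g = Module.finrank E K)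
    (S : Finset (Algebra.adjoin k L →ₐ[k] k)) (τ : Algebra.adjoin k L → Algebra.adjoin k L)
    (hτ : ∀ r : Algebra.adjoin k L, (r : K) ∈ L → (τ r : K) ∈ L)
    (hS : ∀ P ∈ S, ∀ r : Algebra.adjoin k L, (r : K) ∈ L → (P r) ^ (p ^ (μ + ν)) = P (τ r))
    (hQ : (g + 1) * (g + M * (g * (p ^ μ + 2) + 1)) < p ^ ν) :
    S.card ≤ p ^ (μ + ν) + g * g * p ^ ν + g * (3 * g + M * (g * (p ^ μ + 2) + 1)) := by
  classical
  let A : Subalgebra k K := Algebra.adjoin k L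
  let s : Set A := insert 1 {r : A | (r : K) ∈ L}
  have himg : A.val '' s = insert 1 L := by
    rw [Set.image_insert_eq]
    congr 1
    ext x
    constructor
    · rintro ⟨r, hr, rfl⟩; exact hr
    · intro hx; exact ⟨⟨x, Algebra.subset_adjoin hx⟩, hx, rfl⟩
  have hmap : ∀ T, Submodule.map A.val.toLinearMap ((Submodule.span k s) ^ T) =
      (Submodule.span k (insert 1 L)) ^ T := by
    intro T
    rw [Submodule.map_pow, Submodule.map_span]
    congr 2
  have hval : Function.Injective A.val.toLinearMap := Subtype.val_injective
  have hrk : ∀ T, Module.finrank k ↥((Submodule.span k s) ^ T) =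
      Module.finrank k ↥((Submodule.span k (insert 1 L)) ^ T) := by
    intro T
    rw [← hmap T]
    exact (Submodule.equivMapOfInjective _ hval _).finrank_eq
  have hmem : ∀ T, ∀ f ∈ (Submodule.span k s) ^ T, (f : K) ∈ (Submodule.span k (insert 1 L)) ^ T := by
    intro T f hf
    rw [← hmap T]
    exact ⟨f, hf, rfl⟩
  have hsfin : s.Finite := Set.Finite.insert _ (hLfin.preimage Subtype.val_injective.injOn)
  have hgen : Algebra.adjoin k s = ⊤ := by
    have h1 : Subalgebra.map A.val (Algebra.adjoin k s) = A := by
      rw [← Algebra.adjoin_image, himg, Algebra.adjoin_insert_one]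
    rw [eq_top_iff]
    rintro x -
    have hx : (x : K) ∈ Subalgebra.map A.val (Algebra.adjoin k s) := by rw [h1]; exact x.2
    obtain ⟨y, hy, hyx⟩ := hx
    have : y = x := Subtype.ext hyx
    rwa [← this]
  have hgpos : 1 ≤ g := hg ▸ Module.finrank_pos
  refine stepanov hsfin (Set.mem_insert _ _) hgen g M g μ ν (ι.comp (algebraMap A K))
    (ι.injective.comp Subtype.val_injective) (fun c => hιC c) ?_ ?_ ?_ ?_ hM hgpos S
    (fun r => if r = 1 then 1 else τ r) ?_ ?_ hQ
  · rintro r (rfl | hr)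
    · rw [map_one]; simpa using (ordGe_C (1 : k)).mono (show (-1 : ℤ) ≤ 0 by norm_num)
    · exact hL1 r hr
  · intro T f hf hf0
    rw [hg]
    exact dim_order_le (E := E) ι M hLG hLint hιC hM hιX hL1 T f (hmem T f hf)
      (fun h => hf0 (Subtype.ext h))
  · intro b
    rw [hrk, hg]; exact dim_low M hLfin hgenE hyW b
  · intro T
    rw [hrk, hg]; exact dim_up ι M hLfin hLG hLint hgenE hιC hM hιX hL1 T
  · rintro r hr
    by_cases h : r = 1
    · simp [h, s]
    · simp only [h, if_false]
      exact Set.mem_insert_of_mem _ (hτ r (hr.resolve_left h))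
  · rintro P hP r hr
    by_cases h : r = 1
    · simp [h]
    · simp only [h, if_false]
      exact hS P hP r (hr.resolve_left h)

end Dim
end PerAvg

set_option linter.unusedSectionVars false

namespace PerAvg
open Finset Polynomial

section Hensel
variable {k : Type} [Field k]

lemma hensel (P : (PowerSeries k)[X]) (hlc : IsUnit P.leadingCoeff) (a0 : k)
    (h0 : (P.map PowerSeries.constantCoeff).eval a0 = 0)
    (h1 : ((derivative P).map PowerSeries.constantCoeff).eval a0 ≠ 0) :
    ∃ a : PowerSeries k, P.eval a = 0 ∧ PowerSeries.constantCoeff a = a0 := by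
  have hH : HenselianRing (PowerSeries k) (Ideal.span {PowerSeries.X}) := inferInstance
  obtain ⟨u, hu⟩ := hlc
  set P' : (PowerSeries k)[X] := C (↑u⁻¹ : PowerSeries k) * P with hP'
  have hmonic : P'.Monic := by
    rw [Monic, hP', leadingCoeff_mul, leadingCoeff_C, ← hu]; simp
  have hev : ∀ R : (PowerSeries k)[X], PowerSeries.constantCoeff (R.eval (PowerSeries.C a0)) =
      (R.map PowerSeries.constantCoeff).eval a0 := by
    intro R
    have h2 := Polynomial.eval₂_at_apply (p := R) PowerSeries.constantCoeff (PowerSeries.C a0)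
    rw [eval_map]
    simpa using h2.symm
  have hunit : IsUnit (PowerSeries.constantCoeff (↑u⁻¹ : PowerSeries k)) := (Units.isUnit u⁻¹).map _
  obtain ⟨a, ha, ha'⟩ := hH.is_henselian P' hmonic (PowerSeries.C a0) (by
    rw [Ideal.mem_span_singleton, PowerSeries.X_dvd_iff, hP', eval_mul, eval_C, map_mul, hev, h0, mul_zero]) (by
    apply IsUnit.map
    rw [PowerSeries.isUnit_iff_constantCoeff, hP', derivative_C_mul, eval_mul, map_mul, eval_C, hev]
    exact hunit.mul (isUnit_iff_ne_zero.2 h1))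
  refine ⟨a, ?_, ?_⟩
  · have : P'.eval a = 0 := ha
    rw [hP', eval_mul, eval_C] at this
    exact (Units.mul_right_eq_zero u⁻¹).1 this
  · rw [Ideal.mem_span_singleton, PowerSeries.X_dvd_iff, map_sub, sub_eq_zero] at ha'
    simpa using ha'

end Hensel

section Iota
variable {k : Type} [Field k] [IsAlgClosed k]

lemma natDegree_fp {F : Type} [Field F] (j : k →+* F) (h : k[X]) (hM : 1 ≤ h.natDegree) (Y : F) :
    (h.map j - C Y).natDegree = h.natDegree := by
  rw [natDegree_sub_C, natDegree_map]

lemma fp_ne_zero {F : Type} [Field F] (j : k →+* F) (h : k[X]) (hM : 1 ≤ h.natDegree) (Y : F) :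
    h.map j - C Y ≠ 0 := by
  intro h0
  have := natDegree_fp j h hM Y
  rw [h0, natDegree_zero] at this
  omega

lemma splits_of_roots {F : Type} [Field F] (j : k →+* F) (h : k[X]) (hM : 1 ≤ h.natDegree) (Y : F)
    {n : Type} [Fintype n] (hn : Fintype.card n = h.natDegree) (r : n → F) (hr : Function.Injective r)
    (hroot : ∀ i, h.eval₂ j (r i) = Y) : (h.map j - C Y).Splits := by
  classical
  rw [splits_iff_card_roots]
  refine le_antisymm (card_roots' _) ?_
  rw [natDegree_fp j h hM Y]
  have : (Finset.univ.image r).val ≤ (h.map j - C Y).roots := by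
    rw [Multiset.le_iff_subset (Finset.nodup _)]
    intro x hx
    simp only [Finset.mem_val, mem_image, mem_univ, true_and] at hx
    obtain ⟨i, rfl⟩ := hx
    rw [mem_roots (fp_ne_zero j h hM Y)]
    simp [IsRoot, eval_map, hroot i]
  have h2 := Multiset.card_le_card this
  rw [Finset.card_val, Finset.card_image_of_injective _ hr, Finset.card_univ, hn] at h2
  exact h2

lemma laurent_roots_aux (h : k[X]) (hM : 1 ≤ h.natDegree) (hchar : (h.natDegree : k) ≠ 0) :
    ∃ (n : Type) (_ : Fintype n) (a : n → PowerSeries k), Fintype.card n = h.natDegree ∧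
      Function.Injective a ∧ ∀ i, (scaleRoots (h.map PowerSeries.C) PowerSeries.X).eval (a i) =
        (scaleRoots (h.map PowerSeries.C) PowerSeries.X).eval 1 := by
  classical
  set M := h.natDegree with hMdef
  have hh0 : h ≠ 0 := by rintro rfl; simp at hMdef; omega
  have hlc : h.leadingCoeff ≠ 0 := leadingCoeff_ne_zero.2 hh0
  set hp : (PowerSeries k)[X] := h.map PowerSeries.C with hhp
  have hpdeg : hp.natDegree = M := natDegree_map_eq_of_injective PowerSeries.C_injective h
  set SR := scaleRoots hp PowerSeries.X with hSR
  have hSRdeg : SR.natDegree = M := by rw [hSR, natDegree_scaleRoots, hpdeg]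
  set P := SR - C (SR.eval 1) with hP
  have hPdeg : P.natDegree = M := by rw [hP, natDegree_sub_C, hSRdeg]
  have hPlc : IsUnit P.leadingCoeff := by
    have : P.leadingCoeff = PowerSeries.C h.leadingCoeff := by
      rw [leadingCoeff, hPdeg, hP, coeff_sub, coeff_C, if_neg (by omega), sub_zero, hSR, coeff_scaleRoots, hpdeg,
        Nat.sub_self, pow_zero, mul_one, hhp, coeff_map]
      rfl
    rw [this, PowerSeries.isUnit_iff_constantCoeff]
    simpa using hlc
  have hSRred : SR.map PowerSeries.constantCoeff = C h.leadingCoeff * X ^ M := by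
    ext i
    rw [coeff_map, hSR, coeff_scaleRoots, hpdeg, hhp, coeff_map, coeff_C_mul, coeff_X_pow]
    rcases lt_trichotomy i M with hi | hi | hi
    · rw [if_neg hi.ne]; simp [Nat.sub_ne_zero_of_lt hi]
    · rw [if_pos hi, hi]; rw [Nat.sub_self, pow_zero, mul_one, mul_one, PowerSeries.constantCoeff_C]; rfl
    · rw [if_neg hi.ne', coeff_eq_zero_of_natDegree_lt (p := h) hi]; simp
  have hPred : P.map PowerSeries.constantCoeff = C h.leadingCoeff * X ^ M - C h.leadingCoeff := by
    rw [hP, Polynomial.map_sub, hSRred, map_C]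
    congr 2
    have : PowerSeries.constantCoeff (SR.eval 1) = (SR.map PowerSeries.constantCoeff).eval 1 := by
      have h2 := Polynomial.eval₂_at_apply (p := SR) PowerSeries.constantCoeff (1 : PowerSeries k)
      rw [eval_map, ← h2, map_one]
    rw [this, hSRred]; simp
  -- roots of unity
  have hsep : (X ^ M - 1 : k[X]).Separable := X_pow_sub_one_separable_iff.2 hchar
  have hcard : Fintype.card ((X ^ M - 1 : k[X]).rootSet k) = M := by
    rw [card_rootSet_eq_natDegree hsep (IsAlgClosed.splits _)]
    rw [show (X ^ M - 1 : k[X]) = X ^ M - C 1 by simp, natDegree_X_pow_sub_C]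
  have hlift : ∀ ζ : (X ^ M - 1 : k[X]).rootSet k, ∃ a : PowerSeries k,
      P.eval a = 0 ∧ PowerSeries.constantCoeff a = ζ := by
    rintro ⟨ζ, hζ⟩
    have hζ1 : ζ ^ M = 1 := by
      rw [mem_rootSet] at hζ
      simpa [sub_eq_zero] using hζ.2
    apply hensel P hPlc
    · rw [hPred]; simp [hζ1]
    · rw [← derivative_map, hPred]
      have hζ0 : ζ ≠ 0 := by rintro rfl; rw [zero_pow (by omega)] at hζ1; exact zero_ne_one hζ1
      have hd : derivative (C h.leadingCoeff * X ^ M - C h.leadingCoeff) =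
          C h.leadingCoeff * (C (M : k) * X ^ (M - 1)) := by
        rw [derivative_sub, derivative_C, sub_zero, derivative_C_mul, derivative_X_pow]
      rw [hd, eval_mul, eval_C, eval_mul, eval_C, eval_pow, eval_X]
      exact mul_ne_zero hlc (mul_ne_zero hchar (pow_ne_zero _ hζ0))
  choose a ha1 ha2 using hlift
  refine ⟨_, inferInstance, a, hcard, ?_, ?_⟩
  · intro ζ ζ' hζ
    apply Subtype.ext
    rw [← ha2 ζ, ← ha2 ζ', hζ]
  · intro ζ
    have h1 := ha1 ζ
    rwa [hP, eval_sub, eval_C, sub_eq_zero] at h1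

lemma laurent_ev {R : Type} [Field R] (f : PowerSeries k →+* R) (jC : k →+* R) (hfC : f.comp PowerSeries.C = jC)
    (u ui : R) (huui : u * ui = 1) (hfX : f PowerSeries.X = u) (h : k[X]) (b : PowerSeries k) :
    f ((scaleRoots (h.map PowerSeries.C) PowerSeries.X).eval b) =
      u ^ h.natDegree * h.eval₂ jC (f b * ui) := by
  have h1 := scaleRoots_eval₂_mul (p := h.map PowerSeries.C) f (f b * ui) PowerSeries.X
  rw [hfX, natDegree_map_eq_of_injective PowerSeries.C_injective h,
    show u * (f b * ui) = f b by rw [mul_left_comm, huui, mul_one], Polynomial.eval₂_at_apply,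
    eval₂_map, hfC] at h1
  exact h1

lemma laurent_roots_abs {R : Type} [Field R] (f : PowerSeries k →+* R) (jC : k →+* R)
    (hfC : f.comp PowerSeries.C = jC) (hfinj : Function.Injective f)
    (u ui : R) (huui : u * ui = 1) (hfX : f PowerSeries.X = u)
    (h : k[X]) (hM : 1 ≤ h.natDegree) (hchar : (h.natDegree : k) ≠ 0) :
    ((h.map jC) - C (h.eval₂ jC ui)).Splits := by
  obtain ⟨n, _, a, hcard, hinj, hroot⟩ := laurent_roots_aux h hM hchar
  refine splits_of_roots jC h hM _ hcard (fun ζ => f (a ζ) * ui) ?_ ?_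
  · intro ζ ζ' hζ
    have h1 := mul_right_cancel₀ (right_ne_zero_of_mul_eq_one huui) hζ
    exact hinj (hfinj h1)
  · intro ζ
    have h2 := laurent_ev f jC hfC u ui huui hfX h (a ζ)
    rw [hroot, laurent_ev f jC hfC u ui huui hfX h 1, map_one, one_mul] at h2
    have hu0 : u ^ h.natDegree ≠ 0 := pow_ne_zero _ (left_ne_zero_of_mul_eq_one huui)
    exact (mul_left_cancel₀ hu0 h2).symm

lemma laurent_roots (h : k[X]) (hM : 1 ≤ h.natDegree) (hchar : (h.natDegree : k) ≠ 0) :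
    ((h.map (HahnSeries.C : k →+* LaurentSeries k)) -
      C (h.eval₂ (HahnSeries.C : k →+* LaurentSeries k) (HahnSeries.single (-1) 1))).Splits := by
  have hfC : (HahnSeries.ofPowerSeries ℤ k).comp PowerSeries.C = HahnSeries.C :=
    RingHom.ext fun c => HahnSeries.ofPowerSeries_C c
  have huui : (HahnSeries.single 1 1 : LaurentSeries k) * HahnSeries.single (-1) 1 = 1 := by
    rw [HahnSeries.single_mul_single]; simp
  exact laurent_roots_abs (HahnSeries.ofPowerSeries ℤ k) HahnSeries.C hfC
    HahnSeries.ofPowerSeries_injective _ _ huui HahnSeries.ofPowerSeries_X h hM hchar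

variable {E K : Type} [Field E] [Field K] [Algebra k[X] E] [IsFractionRing k[X] E]
  [Algebra k E] [IsScalarTower k k[X] E] [Algebra E K] [Algebra k[X] K] [Algebra k K]
  [IsScalarTower k[X] E K] [IsScalarTower k k[X] K] [IsScalarTower k E K]

/-- general extension of embeddings to the splitting field -/
lemma exists_extend {F : Type} [Field F] (h : k[X]) 
    [IsSplittingField E K (h.map (algebraMap k E) - C (algebraMap k[X] E X))]
    (κ : k[X] →+* F) (hκ : Function.Injective κ)
    (hsp : (h.map (κ.comp C) - C (κ X)).Splits) :
    ∃ ι : K →+* F, ∀ P, ι (algebraMap k[X] K P) = κ P := by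
  let ψ : E →+* F := IsFractionRing.lift hκ
  letI : Algebra E F := ψ.toAlgebra
  have hψ : ∀ P, ψ (algebraMap k[X] E P) = κ P := IsFractionRing.lift_algebraMap hκ
  have hsp' : ((h.map (algebraMap k E) - C (algebraMap k[X] E X)).map (algebraMap E F)).Splits := by
    have : (h.map (algebraMap k E) - C (algebraMap k[X] E X)).map (algebraMap E F) =
        h.map (κ.comp C) - C (κ X) := by
      rw [Polynomial.map_sub, Polynomial.map_map, map_C]
      congr 2
      · ext c
        change ψ (algebraMap k E c) = _
        rw [IsScalarTower.algebraMap_apply k k[X] E, hψ]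
        rfl
      · exact hψ X
    rw [this]; exact hsp
  let lift := IsSplittingField.lift K (h.map (algebraMap k E) - C (algebraMap k[X] E X)) hsp'
  refine ⟨lift.toRingHom, fun P => ?_⟩
  rw [IsScalarTower.algebraMap_apply k[X] E K]
  exact (lift.commutes _).trans (hψ P)

lemma exists_iota (h : k[X]) (hM : 1 ≤ h.natDegree) (hchar : (h.natDegree : k) ≠ 0)
    [IsSplittingField E K (h.map (algebraMap k E) - C (algebraMap k[X] E X))] :
    ∃ ι : K →+* LaurentSeries k, (∀ c, ι (algebraMap k K c) = HahnSeries.C c) ∧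
      (ι (algebraMap k[X] K X)).order = -(h.natDegree : ℤ) ∧
      ∀ r, aeval r h = algebraMap k[X] K X → OrdGe (-1) (ι r) := by
  have hh0 : h ≠ 0 := by rintro rfl; simp at hM
  have hgen : ∀ (ρ : LaurentSeries k) (e : ℕ), 1 ≤ e → ρ.order = -(e : ℤ) → ∀ P : k[X], P ≠ 0 →
      (P.eval₂ HahnSeries.C ρ).order = -((e : ℤ) * P.natDegree) ∧ P.eval₂ HahnSeries.C ρ ≠ 0 := by
    intro ρ e he hρ P hP
    exact order_poly (eval₂RingHom HahnSeries.C ρ) (by simp) e he (by simpa using hρ) _ P rfl hP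
  have hui : (HahnSeries.single (-1) 1 : LaurentSeries k).order = -((1 : ℕ) : ℤ) := by
    rw [HahnSeries.order_single one_ne_zero]; simp
  set Y := h.eval₂ (HahnSeries.C : k →+* LaurentSeries k) (HahnSeries.single (-1) 1) with hY
  have hYord : Y.order = -(h.natDegree : ℤ) := by
    rw [(hgen _ 1 le_rfl hui h hh0).1]; simp
  set κ : k[X] →+* LaurentSeries k := eval₂RingHom HahnSeries.C Y with hκ
  have hκinj : Function.Injective κ := by
    rw [injective_iff_map_eq_zero]
    intro P hP
    by_contra hP0
    exact (hgen Y h.natDegree hM hYord P hP0).2 hP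
  have hκC : κ.comp C = HahnSeries.C := by ext c; simp [hκ]
  have hκX : κ X = Y := by simp [hκ]
  obtain ⟨ι, hι⟩ := exists_extend (E := E) (K := K) h κ hκinj (by
    rw [hκC, hκX]; exact laurent_roots h hM hchar)
  have hιC : ∀ c, ι (algebraMap k K c) = HahnSeries.C c := by
    intro c
    rw [IsScalarTower.algebraMap_apply k k[X] K, hι]
    simp [hκ]
  refine ⟨ι, hιC, ?_, ?_⟩
  · rw [hι, hκX, hYord]
  · intro r hr
    by_cases h0 : ι r = 0
    · exact Or.inl h0
    right
    by_contra hlt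
    push Not at hlt
    obtain ⟨e, he⟩ : ∃ e : ℕ, (ι r).order = -(e : ℤ) := ⟨((ι r).order).natAbs, by omega⟩
    have h2 := (hgen (ι r) e (by omega) he h hh0).1
    have h3 : h.eval₂ HahnSeries.C (ι r) = Y := by
      have := congrArg ι hr
      rw [hι, hκX, aeval_def, Polynomial.hom_eval₂] at this
      rw [← this]
      congr 1
      exact RingHom.ext fun c => (hιC c).symm
    rw [h3, hYord] at h2
    have he2 : (2 : ℤ) ≤ e := by omega
    have : (1 : ℤ) ≤ h.natDegree := by exact_mod_cast hM
    nlinarith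

end Iota
end PerAvg

set_option linter.unusedSectionVars false

namespace PerAvg
open Finset Polynomial

section Inv
variable {k A G : Type} [Field k] [IsAlgClosed k] [CommRing A] [IsDomain A] [Algebra k[X] A]
  [Algebra k A] [IsScalarTower k k[X] A] [Group G] [Fintype G] [MulSemiringAction G A]
  [SMulCommClass G k[X] A] [Algebra.IsInvariant k[X] A G]

lemma conj_places (G : Type) [Group G] [Fintype G] [MulSemiringAction G A]
    [SMulCommClass G k[X] A] [Algebra.IsInvariant k[X] A G]
    (P1 P2 : A →+* k) (hag : ∀ f : k[X], P1 (algebraMap k[X] A f) = P2 (algebraMap k[X] A f))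
    (hsurj : ∀ a : k, ∃ c : k, P2 (algebraMap k A c) = a) :
    ∃ σ : G, ∀ x, P2 x = P1 (σ • x) := by
  have hp1 : (RingHom.ker P1).IsPrime := RingHom.ker_isPrime P1
  have hp2 : (RingHom.ker P2).IsPrime := RingHom.ker_isPrime P2
  have hu : (RingHom.ker P1).under k[X] = (RingHom.ker P2).under k[X] := by
    ext f
    rw [Ideal.mem_comap, Ideal.mem_comap, RingHom.mem_ker, RingHom.mem_ker, hag]
  obtain ⟨g, hg⟩ := Algebra.IsInvariant.exists_smul_of_under_eq k[X] A G _ _ hu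
  refine ⟨g⁻¹, fun x => ?_⟩
  obtain ⟨c, hc⟩ := hsurj (P2 x)
  have h1 : x - algebraMap k A c ∈ RingHom.ker P2 := by
    rw [RingHom.mem_ker, map_sub, hc, sub_self]
  rw [hg, Ideal.mem_pointwise_smul_iff_inv_smul_mem, RingHom.mem_ker, smul_sub, map_sub, sub_eq_zero] at h1
  rw [h1, ← hc, IsScalarTower.algebraMap_apply k k[X] A, smul_algebraMap, hag]

lemma exists_place (G : Type) [Group G] [Fintype G] [MulSemiringAction G A]
    [SMulCommClass G k[X] A] [Algebra.IsInvariant k[X] A G]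
    (hinj : Function.Injective (algebraMap k[X] A)) (y1 : k) :
    ∃ P : A →ₐ[k] k, P (algebraMap k[X] A X) = y1 := by
  have hint : Algebra.IsIntegral k[X] A := Algebra.IsInvariant.isIntegral k[X] A G
  let I : Ideal k[X] := RingHom.ker (evalRingHom y1)
  have hI : I.IsMaximal := RingHom.ker_isMaximal_of_surjective _ (fun a => ⟨C a, by simp⟩)
  obtain ⟨Q, hQ, hQI⟩ := Ideal.exists_ideal_over_maximal_of_isIntegral (S := A) I (by
    rw [(RingHom.injective_iff_ker_eq_bot _).1 hinj]; exact bot_le)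
  have hmem : ∀ f : k[X], Ideal.Quotient.mk Q (algebraMap k[X] A f) =
      algebraMap k (A ⧸ Q) (f.eval y1) := by
    intro f
    have h1 : f - C (f.eval y1) ∈ I := by
      rw [RingHom.mem_ker]; simp
    rw [← hQI, Ideal.mem_comap, map_sub, ← Ideal.Quotient.eq_zero_iff_mem, map_sub, sub_eq_zero] at h1
    rw [h1, show (C (f.eval y1) : k[X]) = algebraMap k k[X] (f.eval y1) from rfl,
      ← IsScalarTower.algebraMap_apply k k[X] A]
    rfl
  have hdom : IsDomain (A ⧸ Q) := Ideal.Quotient.isDomain Q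
  have hint2 : Algebra.IsIntegral k (A ⧸ Q) := by
    refine ⟨fun a => ?_⟩
    obtain ⟨a, rfl⟩ := Ideal.Quotient.mk_surjective a
    obtain ⟨p, hp, hpa⟩ := hint.isIntegral a
    refine ⟨p.map (evalRingHom y1), hp.map _, ?_⟩
    rw [eval₂_map]
    have h2 := congrArg (Ideal.Quotient.mk Q) hpa
    rw [Polynomial.hom_eval₂, map_zero] at h2
    rw [← h2]
    congr 1
    exact RingHom.ext fun f => (hmem f).symm
  have hbij := IsAlgClosed.algebraMap_bijective_of_isIntegral (k := k) (K := A ⧸ Q)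
  let e := AlgEquiv.ofBijective (Algebra.ofId k (A ⧸ Q)) hbij
  refine ⟨(e.symm : (A ⧸ Q) →ₐ[k] k).comp (Ideal.Quotient.mkₐ k Q), ?_⟩
  change e.symm (Ideal.Quotient.mk Q (algebraMap k[X] A X)) = y1
  rw [hmem, eval_X]
  exact e.symm_apply_apply y1

lemma place_eval (P : A →ₐ[k] k) (f : k[X]) :
    P (algebraMap k[X] A f) = f.eval (P (algebraMap k[X] A X)) := by
  have : (P.toRingHom.comp (algebraMap k[X] A)) = evalRingHom (P (algebraMap k[X] A X)) := by
    apply Polynomial.ringHom_ext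
    · intro c
      simp only [AlgHom.toRingHom_eq_coe, RingHom.coe_comp, Function.comp, coe_evalRingHom, eval_C]
      rw [show (C c : k[X]) = algebraMap k k[X] c from rfl, ← IsScalarTower.algebraMap_apply k k[X] A]
      simp
    · simp
  exact congrArg (fun h => h f) this

lemma orbit_prod (G : Type) [Group G] [Fintype G] [MulSemiringAction G A]
    [SMulCommClass G k[X] A] [Algebra.IsInvariant k[X] A G] [DecidableEq A] (x : A) : ∃ f : k[X], algebraMap k[X] A f =
    ∏ s ∈ univ.image (fun σ : G => σ • x), s := by
  obtain ⟨f, hf⟩ := Algebra.IsInvariant.isInvariant (A := k[X]) (G := G)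
    (∏ s ∈ univ.image (fun σ : G => σ • x), s) (by
      intro g
      rw [smul_prod']
      refine prod_bij (fun s _ => g • s) ?_ ?_ ?_ ?_
      · intro s hs
        simp only [mem_image, mem_univ, true_and] at hs ⊢
        obtain ⟨σ, rfl⟩ := hs
        exact ⟨g * σ, mul_smul _ _ _⟩
      · intro a _ b _ h
        exact (MulAction.injective g) h
      · intro s hs
        simp only [mem_image, mem_univ, true_and] at hs ⊢
        obtain ⟨σ, rfl⟩ := hs
        exact ⟨g⁻¹ • σ • x, ⟨g⁻¹ * σ, mul_smul _ _ _⟩, smul_inv_smul _ _⟩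
      · intro s _; rfl)
  exact ⟨f, hf⟩

lemma orbit_divides (P : A →ₐ[k] k) (x : A) (hx : P x = 0)
    (hτ : ∀ τ : G, τ • x ≠ x → P (τ • x) ≠ 0) :
    ∃ w g : A, P w ≠ 0 ∧ x * w = (algebraMap k[X] A X - algebraMap k A (P (algebraMap k[X] A X))) * g := by
  classical
  obtain ⟨f, hf⟩ := orbit_prod (k := k) G x
  have hmem : x ∈ univ.image (fun σ : G => σ • x) := mem_image.2 ⟨1, mem_univ _, one_smul _ _⟩
  rw [← mul_prod_erase _ _ hmem] at hf
  have hPf : f.eval (P (algebraMap k[X] A X)) = 0 := by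
    rw [← place_eval, hf, map_mul, hx, zero_mul]
  obtain ⟨g, hg⟩ := dvd_iff_isRoot.2 hPf
  refine ⟨∏ s ∈ (univ.image (fun σ : G => σ • x)).erase x, s, algebraMap k[X] A g, ?_, ?_⟩
  · rw [map_prod, prod_ne_zero_iff]
    intro s hs
    simp only [mem_erase, mem_image, mem_univ, true_and] at hs
    obtain ⟨hne, σ, rfl⟩ := hs
    exact hτ σ hne
  · rw [← hf, hg, map_mul, map_sub, IsScalarTower.algebraMap_apply k k[X] A]
    rfl

/-- the place `P ∘ σ` -/
def actPlace (hC : ∀ (σ : G) (c : k), σ • algebraMap k A c = algebraMap k A c) (P : A →ₐ[k] k) (σ : G) :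
    A →ₐ[k] k :=
  { P.toRingHom.comp (MulSemiringAction.toRingHom G A σ) with
    commutes' := fun c => by
      change P (σ • algebraMap k A c) = c
      rw [hC]; simp }

lemma smul_const (σ : G) (c : k) : σ • algebraMap k A c = algebraMap k A c := by
  rw [IsScalarTower.algebraMap_apply k k[X] A, smul_algebraMap]

lemma exists_v (P : A →ₐ[k] k) : ∃ v : A, P v = 0 ∧
    (∀ σ : G, (∀ x, P (σ • x) = P x) → σ • v = v) ∧
    (∀ σ : G, ¬ (∀ x, P (σ • x) = P x) → P (σ • v) = 1) := by
  classical
  let aP : G → (A →ₐ[k] k) := actPlace (fun σ c => smul_const (k := k) (A := A) σ c) P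
  have haP : ∀ σ x, aP σ x = P (σ • x) := fun σ x => rfl
  let Z : Finset (A →ₐ[k] k) := univ.image aP
  obtain ⟨T0, hT⟩ := exists_interp (k := k) (A := A) (s := Set.univ) (Set.mem_univ _)
    (by rw [Algebra.adjoin_univ]) Z
  obtain ⟨e, -, he⟩ := hT T0 le_rfl (fun R => if R.1 = P then 0 else 1)
  have he2 : ∀ σ, P (σ • e) = if aP σ = P then 0 else 1 := by
    intro σ
    exact he ⟨aP σ, mem_image.2 ⟨σ, mem_univ _, rfl⟩⟩
  have hiff : ∀ σ, aP σ = P ↔ ∀ x, P (σ • x) = P x := by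
    intro σ
    constructor
    · intro h x; rw [← haP, h]
    · intro h; exact AlgHom.ext fun x => h x
  set D : Finset G := univ.filter (fun σ => ∀ x, P (σ • x) = P x) with hD
  have hmemD : ∀ σ, σ ∈ D ↔ ∀ x, P (σ • x) = P x := by intro σ; simp [hD]
  refine ⟨∏ σ ∈ D, σ • e, ?_, ?_, ?_⟩
  · rw [map_prod]
    refine prod_eq_zero (i := 1) ((hmemD 1).2 fun x => by rw [one_smul]) ?_
    rw [he2, if_pos ((hiff 1).2 fun x => by rw [one_smul])]
  · intro τ hτ
    rw [smul_prod']
    refine prod_bij (fun σ _ => τ * σ) ?_ ?_ ?_ ?_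
    · intro σ hσ
      rw [hmemD] at hσ ⊢
      intro x; rw [mul_smul, hτ, hσ]
    · intro a _ b _ h; exact mul_left_cancel h
    · intro σ hσ
      refine ⟨τ⁻¹ * σ, ?_, by simp⟩
      rw [hmemD] at hσ ⊢
      intro x
      rw [← hτ, ← mul_smul, mul_inv_cancel_left, hσ]
    · intro σ _; rw [mul_smul]
  · intro τ hτ
    rw [smul_prod', map_prod]
    refine prod_eq_one fun σ hσ => ?_
    rw [hmemD] at hσ
    rw [← mul_smul, he2, if_neg]
    intro h
    rw [hiff] at h
    apply hτ
    intro x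
    have := h (σ⁻¹ • x)
    rw [← mul_smul, mul_inv_cancel_right] at this
    rw [this, ← hσ, smul_inv_smul]

lemma inertia (P : A →ₐ[k] k) (r u : A)
    (hru : algebraMap k[X] A X - algebraMap k A (P (algebraMap k[X] A X)) =
      (r - algebraMap k A (P r)) ^ 2 * u) (hr0 : r - algebraMap k A (P r) ≠ 0) :
    ∃ σ : G, (∀ x, P (σ • x) = P x) ∧ σ • r ≠ r := by
  by_contra hcon
  push Not at hcon
  obtain ⟨v, hv0, hv1, hv2⟩ := exists_v (k := k) (G := G) P
  have key : ∀ x : A, P x = 0 → (∀ σ : G, (∀ x, P (σ • x) = P x) → σ • x = x) →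
    (∀ σ : G, ¬ (∀ x, P (σ • x) = P x) → P (σ • x) = 1) → ∃ w g : A, P w ≠ 0 ∧
      x * w = (r - algebraMap k A (P r)) ^ 2 * g := by
    intro x h0 h1 h2
    obtain ⟨w, g, hw, hwg⟩ := orbit_divides (G := G) P x h0 (by
      intro τ hτ
      rw [h2 τ (fun h => hτ (h1 τ h))]; exact one_ne_zero)
    exact ⟨w, u * g, hw, by rw [hwg, hru, mul_assoc]⟩
  set c := algebraMap k A (P r) with hc
  have hPc : P c = P r := by rw [hc]; simp
  obtain ⟨w1, g1, hw1, h1⟩ := key v hv0 hv1 hv2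
  obtain ⟨w2, g2, hw2, h2⟩ := key ((r - c) * (1 - v) + v) (by simp [hPc, hv0])
    (by
      intro σ hσ
      rw [smul_add, smul_mul', smul_sub, smul_sub, smul_one, hv1 σ hσ, hcon σ hσ, hc, smul_const])
    (by
      intro σ hσ
      rw [smul_add, smul_mul', smul_sub, smul_sub, smul_one, map_add, map_mul, map_sub P 1, hv2 σ hσ]
      simp)
  have h3 : (r - c) * ((1 - v) * (w1 * w2)) = (r - c) * ((r - c) * (g2 * w1 - g1 * w2)) := by
    linear_combination w1 * h2 - w2 * h1
  have h4 := congrArg P (mul_left_cancel₀ hr0 h3)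
  simp only [map_mul, map_sub, map_one, hv0, hPc, sub_self, zero_mul, sub_zero, one_mul] at h4
  exact mul_ne_zero hw1 hw2 h4

lemma place_roots (P : A →ₐ[k] k) (h : k[X]) (L : Finset A) (h0 : h ≠ 0)
    (hL : h.map (algebraMap k A) - C (algebraMap k[X] A X) =
      C (algebraMap k A h.leadingCoeff) * ∏ r ∈ L, (X - C r)) :
    (h - C (P (algebraMap k[X] A X))).roots = L.val.map P := by
  have h1 := congrArg (Polynomial.map P.toRingHom) hL
  rw [Polynomial.map_sub, Polynomial.map_map, map_C, Polynomial.map_mul, map_C, Polynomial.map_prod] at h1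
  have hid : P.toRingHom.comp (algebraMap k A) = RingHom.id k := RingHom.ext fun c => by simp
  have hlc : P.toRingHom (algebraMap k A h.leadingCoeff) = h.leadingCoeff := by simp
  rw [hid, Polynomial.map_id, hlc] at h1
  change h - C (P (algebraMap k[X] A X)) = _ at h1
  rw [h1, roots_C_mul _ (leadingCoeff_ne_zero.2 h0)]
  have : ∏ r ∈ L, Polynomial.map P.toRingHom (X - C r) = ((L.val.map P).map fun a => X - C a).prod := by
    rw [Multiset.map_map, Finset.prod]
    congr 1
    apply Multiset.map_congr rfl
    intro r _
    simp
  rw [this, roots_multiset_prod_X_sub_C]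

lemma swap_exists (hinj : Function.Injective (algebraMap k[X] A)) (h : k[X]) (L : Finset A) (h0 : 1 ≤ h.natDegree)
    (hL : h.map (algebraMap k A) - C (algebraMap k[X] A X) =
      C (algebraMap k A h.leadingCoeff) * ∏ r ∈ L, (X - C r))
    (hG : ∀ g : G, ∀ y ∈ L, g • y ∈ L) (c : k) (hc1 : (derivative h).eval c = 0)
    (hc2 : (derivative (derivative h)).eval c ≠ 0)
    (hc3 : ∀ x, x ≠ c → h.eval x = h.eval c → (derivative h).eval x ≠ 0) :
    ∃ a ∈ L, ∃ b ∈ L, a ≠ b ∧ ∃ s : G, s • a = b ∧ s • b = a ∧ ∀ y ∈ L, y ≠ a → y ≠ b → s • y = y := by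
  classical
  have hh0 : h ≠ 0 := by rintro rfl; simp at h0
  obtain ⟨P, hP⟩ := exists_place (A := A) G hinj (h.eval c)
  set f := h - C (h.eval c) with hf
  have hf0 : f ≠ 0 := by
    intro h1
    have : f.natDegree = h.natDegree := natDegree_sub_C
    rw [h1, natDegree_zero] at this; omega
  have hroots : f.roots = L.val.map P := by rw [hf, ← hP]; exact place_roots P h L hh0 hL
  have hdf : derivative f = derivative h := by simp [hf]
  have hcount : ∀ x, f.rootMultiplicity x = (L.filter (fun r => P r = x)).card := by
    intro x
    rw [← count_roots, hroots, Multiset.count_map, Finset.card_def, Finset.filter_val]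
    congr 1
    apply Multiset.filter_congr
    intro r _; exact eq_comm
  have hfc : f.IsRoot c := by simp [hf]
  obtain ⟨f1, hf1⟩ := dvd_iff_isRoot.2 hfc
  have hf1c : f1.IsRoot c := by
    have h1 := congrArg (fun p => (derivative p).eval c) hf1
    simp only [hdf, hc1, derivative_mul, eval_add, eval_mul] at h1
    simpa using h1.symm
  obtain ⟨u, hu⟩ := dvd_iff_isRoot.2 hf1c
  have hfu : f = (X - C c) ^ 2 * u := by rw [hf1, hu]; ring
  have huc : u.eval c ≠ 0 := by
    intro h1
    apply hc2
    rw [← hdf, hfu]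
    simp [derivative_mul, derivative_pow, h1]
  have hmulc : f.rootMultiplicity c = 2 := by
    have hu0 : u ≠ 0 := by rintro rfl; simp at huc
    rw [hfu, rootMultiplicity_mul (by rw [← hfu]; exact hf0), rootMultiplicity_X_sub_C_pow,
      rootMultiplicity_eq_zero huc]
  have hmulx : ∀ x, x ≠ c → f.rootMultiplicity x ≤ 1 := by
    intro x hx
    by_contra hlt
    push Not at hlt
    rw [one_lt_rootMultiplicity_iff_isRoot hf0] at hlt
    refine hc3 x hx ?_ ?_
    · have := hlt.1
      simpa [hf, sub_eq_zero] using this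
    · rw [← hdf]; exact hlt.2
  have h2 := hcount c
  rw [hmulc] at h2
  obtain ⟨a, b, hab, hLab⟩ := Finset.card_eq_two.1 h2.symm
  have hmem : ∀ x, x ∈ L ∧ P x = c ↔ x = a ∨ x = b := by
    intro x
    have : x ∈ L.filter (fun r => P r = c) ↔ x ∈ ({a, b} : Finset A) := by rw [hLab]
    simpa using this
  have haL := (hmem a).2 (Or.inl rfl)
  have hbL := (hmem b).2 (Or.inr rfl)
  have hrootL : ∀ r ∈ L, h.eval₂ (algebraMap k A) r = algebraMap k[X] A X := by
    intro r hr
    have h1 := congrArg (Polynomial.eval r) hL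
    rw [eval_sub, eval_map, eval_C, eval_mul, eval_prod, Finset.prod_eq_zero hr (by simp), mul_zero, sub_eq_zero] at h1
    exact h1
  obtain ⟨σ, hσP, hσa⟩ := inertia (G := G) P a (u.eval₂ (algebraMap k A) a) (by
    rw [haL.2, hP]
    have h1 := congrArg (Polynomial.eval₂ (algebraMap k A) a) hfu
    rw [hf, eval₂_sub, hrootL a haL.1, eval₂_C, eval₂_mul, eval₂_pow, eval₂_sub, eval₂_X, eval₂_C] at h1
    exact h1) (by
    intro h1
    rw [sub_eq_zero, haL.2] at h1
    have h2 := hrootL a haL.1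
    rw [h1, eval₂_at_apply, IsScalarTower.algebraMap_apply k k[X] A] at h2
    have h3 := congrArg natDegree (hinj h2)
    rw [natDegree_X, show algebraMap k k[X] (h.eval c) = C (h.eval c) from rfl, natDegree_C] at h3
    omega)
  have hσab : σ • a = b := by
    rcases (hmem (σ • a)).1 ⟨hG σ a haL.1, by rw [hσP, haL.2]⟩ with h1 | h1
    · exact absurd h1 hσa
    · exact h1
  refine ⟨a, haL.1, b, hbL.1, hab, σ, hσab, ?_, ?_⟩
  · rcases (hmem (σ • b)).1 ⟨hG σ b hbL.1, by rw [hσP, hbL.2]⟩ with h1 | h1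
    · exact h1
    · exact absurd (MulAction.injective σ (hσab.trans h1.symm)) hab
  · intro y hy hya hyb
    have hyc : P y ≠ c := by
      intro h1
      rcases (hmem y).1 ⟨hy, h1⟩ with h2 | h2
      · exact hya h2
      · exact hyb h2
    have h3 := hmulx _ hyc
    rw [hcount, Finset.card_le_one] at h3
    exact h3 _ (by simp [hG σ y hy, hσP]) _ (by simp [hy])

end Inv
end PerAvg

set_option linter.unusedSectionVars false

namespace PerAvg
open Finset Polynomial

section Count
variable {k A G : Type} [Field k] [IsAlgClosed k] [CommRing A] [IsDomain A] [Algebra k[X] A]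
  [Algebra k A] [IsScalarTower k k[X] A] [Group G] [Fintype G] [MulSemiringAction G A]
  [SMulCommClass G k[X] A] [Algebra.IsInvariant k[X] A G]

lemma place_inj (P : A →ₐ[k] k) (h : k[X]) (L : Finset A) (h0 : 1 ≤ h.natDegree)
    (hL : h.map (algebraMap k A) - C (algebraMap k[X] A X) =
      C (algebraMap k A h.leadingCoeff) * ∏ r ∈ L, (X - C r))
    (hsep : ∀ x, h.eval x = P (algebraMap k[X] A X) → (derivative h).eval x ≠ 0) :
    (∀ a ∈ L, ∀ b ∈ L, P a = P b → a = b) ∧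
    ∀ x, h.eval x = P (algebraMap k[X] A X) → ∃ r ∈ L, P r = x := by
  classical
  have hh0 : h ≠ 0 := by rintro rfl; simp at h0
  have hroots := place_roots P h L hh0 hL
  set f := h - C (P (algebraMap k[X] A X)) with hf
  have hf0 : f ≠ 0 := by
    intro h1
    have : f.natDegree = h.natDegree := natDegree_sub_C
    rw [h1, natDegree_zero] at this; omega
  have hnd : f.roots.Nodup := by
    rw [Multiset.nodup_iff_count_le_one]
    intro x
    rw [count_roots]
    by_contra hlt
    push Not at hlt
    rw [one_lt_rootMultiplicity_iff_isRoot hf0] at hlt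
    refine hsep x ?_ ?_
    · have := hlt.1
      simpa [hf, sub_eq_zero] using this
    · have := hlt.2
      simpa [hf] using this
  rw [hroots] at hnd
  refine ⟨fun a ha b hb hab => Multiset.inj_on_of_nodup_map hnd a ha b hb hab, ?_⟩
  intro x hx
  have : x ∈ f.roots := by
    rw [mem_roots hf0]; simp [hf, hx]
  rw [hroots, Multiset.mem_map] at this
  exact this

lemma frob_place (G : Type) [Group G] [Fintype G] [MulSemiringAction G A]
    [SMulCommClass G k[X] A] [Algebra.IsInvariant k[X] A G]
    (p e : ℕ) [Fact p.Prime] [CharP k p] (Ψ : A →+* A)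
    (hΨC : ∀ c, Ψ (algebraMap k A c) = algebraMap k A (c ^ (p ^ e)))
    (hΨX : Ψ (algebraMap k[X] A X) = algebraMap k[X] A X) (R : A →ₐ[k] k)
    (hR : R (algebraMap k[X] A X) ^ (p ^ e) = R (algebraMap k[X] A X)) :
    ∃ σ : G, ∀ x, R x ^ (p ^ e) = R (Ψ (σ • x)) := by
  have hpe : 0 < p ^ e := pow_pos (Fact.out : p.Prime).pos e
  obtain ⟨σ, hσ⟩ := conj_places (k := k) G (R.toRingHom.comp Ψ) ((iterateFrobenius k p e).comp R.toRingHom) (by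
    intro f
    have : (R.toRingHom.comp Ψ).comp (algebraMap k[X] A) =
        ((iterateFrobenius k p e).comp R.toRingHom).comp (algebraMap k[X] A) := by
      apply Polynomial.ringHom_ext
      · intro c
        simp only [AlgHom.toRingHom_eq_coe, RingHom.coe_comp, Function.comp]
        rw [show (C c : k[X]) = algebraMap k k[X] c from rfl, ← IsScalarTower.algebraMap_apply k k[X] A, hΨC]
        simp [iterateFrobenius_def]
      · simp [hΨX, iterateFrobenius_def, hR]
    exact congrArg (fun h => h f) this) (by
    intro a
    obtain ⟨c, hc⟩ := IsAlgClosed.exists_pow_nat_eq a hpe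
    refine ⟨c, ?_⟩
    simp [iterateFrobenius_def, hc])
  refine ⟨σ, fun x => ?_⟩
  have := hσ x
  simpa [iterateFrobenius_def] using this

lemma count_places [DecidableEq A] (hinj : Function.Injective (algebraMap k[X] A)) (h : k[X]) (L : Finset A) (h0 : 1 ≤ h.natDegree)
    (hL : h.map (algebraMap k A) - C (algebraMap k[X] A X) =
      C (algebraMap k A h.leadingCoeff) * ∏ r ∈ L, (X - C r))
    (hG : ∀ g : G, ∀ y ∈ L, g • y ∈ L) (hfaith : ∀ g g' : G, (∀ y ∈ L, g • y = g' • y) → g = g')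
    (p e : ℕ) [Fact p.Prime] [CharP k p] (Ψ : A →+* A)
    (hΨC : ∀ c, Ψ (algebraMap k A c) = algebraMap k A (c ^ (p ^ e)))
    (hΨX : Ψ (algebraMap k[X] A X) = algebraMap k[X] A X) (hΨL : ∀ r ∈ L, Ψ r ∈ L)
    (B : ℕ) (hB : ∀ (S : Finset (A →ₐ[k] k)) (τ : A → A), (∀ r ∈ L, τ r ∈ L) →
      (∀ P ∈ S, ∀ r ∈ L, P r ^ (p ^ e) = P (τ r)) → S.card ≤ B)
    (Y0 : Finset k) (hY1 : ∀ y ∈ Y0, y ^ (p ^ e) = y)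
    (hY2 : ∀ y ∈ Y0, ∃ x, x ^ (p ^ e) = x ∧ h.eval x = y)
    (hY3 : ∀ y ∈ Y0, ∀ x, h.eval x = y → (derivative h).eval x ≠ 0) :
    Y0.card * Fintype.card G ≤ B * (univ.filter (fun g : G => ∃ r ∈ L, g • Ψ r = r)).card := by
  classical
  choose P hP using exists_place (A := A) (k := k) G hinj
  let R : k × G → (A →ₐ[k] k) := fun z => actPlace (fun σ c => smul_const (k := k) (A := A) σ c) (P z.1) z.2
  have hR : ∀ z x, R z x = P z.1 (z.2 • x) := fun z x => rfl
  have hRX : ∀ z, R z (algebraMap k[X] A X) = z.1 := by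
    intro z
    rw [hR, smul_algebraMap, hP]
  have hex : ∀ z : k × G, ∃ σ : G, z.1 ∈ Y0 → ∀ x, R z x ^ (p ^ e) = R z (Ψ (σ • x)) := by
    intro z
    by_cases hz : z.1 ∈ Y0
    · obtain ⟨σ, hσ⟩ := frob_place G p e Ψ hΨC hΨX (R z) (by rw [hRX]; exact hY1 _ hz)
      exact ⟨σ, fun _ => hσ⟩
    · exact ⟨1, fun h => absurd h hz⟩
  choose sg hsg using hex
  have hinjL : ∀ z : k × G, z.1 ∈ Y0 → (∀ a ∈ L, ∀ b ∈ L, R z a = R z b → a = b) ∧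
      ∀ x, h.eval x = z.1 → ∃ r ∈ L, R z r = x := by
    intro z hz
    have := place_inj (R z) h L h0 hL (by rw [hRX]; exact hY3 _ hz)
    rw [hRX] at this
    exact this
  have hmaps : ∀ z ∈ Y0 ×ˢ (univ : Finset G), sg z ∈ univ.filter (fun g : G => ∃ r ∈ L, g • Ψ r = r) := by
    intro z hz
    have hz1 : z.1 ∈ Y0 := (mem_product.1 hz).1
    rw [mem_filter]
    refine ⟨mem_univ _, ?_⟩
    obtain ⟨x, hx1, hx2⟩ := hY2 _ hz1
    obtain ⟨r, hr, rfl⟩ := (hinjL z hz1).2 x hx2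
    have h1 := hsg z hz1 r
    rw [hx1] at h1
    have h2 := (hinjL z hz1).1 _ hr _ (hΨL _ (hG _ _ hr)) h1
    exact ⟨sg z • r, hG _ _ hr, by rw [← h2]⟩
  have hfib : ∀ σ ∈ univ.filter (fun g : G => ∃ r ∈ L, g • Ψ r = r),
      ((Y0 ×ˢ (univ : Finset G)).filter (fun z => sg z = σ)).card ≤ B := by
    intro σ _
    rw [← Finset.card_image_of_injOn (f := R)]
    · refine hB _ (fun r => Ψ (σ • r)) (fun r hr => hΨL _ (hG _ _ hr)) ?_
      intro T hT r hr
      obtain ⟨z, hz, rfl⟩ := mem_image.1 hT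
      rw [mem_filter, mem_product] at hz
      rw [hsg z hz.1.1 r, hz.2]
    · intro z hz z' hz' hzz
      have hz := mem_filter.1 (mem_coe.1 hz)
      have hz' := mem_filter.1 (mem_coe.1 hz')
      rw [mem_product] at hz hz'
      have h1 : z.1 = z'.1 := by rw [← hRX z, ← hRX z', hzz]
      refine Prod.ext h1 (hfaith _ _ fun y hy => ?_)
      have h2 : R z y = R z' y := by rw [hzz]
      rw [hR, hR, ← h1] at h2
      have h3 := (hinjL (z.1, 1) hz.1.1).1 _ (hG z.2 _ hy) _ (hG z'.2 _ hy) (by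
        rw [hR, hR, one_smul, one_smul]; exact h2)
      exact h3
  have := Finset.card_le_mul_card_image_of_maps_to hmaps B hfib
  rw [card_product, card_univ] at this
  exact this

end Count
end PerAvg

set_option linter.unusedSectionVars false

namespace PerAvg
open Finset Polynomial

section Itp
variable {R : Type} [CommRing R]

/-- the `m`-th compositional iterate -/
noncomputable def itp (φ : R[X]) (m : ℕ) : R[X] := (φ.comp)^[m] X

lemma itp_zero (φ : R[X]) : itp φ 0 = X := rfl

lemma itp_succ (φ : R[X]) (m : ℕ) : itp φ (m + 1) = φ.comp (itp φ m) := by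
  rw [itp, Function.iterate_succ_apply']; rfl

lemma eval₂_itp {S : Type} [CommRing S] (j : R →+* S) (φ : R[X]) (m : ℕ) (a : S) :
    (itp φ m).eval₂ j a = (fun x => φ.eval₂ j x)^[m] a := by
  induction m with
  | zero => simp [itp_zero]
  | succ m ih => rw [itp_succ, eval₂_comp, ih, Function.iterate_succ_apply']

lemma eval_itp (φ : R[X]) (m : ℕ) (a : R) :
    (itp φ m).eval a = (fun x => φ.eval x)^[m] a := eval₂_itp (RingHom.id R) φ m a

lemma map_itp {S : Type} [CommRing S] (j : R →+* S) (φ : R[X]) (m : ℕ) :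
    (itp φ m).map j = itp (φ.map j) m := by
  induction m with
  | zero => simp [itp_zero]
  | succ m ih => rw [itp_succ, itp_succ, Polynomial.map_comp, ih]

lemma natDegree_itp [IsDomain R] (φ : R[X]) (m : ℕ) : (itp φ m).natDegree = φ.natDegree ^ m := by
  induction m with
  | zero => simp [itp_zero]
  | succ m ih => rw [itp_succ, natDegree_comp, ih, pow_succ']

end Itp

/-- the transposition condition at level `m` -/
def GoodAt {k : Type} [Field k] (h : k[X]) : Prop :=
  ∃ c, (derivative h).eval c = 0 ∧ (derivative (derivative h)).eval c ≠ 0 ∧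
    ∀ x, x ≠ c → h.eval x = h.eval c → (derivative h).eval x ≠ 0

lemma fibre_exact {α β : Type} [DecidableEq β] (S : Finset α) (T : Finset β) (f : α → β) (e : ℕ)
    (hf : ∀ a ∈ S, f a ∈ T) (hle : ∀ b ∈ T, (S.filter (fun a => f a = b)).card ≤ e)
    (hc : T.card * e ≤ S.card) : ∀ b ∈ T, (S.filter (fun a => f a = b)).card = e := by
  have h1 := Finset.card_eq_sum_card_fiberwise hf
  have h2 : ∑ b ∈ T, (S.filter (fun a => f a = b)).card = ∑ b ∈ T, e := by
    apply le_antisymm (sum_le_sum hle)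
    rw [sum_const, smul_eq_mul, ← h1]; exact hc
  exact (sum_eq_sum_iff_of_le hle).1 h2

section Tower
variable {k A G : Type} [Field k] [IsAlgClosed k] [CommRing A] [IsDomain A] [Algebra k[X] A]
  [Algebra k A] [IsScalarTower k k[X] A] [Group G] [Fintype G] [MulSemiringAction G A]
  [SMulCommClass G k[X] A] [Algebra.IsInvariant k[X] A G] [DecidableEq A]

/-- roots at level `m` -/
noncomputable def Lm (A : Type) [CommRing A] [IsDomain A] [Algebra k[X] A] [Algebra k A] [DecidableEq A]
    (φ : k[X]) (m : ℕ) : Finset A :=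
  ((itp φ m).map (algebraMap k A) - C (algebraMap k[X] A X)).roots.toFinset

lemma fibre_roots (φ : k[X]) (hd : 1 ≤ φ.natDegree) (m : ℕ) (s : A) (S : Finset A)
    (hS : ∀ a ∈ S, (itp φ m).eval₂ (algebraMap k A) a = s) : S.card ≤ φ.natDegree ^ m := by
  have hinj : Function.Injective (algebraMap k A) := (algebraMap k A).injective
  have hdeg : ((itp φ m).map (algebraMap k A) - C s).natDegree = φ.natDegree ^ m := by
    rw [natDegree_sub_C, natDegree_map_eq_of_injective hinj, natDegree_itp]
  have hne : (itp φ m).map (algebraMap k A) - C s ≠ 0 := by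
    intro h0
    rw [h0, natDegree_zero] at hdeg
    exact absurd hdeg (pow_pos hd m).ne
  rw [← hdeg]
  refine le_trans ?_ (card_roots' _)
  rw [← Finset.card_val]
  apply Multiset.card_le_card
  rw [Multiset.le_iff_subset S.nodup]
  intro a ha
  rw [mem_roots hne]
  simp [IsRoot, eval_map, hS a ha]

lemma mem_Lm (φ : k[X]) (hd : 1 ≤ φ.natDegree) (m : ℕ) (a : A) :
    a ∈ Lm A φ m ↔ (fun x => φ.eval₂ (algebraMap k A) x)^[m] a = algebraMap k[X] A X := by
  have hinj : Function.Injective (algebraMap k A) := (algebraMap k A).injective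
  have hdeg : ((itp φ m).map (algebraMap k A) - C (algebraMap k[X] A X)).natDegree = φ.natDegree ^ m := by
    rw [natDegree_sub_C, natDegree_map_eq_of_injective hinj, natDegree_itp]
  have hne : (itp φ m).map (algebraMap k A) - C (algebraMap k[X] A X) ≠ 0 := by
    intro h0
    rw [h0, natDegree_zero] at hdeg
    exact absurd hdeg (pow_pos hd m).ne
  rw [Lm, Multiset.mem_toFinset, mem_roots hne, ← eval₂_itp]
  simp [IsRoot, eval_map, sub_eq_zero]

lemma card_Lm_le (φ : k[X]) (hd : 1 ≤ φ.natDegree) (m : ℕ) : (Lm A φ m).card ≤ φ.natDegree ^ m := by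
  refine fibre_roots φ hd m (algebraMap k[X] A X) _ ?_
  intro a ha
  rw [eval₂_itp]
  exact (mem_Lm φ hd m a).1 ha

lemma card_Lm (φ : k[X]) (hd : 1 ≤ φ.natDegree) (N : ℕ) (hN : (Lm A φ N).card = φ.natDegree ^ N) (m : ℕ)
    (hm : m ≤ N) : (Lm A φ m).card = φ.natDegree ^ m ∧ ∀ s ∈ Lm A φ m, ∃ a ∈ Lm A φ N,
      (fun x => φ.eval₂ (algebraMap k A) x)^[N - m] a = s := by
  have hmaps : ∀ a ∈ Lm A φ N, (fun x => φ.eval₂ (algebraMap k A) x)^[N - m] a ∈ Lm A φ m := by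
    intro a ha
    rw [mem_Lm φ hd] at ha ⊢
    rw [← Function.iterate_add_apply, Nat.add_sub_cancel' hm, ha]
  have hfib : ∀ s ∈ Lm A φ m, ((Lm A φ N).filter
      (fun a => (fun x => φ.eval₂ (algebraMap k A) x)^[N - m] a = s)).card ≤ φ.natDegree ^ (N - m) := by
    intro s _
    refine fibre_roots φ hd (N - m) s _ ?_
    intro a ha
    rw [eval₂_itp]
    exact (mem_filter.1 ha).2
  have h1 := Finset.card_le_mul_card_image_of_maps_to hmaps _ hfib
  have hpow : φ.natDegree ^ N = φ.natDegree ^ (N - m) * φ.natDegree ^ m := by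
    rw [← pow_add, Nat.sub_add_cancel hm]
  have hpos : 0 < φ.natDegree ^ (N - m) := pow_pos hd _
  have hc : (Lm A φ m).card = φ.natDegree ^ m := by
    apply le_antisymm (card_Lm_le φ hd m)
    rw [hN, hpow] at h1
    exact Nat.le_of_mul_le_mul_left h1 hpos
  refine ⟨hc, fun s hs => ?_⟩
  have h2 := fibre_exact _ _ _ _ hmaps hfib (by rw [hc, hN, hpow, mul_comm]) s hs
  have h3 : 0 < ((Lm A φ N).filter
      (fun a => (fun x => φ.eval₂ (algebraMap k A) x)^[N - m] a = s)).card := by rw [h2]; exact hpos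
  obtain ⟨a, ha⟩ := Finset.card_pos.1 h3
  rw [mem_filter] at ha
  exact ⟨a, ha⟩

lemma fact_Lm (φ : k[X]) (hd : 1 ≤ φ.natDegree) (m : ℕ) (hc : (Lm A φ m).card = φ.natDegree ^ m) :
    (itp φ m).map (algebraMap k A) - C (algebraMap k[X] A X) =
      C (algebraMap k A (itp φ m).leadingCoeff) * ∏ r ∈ Lm A φ m, (X - C r) := by
  have hinj : Function.Injective (algebraMap k A) := (algebraMap k A).injective
  by_cases hm0 : m = 0 ∧ False
  · exact hm0.2.elim
  have hdeg : ((itp φ m).map (algebraMap k A) - C (algebraMap k[X] A X)).natDegree = φ.natDegree ^ m := by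
    rw [natDegree_sub_C, natDegree_map_eq_of_injective hinj, natDegree_itp]
  have hcard : Multiset.card ((itp φ m).map (algebraMap k A) - C (algebraMap k[X] A X)).roots =
      ((itp φ m).map (algebraMap k A) - C (algebraMap k[X] A X)).natDegree := by
    apply le_antisymm (card_roots' _)
    rw [hdeg, ← hc]
    exact Multiset.toFinset_card_le _
  have hnd : (Lm A φ m).val = ((itp φ m).map (algebraMap k A) - C (algebraMap k[X] A X)).roots := by
    apply Multiset.eq_of_le_of_card_le
    · exact Multiset.dedup_le _
    · rw [hcard, hdeg, Finset.card_val, hc]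
  have h1 := C_leadingCoeff_mul_prod_multiset_X_sub_C hcard
  have hlc : ((itp φ m).map (algebraMap k A) - C (algebraMap k[X] A X)).leadingCoeff =
      algebraMap k A (itp φ m).leadingCoeff := by
    have hpos : 0 < φ.natDegree ^ m := pow_pos hd m
    rw [leadingCoeff, hdeg, coeff_sub, coeff_C, if_neg hpos.ne', sub_zero, coeff_map, leadingCoeff, natDegree_itp]
  rw [hlc, ← hnd] at h1
  exact h1.symm

theorem tower_bound (hinj : Function.Injective (algebraMap k[X] A)) (φ : k[X]) (hd : 2 ≤ φ.natDegree)
    (N K : ℕ) (hNK : K * (φ.natDegree * K) ^ (φ.natDegree * K) ≤ N) (hN1 : 1 ≤ N)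
    (hN : (Lm A φ N).card = φ.natDegree ^ N)
    (htr : ∀ x ∈ Lm A φ N, ∀ y ∈ Lm A φ N, ∃ g : G, g • x = y)
    (hgood : ∀ m, 1 ≤ m → m ≤ N → GoodAt (itp φ m))
    (hfaith : ∀ g g' : G, (∀ y ∈ Lm A φ N, g • y = g' • y) → g = g')
    (p e : ℕ) [Fact p.Prime] [CharP k p] (Ψ : A →+* A) (hΨinj : Function.Injective Ψ)
    (hφ : ∀ i, φ.coeff i ^ (p ^ e) = φ.coeff i)
    (hΨC : ∀ c, Ψ (algebraMap k A c) = algebraMap k A (c ^ (p ^ e)))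
    (hΨX : Ψ (algebraMap k[X] A X) = algebraMap k[X] A X)
    (B : ℕ) (hB : ∀ (S : Finset (A →ₐ[k] k)) (τ : A → A), (∀ r ∈ Lm A φ N, τ r ∈ Lm A φ N) →
      (∀ P ∈ S, ∀ r ∈ Lm A φ N, P r ^ (p ^ e) = P (τ r)) → S.card ≤ B)
    (Y0 : Finset k) (hY1 : ∀ y ∈ Y0, y ^ (p ^ e) = y)
    (hY2 : ∀ y ∈ Y0, ∃ x, x ^ (p ^ e) = x ∧ (itp φ N).eval x = y)
    (hY3 : ∀ y ∈ Y0, ∀ x, (itp φ N).eval x = y → (derivative (itp φ N)).eval x ≠ 0) :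
    Y0.card * K ≤ 2 * B := by
  have hd1 : 1 ≤ φ.natDegree := by omega
  set f : A → A := fun x => φ.eval₂ (algebraMap k A) x with hf
  have hmem : ∀ m a, a ∈ Lm A φ m ↔ f^[m] a = algebraMap k[X] A X := mem_Lm φ hd1
  have hfG : ∀ (g : G) a, f (g • a) = g • f a := by
    intro g a
    have h1 := Polynomial.hom_eval₂ φ (algebraMap k A) (MulSemiringAction.toRingHom G A g) a
    have h2 : (MulSemiringAction.toRingHom G A g).comp (algebraMap k A) = algebraMap k A :=
      RingHom.ext fun c => smul_const (k := k) (A := A) g c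
    rw [h2] at h1
    exact h1.symm
  have hfΨ : ∀ a, f (Ψ a) = Ψ (f a) := by
    intro a
    change eval₂ _ _ _ = Ψ (eval₂ _ _ _)
    rw [Polynomial.hom_eval₂, eval₂_eq_sum_range, eval₂_eq_sum_range]
    refine sum_congr rfl fun i _ => ?_
    rw [RingHom.comp_apply, hΨC, hφ]
  have hfGm : ∀ m (g : G) a, f^[m] (g • a) = g • f^[m] a := by
    intro m g
    induction m with
    | zero => intro a; rfl
    | succ m ih => intro a; rw [Function.iterate_succ_apply, hfG, ih, ← Function.iterate_succ_apply]
  have hfΨm : ∀ m a, f^[m] (Ψ a) = Ψ (f^[m] a) := by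
    intro m
    induction m with
    | zero => intro a; rfl
    | succ m ih => intro a; rw [Function.iterate_succ_apply, hfΨ, ih, ← Function.iterate_succ_apply]
  have hG : ∀ m, ∀ g : G, ∀ y ∈ Lm A φ m, g • y ∈ Lm A φ m := by
    intro m g y hy
    rw [hmem] at hy ⊢
    rw [hfGm, hy, smul_algebraMap]
  have hΨL : ∀ m, ∀ y ∈ Lm A φ m, Ψ y ∈ Lm A φ m := by
    intro m y hy
    rw [hmem] at hy ⊢
    rw [hfΨm, hy, hΨX]
  have hcard := fun m hm => (card_Lm φ hd1 N hN m hm).1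
  let NF : Finset A → ℕ := fun T => (univ.filter (fun g : G => ∃ y ∈ T, g • Ψ y = y)).card
  have hstep : ∀ m : ℕ, m < N → NF (Lm A φ (m + 1)) * K ≤ Fintype.card G +
      K * (φ.natDegree * K) ^ (φ.natDegree * K) * (NF (Lm A φ m) - NF (Lm A φ (m + 1))) ∧
      NF (Lm A φ (m + 1)) ≤ NF (Lm A φ m) := by
    intro m hm
    have hmaps : ∀ a ∈ Lm A φ (m + 1), f a ∈ Lm A φ m := by
      intro a ha
      rw [hmem] at ha ⊢
      rw [← Function.iterate_succ_apply, ha]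
    have hfib : ∀ s ∈ Lm A φ m, ((Lm A φ (m + 1)).filter (fun a => f a = s)).card ≤ φ.natDegree := by
      intro s _
      have := fibre_roots φ hd1 1 s ((Lm A φ (m + 1)).filter (fun a => f a = s)) (by
        intro a ha
        rw [eval₂_itp]
        exact (mem_filter.1 ha).2)
      rwa [pow_one] at this
    have hex := fibre_exact _ _ f _ hmaps hfib (by
      rw [hcard m (by omega), hcard (m + 1) (by omega), pow_succ])
    have hlast : (Lm A φ (m + 1)).card = φ.natDegree ^ (m + 1) := hcard (m + 1) (by omega)
    obtain ⟨c, hc1, hc2, hc3⟩ := hgood (m + 1) (by omega) (by omega)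
    refine group_step (G := G) (Lm A φ m) (Lm A φ (m + 1)) f Ψ φ.natDegree K (hG (m + 1)) (hΨL (m + 1)) hΨinj
      (fun y _ => hfΨ y) (fun g y _ => hfG g y) ?_ hmaps (hΨL m) ?_ hfib ?_ ?_ ?_
    · intro x hx
      have h1 := hex x hx
      obtain ⟨a, ha⟩ := Finset.card_pos.1 (show 0 < ((Lm A φ (m + 1)).filter (fun a => f a = x)).card by omega)
      rw [mem_filter] at ha
      exact ⟨a, ha⟩
    · rw [← Finset.card_pos, hlast]
      exact pow_pos hd1 _
    · intro y hy
      have h1 := hex (f y) (hmaps y hy)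
      obtain ⟨a, ha, hne⟩ := Finset.exists_mem_ne (show 1 < ((Lm A φ (m + 1)).filter (fun a => f a = f y)).card by omega) y
      rw [mem_filter] at ha
      exact ⟨a, ha.1, hne, ha.2⟩
    · intro x hx y hy
      obtain ⟨a, ha, rfl⟩ := (card_Lm φ hd1 N hN (m + 1) (by omega)).2 x hx
      obtain ⟨b, hb, rfl⟩ := (card_Lm φ hd1 N hN (m + 1) (by omega)).2 y hy
      obtain ⟨g, hg⟩ := htr a ha b hb
      exact ⟨g, by rw [← hg]; exact (hfGm _ g a).symm⟩
    · refine swap_exists hinj (itp φ (m + 1)) _ ?_ (fact_Lm φ hd1 (m + 1) hlast) (hG (m + 1)) c hc1 hc2 hc3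
      rw [natDegree_itp]; exact Nat.one_le_pow _ _ hd1
  have hnum := numeric_iter (Fintype.card G) K ((φ.natDegree * K) ^ (φ.natDegree * K))
    (fun m => NF (Lm A φ m))
    (card_le_univ _) N hNK hN1 (fun m hm => (hstep m hm).1) (fun m hm => (hstep m hm).2)
  have hcp := count_places (G := G) hinj (itp φ N) (Lm A φ N) (by rw [natDegree_itp]; exact Nat.one_le_pow _ _ hd1)
    (fact_Lm φ hd1 N hN) (hG N) hfaith p e Ψ hΨC hΨX (hΨL N) B hB Y0 hY1 hY2 hY3
  have hgpos : 0 < Fintype.card G := Fintype.card_pos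
  have h1 : Y0.card * K * Fintype.card G ≤ 2 * B * Fintype.card G := by
    calc Y0.card * K * Fintype.card G = Y0.card * Fintype.card G * K := by ring
      _ ≤ B * (univ.filter (fun g : G => ∃ r ∈ Lm A φ N, g • Ψ r = r)).card * K := Nat.mul_le_mul_right _ hcp
      _ = B * ((univ.filter (fun g : G => ∃ r ∈ Lm A φ N, g • Ψ r = r)).card * K) := by ring
      _ ≤ B * (2 * Fintype.card G) := Nat.mul_le_mul_left _ hnum
      _ = _ := by ring
  exact Nat.le_of_mul_le_mul_right h1 hgpos

end Tower
end PerAvg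

set_option linter.unusedSectionVars false

namespace PerAvg
open Finset Polynomial

section Conc
variable {k E K : Type} [Field k] [IsAlgClosed k] [Field E] [Field K] [Algebra k[X] E] [IsFractionRing k[X] E]
  [Algebra k E] [IsScalarTower k k[X] E] [Algebra E K] [Algebra k[X] K] [Algebra k K]
  [IsScalarTower k[X] E K] [IsScalarTower k k[X] K] [IsScalarTower k E K]

/-- the polynomial `h(Z) - y` over `k(y)` -/
noncomputable def fp (E : Type) [Field E] [Algebra k[X] E] [Algebra k E] (h : k[X]) : E[X] :=
  h.map (algebraMap k E) - C (algebraMap k[X] E X)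

lemma deriv_ne_zero (h : k[X]) (hM : 1 ≤ h.natDegree) (hchar : (h.natDegree : k) ≠ 0) :
    derivative h ≠ 0 := by
  intro h0
  have h1 := congrArg (fun P => P.coeff (h.natDegree - 1)) h0
  simp only [coeff_derivative, coeff_zero] at h1
  rw [Nat.sub_add_cancel hM] at h1
  have h2 : ((h.natDegree - 1 : ℕ) : k) + 1 = (h.natDegree : k) := by
    rw [← Nat.cast_succ, Nat.succ_eq_add_one, Nat.sub_add_cancel hM]
  rw [h2] at h1
  rcases mul_eq_zero.1 h1 with h3 | h3
  · have : h = 0 := leadingCoeff_eq_zero.1 h3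
    rw [this] at hM; simp at hM
  · exact hchar h3

lemma sep_fp (h : k[X]) (hM : 1 ≤ h.natDegree) (hchar : (h.natDegree : k) ≠ 0) :
    (fp E h).Separable := by
  have hd0 := deriv_ne_zero h hM hchar
  rw [Polynomial.Separable]
  rw [Polynomial.isCoprime_iff_aeval_ne_zero_of_isAlgClosed E (AlgebraicClosure E)]
  intro a
  by_contra hcon
  push Not at hcon
  obtain ⟨h1, h2⟩ := hcon
  let j : k →+* AlgebraicClosure E := (algebraMap E (AlgebraicClosure E)).comp (algebraMap k E)
  have hder : derivative (fp E h) = (derivative h).map (algebraMap k E) := by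
    rw [fp, derivative_sub, derivative_C, sub_zero, derivative_map]
  rw [hder, aeval_def, eval₂_map] at h2
  have hsp : (derivative h).Splits := IsAlgClosed.splits _
  have hroot : ∃ c : k, j c = a ∧ True := by
    have h3 : ((derivative h).map j).eval a = 0 := by rw [eval_map]; exact h2
    have h4 := (hsp.map j)
    have h5 : a ∈ ((derivative h).map j).roots := by
      rw [mem_roots (by rwa [Polynomial.map_ne_zero_iff j.injective])]
      exact h3
    rw [hsp.roots_map] at h5
    obtain ⟨c, _, hc⟩ := Multiset.mem_map.1 h5
    exact ⟨c, hc, trivial⟩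
  obtain ⟨c, rfl, -⟩ := hroot
  rw [fp, map_sub, aeval_C, aeval_def, eval₂_map] at h1
  have h6 : eval₂ j (j c) h = j (h.eval c) := by rw [eval₂_at_apply]
  change eval₂ j (j c) h - _ = 0 at h1
  rw [h6, sub_eq_zero] at h1
  have h7 := (algebraMap E (AlgebraicClosure E)).injective h1
  rw [IsScalarTower.algebraMap_apply k k[X] E] at h7
  have h8 := IsFractionRing.injective k[X] E h7
  have h9 := congrArg natDegree h8
  simp [algebraMap_eq] at h9

/-- the roots of `h(Z) = y` -/
def LS (K : Type) [Field K] [Algebra k[X] K] [Algebra k K] (h : k[X]) : Set K :=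
  {r | aeval r h = algebraMap k[X] K X}

lemma LS_eq (h : k[X]) (hM : 1 ≤ h.natDegree) : LS K h = (fp E h).rootSet K := by
  ext r
  rw [fp, mem_rootSet_of_ne (fp_ne_zero _ h hM _), map_sub, aeval_C, aeval_map_algebraMap,
    ← IsScalarTower.algebraMap_apply, sub_eq_zero]
  rfl

lemma LS_finite (E : Type) [Field E] [Algebra k[X] E] [IsFractionRing k[X] E] [Algebra k E]
    [IsScalarTower k k[X] E] [Algebra E K] [IsScalarTower k[X] E K] [IsScalarTower k E K] (h : k[X]) (hM : 1 ≤ h.natDegree) : (LS K h).Finite := by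
  rw [LS_eq (E := E) h hM]
  exact rootSet_finite _ _

lemma LS_ncard (E : Type) [Field E] [Algebra k[X] E] [IsFractionRing k[X] E] [Algebra k E]
    [IsScalarTower k k[X] E] [Algebra E K] [IsScalarTower k[X] E K] [IsScalarTower k E K] (h : k[X]) (hM : 1 ≤ h.natDegree) (hchar : (h.natDegree : k) ≠ 0)
    [IsSplittingField E K (fp E h)] :
    (LS K h).ncard = h.natDegree := by
  rw [LS_eq (E := E) h hM, Set.ncard_eq_toFinset_card', Set.toFinset_card,
    card_rootSet_eq_natDegree (sep_fp h hM hchar) (IsSplittingField.splits K (fp E h)), fp, natDegree_fp _ h hM]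

lemma LS_adjoin (h : k[X]) (hM : 1 ≤ h.natDegree) [IsSplittingField E K (fp E h)] :
    Algebra.adjoin E (LS K h) = ⊤ := by
  rw [LS_eq (E := E) h hM]
  exact IsSplittingField.adjoin_rootSet _ _

lemma LS_integral (h : k[X]) (hM : 1 ≤ h.natDegree) (r : K) (hr : r ∈ LS K h) : IsIntegral k[X] r := by
  let P : k[X][X] := h.map C - C X
  have hlc : h.leadingCoeff ≠ 0 := by
    intro h0
    rw [leadingCoeff_eq_zero] at h0
    rw [h0] at hM; simp at hM
  have hPd : P.natDegree = h.natDegree := by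
    rw [natDegree_sub_C, natDegree_map_eq_of_injective C_injective]
  have hPl : P.leadingCoeff = C h.leadingCoeff := by
    rw [leadingCoeff, hPd, coeff_sub, coeff_map, coeff_C, if_neg (by omega), sub_zero]
    rfl
  have hP0 : aeval r P = 0 := by
    simp only [P, map_sub, aeval_C]
    rw [aeval_def, eval₂_map]
    have : (algebraMap k[X] K).comp C = algebraMap k K := by
      rw [← algebraMap_eq, ← IsScalarTower.algebraMap_eq]
    rw [this, sub_eq_zero]
    exact hr
  have h1 := isIntegral_leadingCoeff_smul P r hP0
  rw [hPl] at h1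
  have h2 : IsIntegral k[X] ((C h.leadingCoeff⁻¹ : k[X]) • ((C h.leadingCoeff : k[X]) • r)) := h1.smul _
  rwa [smul_smul, ← C_mul, inv_mul_cancel₀ hlc, C_1, one_smul] at h2

lemma LS_yW (h : k[X]) (r : K) (hr : r ∈ LS K h) :
    algebraMap k[X] K X ∈ (Submodule.span k (insert 1 (LS K h))) ^ h.natDegree := by
  have hr' : aeval r h = algebraMap k[X] K X := hr
  rw [← hr', aeval_eq_sum_range]
  refine Submodule.sum_mem _ fun i hi => Submodule.smul_mem _ _ ?_
  refine pow_span_mono (Set.mem_insert _ _) (Nat.lt_succ_iff.1 (mem_range.1 hi)) ?_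
  exact Submodule.pow_mem_pow _ (Submodule.subset_span (Set.mem_insert_of_mem _ hr)) i

lemma LS_aut (h : k[X]) (σ : K ≃ₐ[E] K) (r : K) (hr : r ∈ LS K h) : σ r ∈ LS K h := by
  have hr' : aeval r h = algebraMap k[X] K X := hr
  have h1 : σ (aeval r h) = aeval (σ r) h := by
    exact (Polynomial.aeval_algHom_apply (σ.toAlgHom.restrictScalars k) r h).symm
  change aeval (σ r) h = _
  rw [← h1, hr', IsScalarTower.algebraMap_apply k[X] E K, AlgEquiv.commutes]

lemma LS_order (h : k[X]) (hM : 1 ≤ h.natDegree) (ι : K →+* LaurentSeries k)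
    (hC : ∀ c, ι (algebraMap k K c) = HahnSeries.C c)
    (hX : (ι (algebraMap k[X] K X)).order = -(h.natDegree : ℤ))
    (h1 : ∀ r, aeval r h = algebraMap k[X] K X → OrdGe (-1) (ι r)) (r : K) (hr : r ∈ LS K h) :
    (ι r).order = -1 ∧ ι r ≠ 0 := by
  have key : ¬ OrdGe 0 (ι r) := by
    intro h0
    have h2 : OrdGe 0 (ι (aeval r h)) := by
      rw [aeval_eq_sum_range, map_sum]
      refine OrdGe.sum _ _ fun i _ => ?_
      rw [Algebra.smul_def, map_mul, map_pow, hC]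
      have := (ordGe_C (h.coeff i)).mul (h0.pow i)
      simpa using this
    have hr' : aeval r h = algebraMap k[X] K X := hr
    rw [hr'] at h2
    rcases h2 with h3 | h3
    · rw [h3] at hX
      rw [HahnSeries.order_zero] at hX
      omega
    · omega
  have h2 := h1 r hr
  have hne : ι r ≠ 0 := fun h0 => key (Or.inl h0)
  refine ⟨?_, hne⟩
  rcases h2 with h3 | h3
  · exact absurd h3 hne
  · by_contra hcon
    exact key (Or.inr (by omega))

end Conc
end PerAvg

set_option linter.unusedSectionVars false
set_option linter.unusedVariables false
set_option linter.style.haveILetI false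

namespace PerAvg
open Finset Polynomial

section Conc
variable {k E K : Type} [Field k] [IsAlgClosed k] [Field E] [Field K] [Algebra k[X] E] [IsFractionRing k[X] E]
  [Algebra k E] [IsScalarTower k k[X] E] [Algebra E K] [Algebra k[X] K] [Algebra k K]
  [IsScalarTower k[X] E K] [IsScalarTower k k[X] K] [IsScalarTower k E K]

lemma AA_X (h : k[X]) (r : K) (hr : r ∈ LS K h) :
    algebraMap k[X] K X ∈ Algebra.adjoin k (LS K h) := by
  have hr' : aeval r h = algebraMap k[X] K X := hr
  rw [← hr']
  rw [aeval_eq_sum_range]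
  exact Subalgebra.sum_mem _ fun i _ => Subalgebra.smul_mem _
    (Subalgebra.pow_mem _ (Algebra.subset_adjoin hr) i) _

lemma AA_aut (h : k[X]) (σ : K ≃ₐ[E] K) (a : K) (ha : a ∈ Algebra.adjoin k (LS K h)) :
    σ a ∈ Algebra.adjoin k (LS K h) := by
  induction ha using Algebra.adjoin_induction with
  | mem x hx => exact Algebra.subset_adjoin (LS_aut h σ x hx)
  | algebraMap r =>
    rw [IsScalarTower.algebraMap_apply k E K, AlgEquiv.commutes, ← IsScalarTower.algebraMap_apply k E K]
    exact Subalgebra.algebraMap_mem _ r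
  | add x y _ _ hx hy => rw [map_add]; exact add_mem hx hy
  | mul x y _ _ hx hy => rw [map_mul]; exact mul_mem hx hy

lemma AA_integral (h : k[X]) (hM : 1 ≤ h.natDegree) (a : K) (ha : a ∈ Algebra.adjoin k (LS K h)) :
    IsIntegral k[X] a := by
  induction ha using Algebra.adjoin_induction with
  | mem x hx => exact LS_integral h hM x hx
  | algebraMap r =>
    rw [IsScalarTower.algebraMap_apply k k[X] K]
    exact isIntegral_algebraMap
  | add x y _ _ hx hy => exact hx.add hy
  | mul x y _ _ hx hy => exact hx.mul hy

/-- `k[y]`-algebra structure on the coordinate ring -/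
@[reducible] noncomputable def algA (h : k[X]) (hX : algebraMap k[X] K X ∈ Algebra.adjoin k (LS K h)) :
    Algebra k[X] (Algebra.adjoin k (LS K h)) :=
  RingHom.toAlgebra
    (aeval (⟨algebraMap k[X] K X, hX⟩ : Algebra.adjoin k (LS K h)) : k[X] →ₐ[k] Algebra.adjoin k (LS K h)).toRingHom

/-- Galois action on the coordinate ring -/
@[reducible] def actA (E : Type) [Field E] [Algebra k E] [Algebra k[X] E] [IsFractionRing k[X] E] [IsScalarTower k k[X] E]
    [Algebra E K] [IsScalarTower k[X] E K] [IsScalarTower k E K] (h : k[X]) :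
    MulSemiringAction (K ≃ₐ[E] K) (Algebra.adjoin k (LS K h)) where
  smul σ a := ⟨σ a, AA_aut h σ a a.2⟩
  one_smul a := Subtype.ext rfl
  mul_smul σ τ a := Subtype.ext rfl
  smul_zero σ := Subtype.ext (map_zero σ)
  smul_add σ a b := Subtype.ext (map_add σ _ _)
  smul_one σ := Subtype.ext (map_one σ)
  smul_mul σ a b := Subtype.ext (map_mul σ _ _)

lemma algA_coe (h : k[X]) (hX : algebraMap k[X] K X ∈ Algebra.adjoin k (LS K h)) (P : k[X]) :
    letI := algA h hX
    ((algebraMap k[X] (Algebra.adjoin k (LS K h)) P : Algebra.adjoin k (LS K h)) : K) = algebraMap k[X] K P := by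
  change ((aeval (⟨algebraMap k[X] K X, hX⟩ : Algebra.adjoin k (LS K h)) P : Algebra.adjoin k (LS K h)) : K) = _
  have h1 := Polynomial.aeval_algHom_apply (Algebra.adjoin k (LS K h)).val
    (⟨algebraMap k[X] K X, hX⟩ : Algebra.adjoin k (LS K h)) P
  have h2 := Polynomial.aeval_algHom_apply (IsScalarTower.toAlgHom k k[X] K) X P
  rw [aeval_X_left_apply] at h2
  exact h1.symm.trans h2

lemma exists_Psi (φ : k[X]) (N : ℕ) (p e : ℕ) [Fact p.Prime] [CharP k p]
    (hM : 1 ≤ (itp φ N).natDegree) [IsSplittingField E K (fp E (itp φ N))]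
    (hφ : ∀ i, φ.coeff i ^ (p ^ e) = φ.coeff i) :
    ∃ Ψ : K →+* K, (∀ c, Ψ (algebraMap k K c) = algebraMap k K (c ^ (p ^ e))) ∧
      Ψ (algebraMap k[X] K X) = algebraMap k[X] K X := by
  haveI : IsSplittingField E K ((itp φ N).map (algebraMap k E) - C (algebraMap k[X] E X)) :=
    inferInstanceAs (IsSplittingField E K (fp E (itp φ N)))
  let fr : k →+* k := iterateFrobenius k p e
  have hfr : ∀ c, fr c = c ^ (p ^ e) := fun c => iterateFrobenius_def ..
  let κ : k[X] →+* K := (algebraMap k[X] K).comp (mapRingHom fr)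
  have hinj : Function.Injective (algebraMap k[X] K) := by
    rw [IsScalarTower.algebraMap_eq k[X] E K]
    exact (algebraMap E K).injective.comp (IsFractionRing.injective k[X] E)
  have hκ : Function.Injective κ := hinj.comp (map_injective _ fr.injective)
  have hκX : κ X = algebraMap k[X] K X := by simp [κ]
  have hκC : ∀ c, κ (C c) = algebraMap k K (c ^ (p ^ e)) := by
    intro c
    simp only [κ, RingHom.comp_apply, coe_mapRingHom, map_C, hfr]
    rw [IsScalarTower.algebraMap_apply k k[X] K]; rfl
  have hφm : φ.map fr = φ := by
    ext i
    rw [coeff_map, hfr, hφ]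
  have hcomp : κ.comp C = (algebraMap k K).comp fr := by
    refine RingHom.ext fun c => ?_
    exact (hκC c).trans (by rw [RingHom.comp_apply, hfr])
  have hmap : (itp φ N).map (κ.comp C) = (itp φ N).map (algebraMap k K) := by
    rw [hcomp, ← Polynomial.map_map, map_itp fr, hφm]
  have hsp : ((itp φ N).map (κ.comp C) - C (κ X)).Splits := by
    rw [hmap, hκX]
    have h1 := IsSplittingField.splits K (fp E (itp φ N))
    rw [fp, Polynomial.map_sub, Polynomial.map_map, map_C, ← IsScalarTower.algebraMap_eq,
      ← IsScalarTower.algebraMap_apply] at h1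
    exact h1
  obtain ⟨Ψ, hΨ⟩ := exists_extend (E := E) (K := K) (itp φ N) κ hκ hsp
  refine ⟨Ψ, fun c => ?_, ?_⟩
  · rw [← hκC, ← hΨ, ← algebraMap_eq, ← IsScalarTower.algebraMap_apply]
  · rw [hΨ, hκX]

end Conc
end PerAvg

set_option linter.unusedSectionVars false
set_option linter.unusedVariables false
set_option linter.style.haveILetI false

namespace PerAvg
open Finset Polynomial

section Conc
variable {k E K : Type} [Field k] [IsAlgClosed k] [Field E] [Field K] [Algebra k[X] E] [IsFractionRing k[X] E]
  [Algebra k E] [IsScalarTower k k[X] E] [Algebra E K] [Algebra k[X] K] [Algebra k K]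
  [IsScalarTower k[X] E K] [IsScalarTower k k[X] K] [IsScalarTower k E K]

set_option maxHeartbeats 1000000 in
theorem conc_bound (E K : Type) [Field E] [Field K] [Algebra k[X] E] [IsFractionRing k[X] E]
  [Algebra k E] [IsScalarTower k k[X] E] [Algebra E K] [Algebra k[X] K] [Algebra k K]
  [IsScalarTower k[X] E K] [IsScalarTower k k[X] K] [IsScalarTower k E K]
    (φ : k[X]) (hd : 2 ≤ φ.natDegree)
    (N Kc : ℕ) (hNK : Kc * (φ.natDegree * Kc) ^ (φ.natDegree * Kc) ≤ N) (hN1 : 1 ≤ N)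
    [IsSplittingField E K (fp E (itp φ N))]
    (hchar : (φ.natDegree : k) ≠ 0)
    (hgood : ∀ m, 1 ≤ m → m ≤ N → GoodAt (itp φ m))
    (p μ ν : ℕ) [Fact p.Prime] [CharP k p]
    (hφ : ∀ i, φ.coeff i ^ (p ^ (μ + ν)) = φ.coeff i)
    (M g : ℕ) (hM : M = φ.natDegree ^ N) (hg : g = M ^ M)
    (hQ : (g + 1) * (g + M * (g * (p ^ μ + 2) + 1)) < p ^ ν)
    (Y0 : Finset k) (hY1 : ∀ y ∈ Y0, y ^ (p ^ (μ + ν)) = y)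
    (hY2 : ∀ y ∈ Y0, ∃ x, x ^ (p ^ (μ + ν)) = x ∧ (itp φ N).eval x = y)
    (hY3 : ∀ y ∈ Y0, ∀ x, (itp φ N).eval x = y → (derivative (itp φ N)).eval x ≠ 0) :
    Y0.card * Kc ≤ 2 * (p ^ (μ + ν) + g * g * p ^ ν + g * (3 * g + M * (g * (p ^ μ + 2) + 1))) := by
  classical
  have hMd : (itp φ N).natDegree = M := by rw [natDegree_itp, hM]
  have hM1 : 1 ≤ M := by rw [hM]; exact Nat.one_le_pow _ _ (by omega)
  have hM1' : 1 ≤ (itp φ N).natDegree := by rw [hMd]; exact hM1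
  have hMc : ((itp φ N).natDegree : k) ≠ 0 := by
    rw [natDegree_itp, Nat.cast_pow]; exact pow_ne_zero _ hchar
  have hsep := sep_fp (E := E) (itp φ N) hM1' hMc
  haveI : FiniteDimensional E K := IsSplittingField.finiteDimensional K (fp E (itp φ N))
  haveI : IsGalois E K := IsGalois.of_separable_splitting_field hsep
  haveI : IsSplittingField E K ((itp φ N).map (algebraMap k E) - C (algebraMap k[X] E X)) :=
    inferInstanceAs (IsSplittingField E K (fp E (itp φ N)))
  have hLn := LS_ncard (K := K) E (itp φ N) hM1' hMc
  have hLfin := LS_finite (K := K) E (itp φ N) hM1'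
  obtain ⟨r0, hr0⟩ : (LS K (itp φ N)).Nonempty := by
    rw [← Set.ncard_pos hLfin]; omega
  obtain ⟨ι, hιC, hιX, hι1⟩ := exists_iota (E := E) (K := K) (itp φ N) hM1' hMc
  obtain ⟨Ψ, hΨC, hΨX⟩ := exists_Psi (E := E) (K := K) φ N p (μ + ν) hM1' hφ
  have hX := AA_X (itp φ N) r0 hr0
  have hinjK : Function.Injective (algebraMap k[X] K) := by
    rw [IsScalarTower.algebraMap_eq k[X] E K]
    exact (algebraMap E K).injective.comp (IsFractionRing.injective k[X] E)
  -- structures on A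
  letI iA : Algebra k[X] (Algebra.adjoin k (LS K (itp φ N))) := algA (itp φ N) hX
  letI iG : MulSemiringAction (K ≃ₐ[E] K) (Algebra.adjoin k (LS K (itp φ N))) := actA E (itp φ N)
  have hcoe : ∀ P : k[X], ((algebraMap k[X] (Algebra.adjoin k (LS K (itp φ N))) P :
      Algebra.adjoin k (LS K (itp φ N))) : K) = algebraMap k[X] K P := algA_coe (itp φ N) hX
  have hact : ∀ (σ : K ≃ₐ[E] K) (a : Algebra.adjoin k (LS K (itp φ N))),
    ((σ • a : Algebra.adjoin k (LS K (itp φ N))) : K) = σ (a : K) := fun _ _ => rfl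
  haveI i1 : IsScalarTower k k[X] (Algebra.adjoin k (LS K (itp φ N))) := by
    refine IsScalarTower.of_algebraMap_eq fun c => Subtype.ext ?_
    rw [hcoe, algebraMap_eq]
    exact IsScalarTower.algebraMap_apply k k[X] K c
  haveI i2 : SMulCommClass (K ≃ₐ[E] K) k[X] (Algebra.adjoin k (LS K (itp φ N))) := by
    refine ⟨fun σ P a => Subtype.ext ?_⟩
    rw [hact, Algebra.smul_def, Algebra.smul_def, MulMemClass.coe_mul, MulMemClass.coe_mul, hcoe, map_mul, hact,
      IsScalarTower.algebraMap_apply k[X] E K, AlgEquiv.commutes]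
  haveI i3 : Algebra.IsInvariant k[X] (Algebra.adjoin k (LS K (itp φ N))) (K ≃ₐ[E] K) := by
    refine ⟨fun b hb => ?_⟩
    obtain ⟨P, hP⟩ := fixed_poly (k := k) (E := E) (x := (b : K))
      (fun σ => by rw [← hact, hb]) (AA_integral (itp φ N) hM1' (b : K) b.2)
    exact ⟨P, Subtype.ext (by rw [hcoe, hP])⟩
  have hinj : Function.Injective (algebraMap k[X] (Algebra.adjoin k (LS K (itp φ N)))) := by
    intro P P' hPP
    apply hinjK
    rw [← hcoe, ← hcoe, hPP]
  have hmem : ∀ a : Algebra.adjoin k (LS K (itp φ N)),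
      a ∈ Lm (Algebra.adjoin k (LS K (itp φ N))) φ N ↔ (a : K) ∈ LS K (itp φ N) := by
    intro a
    rw [mem_Lm φ (by omega), ← eval₂_itp, Subtype.ext_iff, hcoe]
    change _ ↔ aeval (a : K) (itp φ N) = _
    rw [← aeval_def, Subalgebra.aeval_coe]
  have hcard : (Lm (Algebra.adjoin k (LS K (itp φ N))) φ N).card = M := by
    rw [← hMd, ← hLn, ← Set.ncard_coe_finset]
    refine Set.ncard_congr (fun a _ => (a : K)) (fun a ha => (hmem a).1 ha) (fun a b _ _ h => Subtype.ext h) ?_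
    intro b hb
    exact ⟨⟨b, Algebra.subset_adjoin hb⟩, (hmem _).2 hb, rfl⟩
  have hσL : ∀ (σ : K ≃ₐ[E] K), ∀ a ∈ Lm (Algebra.adjoin k (LS K (itp φ N))) φ N,
      σ • a ∈ Lm (Algebra.adjoin k (LS K (itp φ N))) φ N := by
    intro σ a ha
    rw [hmem] at ha ⊢
    exact LS_aut (itp φ N) σ _ ha
  have hfaith : ∀ g g' : K ≃ₐ[E] K, (∀ y ∈ Lm (Algebra.adjoin k (LS K (itp φ N))) φ N, g • y = g' • y) →
      g = g' := by
    intro g g' hgg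
    have h1 : (g : K →ₐ[E] K) = (g' : K →ₐ[E] K) := by
      refine AlgHom.ext_of_adjoin_eq_top (LS_adjoin (E := E) (itp φ N) hM1') fun x hx => ?_
      have := hgg ⟨x, Algebra.subset_adjoin hx⟩ ((hmem _).2 hx)
      exact congrArg Subtype.val this
    exact AlgEquiv.ext fun x => congrArg (fun f : K →ₐ[E] K => f x) h1
  -- transitivity
  have htr : ∀ x ∈ Lm (Algebra.adjoin k (LS K (itp φ N))) φ N, ∀ y ∈ Lm (Algebra.adjoin k (LS K (itp φ N))) φ N,
      ∃ g : K ≃ₐ[E] K, g • x = y := by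
    intro x hx y hy
    set O : Finset (Algebra.adjoin k (LS K (itp φ N))) := univ.image (fun σ : K ≃ₐ[E] K => σ • x) with hO
    have hOL : O ⊆ Lm (Algebra.adjoin k (LS K (itp φ N))) φ N := by
      intro z hz
      obtain ⟨σ, -, rfl⟩ := mem_image.1 hz
      exact hσL σ x hx
    obtain ⟨P, hP⟩ := orbit_prod (k := k) (K ≃ₐ[E] K) x
    have hPK : algebraMap k[X] K P = ∏ s ∈ O, (s : K) := by
      rw [← hcoe, hP]
      exact map_prod (Algebra.adjoin k (LS K (itp φ N))).val _ _
    have hord : ∀ s ∈ O, (ι (s : K)).order = -1 ∧ ι (s : K) ≠ 0 := fun s hs =>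
      LS_order (itp φ N) hM1' ι hιC hιX hι1 s ((hmem s).1 (hOL hs))
    have hprod : (ι (algebraMap k[X] K P)).order = -(O.card : ℤ) := by
      rw [hPK, map_prod, order_prod _ _ (fun s hs => (hord s hs).2), sum_congr rfl (fun s hs => (hord s hs).1)]
      simp
    have hP0 : P ≠ 0 := by
      rintro rfl
      rw [map_zero] at hPK
      obtain ⟨s, hs, hs0⟩ := prod_eq_zero_iff.1 hPK.symm
      exact (hord s hs).2 (by rw [hs0, map_zero])
    have hpo := (order_poly (ι.comp (algebraMap k[X] K)) (fun c => by
      rw [RingHom.comp_apply, ← algebraMap_eq, ← IsScalarTower.algebraMap_apply, hιC]) M hM1 (by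
        rw [RingHom.comp_apply, hιX, hMd]) _ P rfl hP0).1
    rw [RingHom.comp_apply, hprod, neg_inj] at hpo
    have hpo' : O.card = M * P.natDegree := by exact_mod_cast hpo
    have hOpos : 0 < O.card := card_pos.2 ⟨x, mem_image.2 ⟨1, mem_univ _, one_smul _ _⟩⟩
    have hle : M ≤ O.card := Nat.le_of_dvd hOpos ⟨_, hpo'⟩
    have hEq : O = Lm (Algebra.adjoin k (LS K (itp φ N))) φ N := eq_of_subset_of_card_le hOL (by rw [hcard]; exact hle)
    rw [← hEq] at hy
    obtain ⟨σ, -, hσ⟩ := mem_image.1 hy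
    exact ⟨σ, hσ⟩
  -- Frobenius
  have hΨh : ∀ r, r ∈ LS K (itp φ N) → Ψ r ∈ LS K (itp φ N) := by
    intro r hr
    have hr' : aeval r (itp φ N) = algebraMap k[X] K X := hr
    change aeval (Ψ r) (itp φ N) = _
    rw [← hΨX, ← hr', aeval_def, aeval_def, hom_eval₂]
    have h1 : Ψ.comp (algebraMap k K) = (algebraMap k K).comp (iterateFrobenius k p (μ + ν)) := by
      refine RingHom.ext fun c => ?_
      rw [RingHom.comp_apply, hΨC, RingHom.comp_apply, iterateFrobenius_def]
    rw [h1, ← eval₂_map, map_itp]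
    congr 2
    ext i
    rw [coeff_map, iterateFrobenius_def, hφ]
  have hΨA : ∀ a ∈ Algebra.adjoin k (LS K (itp φ N)), Ψ a ∈ Algebra.adjoin k (LS K (itp φ N)) := by
    intro a ha
    induction ha using Algebra.adjoin_induction with
    | mem x hx => exact Algebra.subset_adjoin (hΨh x hx)
    | algebraMap r => rw [hΨC]; exact Subalgebra.algebraMap_mem _ _
    | add x y _ _ hx hy => rw [map_add]; exact add_mem hx hy
    | mul x y _ _ hx hy => rw [map_mul]; exact mul_mem hx hy
  let ΨA : Algebra.adjoin k (LS K (itp φ N)) →+* Algebra.adjoin k (LS K (itp φ N)) :=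
    Ψ.restrict _ _ hΨA
  have hΨAc : ∀ a, (ΨA a : K) = Ψ a := fun a => rfl
  -- finrank bound
  have hgle : Module.finrank E K ≤ g := by
    rw [← IsGalois.card_aut_eq_finrank E K, Nat.card_eq_fintype_card]
    let LF := Lm (Algebra.adjoin k (LS K (itp φ N))) φ N
    let emb : (K ≃ₐ[E] K) → (LF → LF) := fun σ a => ⟨σ • a.1, hσL σ a.1 a.2⟩
    have hemb : Function.Injective emb := by
      intro σ τ h
      refine hfaith σ τ fun y hy => ?_
      exact congrArg Subtype.val (congrFun h ⟨y, hy⟩)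
    have := Fintype.card_le_of_injective emb hemb
    rwa [Fintype.card_fun, Fintype.card_coe, hcard, ← hg] at this
  have hle1 : ∀ g0, g0 ≤ g → (g0 + 1) * (g0 + M * (g0 * (p ^ μ + 2) + 1)) < p ^ ν := fun g0 h =>
    lt_of_le_of_lt (by gcongr) hQ
  have hle2 : ∀ g0, g0 ≤ g → p ^ (μ + ν) + g0 * g0 * p ^ ν + g0 * (3 * g0 + M * (g0 * (p ^ μ + 2) + 1)) ≤
    p ^ (μ + ν) + g * g * p ^ ν + g * (3 * g + M * (g * (p ^ μ + 2) + 1)) := fun g0 h => by gcongr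
  refine tower_bound (G := K ≃ₐ[E] K) hinj φ hd N Kc hNK hN1 (by rw [hcard, hM]) htr hgood hfaith p (μ + ν) ΨA
    ?_ hφ ?_ ?_ _ ?_ Y0 hY1 hY2 hY3
  · intro a b hab
    apply Subtype.ext
    apply Ψ.injective
    rw [← hΨAc, ← hΨAc, hab]
  · intro c
    apply Subtype.ext
    rw [hΨAc]
    exact hΨC c
  · apply Subtype.ext
    rw [hΨAc, hcoe, hΨX]
  · intro S τ hτ hS
    refine le_trans ?_ (hle2 _ hgle)
    refine stepanov_galois (E := E) μ ν hLfin ι M (fun σ r hr => LS_aut (itp φ N) σ r hr)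
      (LS_integral (itp φ N) hM1') (LS_adjoin (E := E) (itp φ N) hM1') ?_ hιC hM1 (by rw [hιX, hMd]) hι1 _ rfl S τ ?_ ?_
      (hle1 _ hgle)
    · rw [← hMd]; exact LS_yW (itp φ N) r0 hr0
    · intro r hr
      exact (hmem _).1 (hτ r ((hmem r).2 hr))
    · intro P hP r hr
      exact hS P hP r ((hmem r).2 hr)

end Conc
end PerAvg

set_option linter.unusedSectionVars false
set_option linter.unusedVariables false
set_option linter.style.haveILetI false

namespace PerAvg
open Finset Polynomial

theorem alg_bound {k : Type} [Field k] [IsAlgClosed k]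
    (φ : k[X]) (hd : 2 ≤ φ.natDegree)
    (N Kc : ℕ) (hNK : Kc * (φ.natDegree * Kc) ^ (φ.natDegree * Kc) ≤ N) (hN1 : 1 ≤ N)
    (hchar : (φ.natDegree : k) ≠ 0)
    (hgood : ∀ m, 1 ≤ m → m ≤ N → GoodAt (itp φ m))
    (p μ ν : ℕ) [Fact p.Prime] [CharP k p]
    (hφ : ∀ i, φ.coeff i ^ (p ^ (μ + ν)) = φ.coeff i)
    (M g : ℕ) (hM : M = φ.natDegree ^ N) (hg : g = M ^ M)
    (hQ : (g + 1) * (g + M * (g * (p ^ μ + 2) + 1)) < p ^ ν)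
    (Y0 : Finset k) (hY1 : ∀ y ∈ Y0, y ^ (p ^ (μ + ν)) = y)
    (hY2 : ∀ y ∈ Y0, ∃ x, x ^ (p ^ (μ + ν)) = x ∧ (itp φ N).eval x = y)
    (hY3 : ∀ y ∈ Y0, ∀ x, (itp φ N).eval x = y → (derivative (itp φ N)).eval x ≠ 0) :
    Y0.card * Kc ≤ 2 * (p ^ (μ + ν) + g * g * p ^ ν + g * (3 * g + M * (g * (p ^ μ + 2) + 1))) := by
  haveI : IsScalarTower k k[X] (SplittingField (fp (FractionRing k[X]) (itp φ N))) := by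
    refine IsScalarTower.of_algebraMap_eq fun c => ?_
    rw [IsScalarTower.algebraMap_apply k (FractionRing k[X]) (SplittingField (fp (FractionRing k[X]) (itp φ N))),
      IsScalarTower.algebraMap_apply k k[X] (FractionRing k[X]),
      ← IsScalarTower.algebraMap_apply k[X] (FractionRing k[X])]
  exact conc_bound (FractionRing k[X]) (SplittingField (fp (FractionRing k[X]) (itp φ N))) φ hd N Kc hNK hN1
    hchar hgood p μ ν hφ M g hM hg hQ Y0 hY1 hY2 hY3

theorem per_bound {F : Type} [Field F] [Fintype F]
    (φ : F[X]) (d : ℕ) (hd : φ.natDegree = d) (hd2 : 2 ≤ d)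
    (N Kc : ℕ) (hNK : Kc * (d * Kc) ^ (d * Kc) ≤ N) (hN1 : 1 ≤ N)
    (hchar : (d : F) ≠ 0)
    (hgood : ∀ m, 1 ≤ m → m ≤ N → GoodAt (itp (φ.map (algebraMap F (AlgebraicClosure F))) m))
    (p μ ν : ℕ) [Fact p.Prime] [CharP F p] (hF : Fintype.card F = p ^ (μ + ν))
    (M g : ℕ) (hM : M = d ^ N) (hg : g = M ^ M)
    (hQ : (g + 1) * (g + M * (g * (p ^ μ + 2) + 1)) < p ^ ν) :
    Set.ncard {a : F | ∃ n : ℕ, 1 ≤ n ∧ (fun x => Polynomial.eval x φ)^[n] a = a} * Kc ≤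
      2 * (p ^ (μ + ν) + g * g * p ^ ν + g * (3 * g + M * (g * (p ^ μ + 2) + 1))) + M * Kc := by
  classical
  set j := algebraMap F (AlgebraicClosure F) with hj
  haveI : CharP (AlgebraicClosure F) p := charP_of_injective_algebraMap j.injective p
  have hdj : (φ.map j).natDegree = d := by rw [natDegree_map, hd]
  have hpow : ∀ a : F, (j a) ^ (p ^ (μ + ν)) = j a := by
    intro a
    rw [← map_pow, ← hF, FiniteField.pow_card]
  have hev : ∀ a, j ((fun x => φ.eval x)^[N] a) = (itp (φ.map j) N).eval (j a) := by
    intro a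
    rw [← eval_itp, ← map_itp, eval_map, eval₂_at_apply]
  have hMd : (itp (φ.map j) N).natDegree = M := by rw [natDegree_itp, hdj, hM]
  have hM1 : 1 ≤ M := by rw [hM]; exact Nat.one_le_pow _ _ (by omega)
  have hdc : (d : AlgebraicClosure F) ≠ 0 := by
    rw [← map_natCast j]; exact (map_ne_zero j).2 hchar
  set Y : Finset (AlgebraicClosure F) := univ.image (fun a : F => j ((fun x => φ.eval x)^[N] a)) with hY
  set Y0 := Y.filter (fun y => ∀ x, (itp (φ.map j) N).eval x = y → (derivative (itp (φ.map j) N)).eval x ≠ 0)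
    with hY0
  have hmain : Y0.card * Kc ≤ 2 * (p ^ (μ + ν) + g * g * p ^ ν + g * (3 * g + M * (g * (p ^ μ + 2) + 1))) := by
    refine alg_bound (φ.map j) (by omega) N Kc (by rw [hdj]; exact hNK) hN1 (by rw [hdj]; exact hdc) hgood p μ ν ?_
      M g (by rw [hdj]; exact hM) hg hQ Y0 ?_ ?_ ?_
    · intro i; rw [coeff_map]; exact hpow _
    · intro y hy
      obtain ⟨a, -, rfl⟩ := mem_image.1 (mem_filter.1 hy).1
      exact hpow _
    · intro y hy
      obtain ⟨a, -, rfl⟩ := mem_image.1 (mem_filter.1 hy).1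
      exact ⟨j a, hpow a, (hev a).symm⟩
    · intro y hy
      exact (mem_filter.1 hy).2
  have hder := deriv_ne_zero (itp (φ.map j) N) (by omega) (by
    rw [natDegree_itp, hdj, Nat.cast_pow]; exact pow_ne_zero _ hdc)
  have hbad : (Y.filter (fun y => ¬ ∀ x, (itp (φ.map j) N).eval x = y →
      (derivative (itp (φ.map j) N)).eval x ≠ 0)).card ≤ M := by
    calc _ ≤ ((derivative (itp (φ.map j) N)).roots.toFinset.image (fun x => (itp (φ.map j) N).eval x)).card := by
          refine card_le_card fun y hy => ?_
          have h1 := (mem_filter.1 hy).2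
          push Not at h1
          obtain ⟨x, hx1, hx2⟩ := h1
          refine mem_image.2 ⟨x, ?_, hx1⟩
          rw [Multiset.mem_toFinset, mem_roots hder]
          exact hx2
      _ ≤ (derivative (itp (φ.map j) N)).roots.toFinset.card := card_image_le
      _ ≤ (derivative (itp (φ.map j) N)).roots.card := Multiset.toFinset_card_le _
      _ ≤ (derivative (itp (φ.map j) N)).natDegree := card_roots' _
      _ ≤ M := by
        refine (natDegree_derivative_le _).trans ?_
        omega
  have hYc : Y.card ≤ Y0.card + M := by
    rw [hY0, ← card_filter_add_card_filter_not (s := Y) (fun y => ∀ x, (itp (φ.map j) N).eval x = y →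
      (derivative (itp (φ.map j) N)).eval x ≠ 0)]
    omega
  have hper : Set.ncard {a : F | ∃ n : ℕ, 1 ≤ n ∧ (fun x => Polynomial.eval x φ)^[n] a = a} ≤ Y.card := by
    rw [← Set.ncard_coe_finset]
    refine Set.ncard_le_ncard_of_injOn j ?_ j.injective.injOn (Finset.finite_toSet _)
    rintro a ⟨n, hn, hna⟩
    refine mem_coe.2 (mem_image.2 ⟨(fun x => Polynomial.eval x φ)^[n * N - N] a, mem_univ _, ?_⟩)
    congr 1
    rw [← Function.iterate_add_apply]
    have : N + (n * N - N) = n * N := by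
      have := Nat.mul_le_mul_right N hn
      omega
    rw [this, Function.iterate_mul]
    exact Function.iterate_fixed hna N
  calc _ ≤ (Y0.card + M) * Kc := Nat.mul_le_mul_right _ (hper.trans hYc)
    _ = Y0.card * Kc + M * Kc := by ring
    _ ≤ _ := by omega

end PerAvg

set_option linter.unusedSectionVars false
set_option linter.unusedVariables false

namespace PerAvg
open Finset Polynomial

section Res
variable {R S : Type} [CommRing R] [CommRing S]

/-- resultant in `Z` of the derivative of φ and `Y - φ^j(Z)` -/
noncomputable def EE (φ : R[X]) (d j : ℕ) : R[X] :=
  resultant ((derivative φ).map C : R[X][X]) (C X - (itp φ j).map C) (d - 1) (d ^ j)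

/-- polynomial whose roots are the first critical orbit values -/
noncomputable def BB (φ : R[X]) (d N : ℕ) : R[X] := ∏ j ∈ range N, EE φ d (j + 1)

/-- its discriminant, up to normalization -/
noncomputable def DD (φ : R[X]) (d N : ℕ) : R :=
  resultant (BB φ d N) (derivative (BB φ d N)) (N * (d - 1)) (N * (d - 1))

lemma map_EE (f : R →+* S) (φ : R[X]) (d j : ℕ) : EE (φ.map f) d j = (EE φ d j).map f := by
  change _ = (mapRingHom f) (EE φ d j)
  rw [EE, EE, ← resultant_map_map]
  congr 1
  · rw [derivative_map, Polynomial.map_map, Polynomial.map_map]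
    congr 1
    refine RingHom.ext fun c => ?_
    simp
  · rw [Polynomial.map_sub, map_C, coe_mapRingHom, map_X, Polynomial.map_map, ← map_itp, Polynomial.map_map]
    congr 2
    refine RingHom.ext fun c => ?_
    simp

lemma map_BB (f : R →+* S) (φ : R[X]) (d N : ℕ) : BB (φ.map f) d N = (BB φ d N).map f := by
  rw [BB, BB, Polynomial.map_prod]
  exact prod_congr rfl fun j _ => map_EE f φ d (j + 1)

lemma map_DD (f : R →+* S) (φ : R[X]) (d N : ℕ) : DD (φ.map f) d N = f (DD φ d N) := by
  rw [DD, DD, ← resultant_map_map, map_BB, derivative_map]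

end Res

section Fld
variable {k : Type} [Field k] [IsAlgClosed k]

/-- critical orbit values, with multiplicity -/
noncomputable def VV (φ : k[X]) (N : ℕ) : Multiset k :=
  ((Multiset.range N) ×ˢ (derivative φ).roots).map (fun x => (itp φ (x.1 + 1)).eval x.2)

lemma natDegree_deriv (φ : k[X]) (d : ℕ) (hd : φ.natDegree = d) (hd1 : 1 ≤ d) (hc : (d : k) ≠ 0) :
    (derivative φ).natDegree = d - 1 := by
  refine le_antisymm (by rw [← hd]; exact natDegree_derivative_le _) ?_
  apply le_natDegree_of_ne_zero
  rw [coeff_derivative, Nat.sub_add_cancel hd1, ← Nat.cast_succ, Nat.succ_eq_add_one, Nat.sub_add_cancel hd1]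
  refine mul_ne_zero ?_ hc
  rw [← hd]
  intro h0
  rw [coeff_natDegree, leadingCoeff_eq_zero] at h0
  rw [h0] at hd; simp at hd; omega

lemma EE_eq (φ : k[X]) (d : ℕ) (hd : φ.natDegree = d) (hd1 : 1 ≤ d) (hc : (d : k) ≠ 0) (j : ℕ) :
    ∃ a : k, a ≠ 0 ∧ EE φ d j = C a * ((derivative φ).roots.map (fun c => X - C ((itp φ j).eval c))).prod := by
  have hdd := natDegree_deriv φ d hd hd1 hc
  have hd0 : derivative φ ≠ 0 := deriv_ne_zero φ (by omega) (by rw [hd]; exact hc)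
  have hmd : ((derivative φ).map C : k[X][X]).natDegree = d - 1 := by
    rw [natDegree_map_eq_of_injective C_injective, hdd]
  have hsp : (derivative φ).Splits := IsAlgClosed.splits _
  have h1 := resultant_eq_prod_eval ((derivative φ).map C : k[X][X]) (C X - (itp φ j).map C) (d ^ j) (by
    refine (natDegree_sub_le _ _).trans ?_
    rw [natDegree_C, natDegree_map_eq_of_injective C_injective, natDegree_itp, hd]
    simp) (hsp.map _)
  rw [hmd] at h1
  refine ⟨(derivative φ).leadingCoeff ^ (d ^ j), pow_ne_zero _ (leadingCoeff_ne_zero.2 hd0), ?_⟩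
  rw [EE, h1, leadingCoeff_map_of_injective C_injective, C_pow]
  congr 1
  have hr : ((derivative φ).map C : k[X][X]).roots = (derivative φ).roots.map C :=
    (roots_map_of_injective_of_card_eq_natDegree C_injective hsp.natDegree_eq_card_roots.symm).symm
  rw [hr, Multiset.map_map]
  congr 1
  refine Multiset.map_congr rfl fun c _ => ?_
  simp [eval_map, eval₂_at_apply]

lemma BB_eq (φ : k[X]) (d : ℕ) (hd : φ.natDegree = d) (hd1 : 1 ≤ d) (hc : (d : k) ≠ 0) (N : ℕ) :
    ∃ a : k, a ≠ 0 ∧ BB φ d N = C a * ((VV φ N).map (fun v => X - C v)).prod := by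
  choose a ha hE using fun j => EE_eq φ d hd hd1 hc j
  refine ⟨∏ j ∈ range N, a (j + 1), prod_ne_zero_iff.2 fun j _ => ha _, ?_⟩
  rw [BB, prod_congr rfl fun j _ => hE (j + 1), prod_mul_distrib, map_prod]
  congr 1
  rw [VV, Multiset.map_map, show (Multiset.range N ×ˢ (derivative φ).roots) = (Multiset.range N).bind
    (fun a => (derivative φ).roots.map (Prod.mk a)) from rfl, Multiset.map_bind, Multiset.prod_bind]
  rw [Finset.prod]
  change (Multiset.map _ (Multiset.range N)).prod = _
  congr 1
  refine Multiset.map_congr rfl fun j _ => ?_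
  rw [Multiset.map_map]
  rfl

lemma DD_iff (φ : k[X]) (d : ℕ) (hd : φ.natDegree = d) (hd1 : 2 ≤ d) (hc : (d : k) ≠ 0) (N : ℕ) :
    DD φ d N ≠ 0 ↔ (VV φ N).Nodup := by
  obtain ⟨a, ha, hB⟩ := BB_eq φ d hd (by omega) hc N
  have hdd := natDegree_deriv φ d hd (by omega) hc
  have hsp : (derivative φ).Splits := IsAlgClosed.splits _
  have hroots : (BB φ d N).roots = VV φ N := by
    rw [hB, roots_C_mul _ ha, roots_multiset_prod_X_sub_C]
  have hB0 : BB φ d N ≠ 0 := by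
    rw [hB]
    refine mul_ne_zero (C_ne_zero.2 ha) ?_
    exact (monic_multiset_prod_of_monic _ _ fun v _ => monic_X_sub_C v).ne_zero
  have hcard : (VV φ N).card = N * (d - 1) := by
    rw [VV, Multiset.card_map, Multiset.card_product, Multiset.card_range, ← hsp.natDegree_eq_card_roots, hdd]
  have hBsp : (BB φ d N).Splits := IsAlgClosed.splits _
  have hdeg : (BB φ d N).natDegree = N * (d - 1) := by
    rw [hBsp.natDegree_eq_card_roots, hroots, hcard]
  have hder : (derivative (BB φ d N)).natDegree ≤ N * (d - 1) := by
    refine (natDegree_derivative_le _).trans ?_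
    omega
  obtain ⟨t, ht⟩ := Nat.exists_eq_add_of_le hder
  rw [← hroots, nodup_roots_iff_of_splits hB0 hBsp, DD]
  have h1 := resultant_add_right_deg (BB φ d N) (derivative (BB φ d N)) (N * (d - 1)) _ t le_rfl
  rw [← ht] at h1
  rw [h1, mul_ne_zero_iff]
  have hl : (BB φ d N).coeff (N * (d - 1)) ^ t ≠ 0 := by
    rw [← hdeg]; exact pow_ne_zero _ (leadingCoeff_ne_zero.2 hB0)
  rw [← hdeg]
  rw [← hdeg] at hl
  rw [Ne, Ne, resultant_eq_zero_iff, Polynomial.Separable]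
  tauto

end Fld
end PerAvg

set_option linter.unusedSectionVars false
set_option linter.unusedVariables false

namespace PerAvg
open Finset Polynomial

section Fld
variable {k : Type} [Field k] [IsAlgClosed k]

lemma derivative_itp (φ : k[X]) (m : ℕ) :
    derivative (itp φ m) = ∏ i ∈ range m, (derivative φ).comp (itp φ i) := by
  induction m with
  | zero => simp [itp_zero]
  | succ m ih => rw [itp_succ, derivative_comp, ih, prod_range_succ]

lemma itp_add_eval (φ : k[X]) (i j : ℕ) (x : k) :
    (itp φ i).eval ((itp φ j).eval x) = (itp φ (i + j)).eval x := by
  rw [eval_itp, eval_itp, eval_itp, Function.iterate_add_apply]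

lemma good_of_nodup (φ : k[X]) (d : ℕ) (hd : φ.natDegree = d) (hd1 : 2 ≤ d) (hc : (d : k) ≠ 0) (N : ℕ)
    (hV : (VV φ N).Nodup) (m : ℕ) (hm : 1 ≤ m) (hmN : m ≤ N) : GoodAt (itp φ m) := by
  classical
  have hdd := natDegree_deriv φ d hd (by omega) hc
  have hd0 : derivative φ ≠ 0 := deriv_ne_zero φ (by omega) (by rw [hd]; exact hc)
  have hsp : (derivative φ).Splits := IsAlgClosed.splits _
  have hinj : ∀ i j c c', 1 ≤ i → i ≤ N → 1 ≤ j → j ≤ N → (derivative φ).eval c = 0 → (derivative φ).eval c' = 0 →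
      (itp φ i).eval c = (itp φ j).eval c' → i = j ∧ c = c' := by
    intro i j c c' hi hiN hj hjN hc hc' h
    have h1 := Multiset.inj_on_of_nodup_map hV (i - 1, c) (Multiset.mem_product.2
      ⟨Multiset.mem_range.2 (by change i - 1 < N; omega), (mem_roots hd0).2 hc⟩) (j - 1, c') (Multiset.mem_product.2
      ⟨Multiset.mem_range.2 (by change j - 1 < N; omega), (mem_roots hd0).2 hc'⟩) (by
        simp only
        rw [Nat.sub_add_cancel hi, Nat.sub_add_cancel hj, h])
    rw [Prod.mk.injEq] at h1
    exact ⟨by omega, h1.2⟩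
  have hnd : (derivative φ).roots.Nodup := by
    rw [Multiset.nodup_iff_count_le_one]
    intro c
    by_contra hcon
    have h2 := Multiset.Nodup.of_map _ hV
    have h3 : Multiset.map (Prod.mk 0) (derivative φ).roots ≤ (Multiset.range N) ×ˢ (derivative φ).roots := by
      obtain ⟨n, rfl⟩ : ∃ n, N = n + 1 := ⟨N - 1, by omega⟩
      have h4 : (0 : ℕ) ∈ Multiset.range (n + 1) := Multiset.mem_range.2 (by omega)
      obtain ⟨t, ht⟩ := Multiset.exists_cons_of_mem h4
      rw [ht, Multiset.cons_product]
      exact Multiset.le_add_right _ _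
    have h5 := (Multiset.nodup_of_le h3 h2).of_map
    exact hcon (Multiset.nodup_iff_count_le_one.1 h5 c)
  have hsepd : (derivative φ).Separable := (nodup_roots_iff_of_splits hd0 hsp).1 hnd
  obtain ⟨c, hcr⟩ := IsAlgClosed.exists_root (derivative φ) (by
    rw [degree_eq_natDegree hd0, hdd]
    intro h
    have : d - 1 = 0 := by exact_mod_cast h
    omega)
  have hcr' : (derivative φ).eval c = 0 := hcr
  obtain ⟨m, rfl⟩ : ∃ n, m = n + 1 := ⟨m - 1, by omega⟩
  have hder : derivative (itp φ (m + 1)) =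
      (∏ i ∈ range m, (derivative φ).comp (itp φ (i + 1))) * derivative φ := by
    rw [derivative_itp, prod_range_succ', itp_zero, comp_X]
  refine ⟨c, ?_, ?_, ?_⟩
  · rw [hder, eval_mul, hcr', mul_zero]
  · rw [hder, derivative_mul, eval_add, eval_mul, eval_mul, hcr', mul_zero, zero_add, eval_prod]
    refine mul_ne_zero (prod_ne_zero_iff.2 fun i hi => ?_) ?_
    · rw [eval_comp]
      intro h0
      have hi := mem_range.1 hi
      have h1 := hinj 1 (i + 2) _ c le_rfl (by omega) (by omega) (by omega) h0 hcr' (by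
        rw [itp_add_eval]; congr 2; omega)
      omega
    · exact hsepd.eval₂_derivative_ne_zero (RingHom.id k) hcr'
  · intro x hx hxe h0
    rw [derivative_itp, eval_prod] at h0
    obtain ⟨i, hi, hi0⟩ := prod_eq_zero_iff.1 h0
    rw [eval_comp] at hi0
    have hi := mem_range.1 hi
    have h1 := hinj (m + 1 - i) (m + 1) _ c (by omega) (by omega) hm hmN hi0 hcr' (by
      rw [itp_add_eval, Nat.sub_add_cancel (by omega), hxe])
    have hi0' : i = 0 := by omega
    subst hi0'
    apply hx
    have := h1.2
    rwa [itp_zero, eval_X] at this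

/-- orbit of the critical point `c` under `X^d - X + t`, as a polynomial in `t` -/
noncomputable def WW (d : ℕ) (c : k) : ℕ → k[X]
  | 0 => C c
  | j + 1 => (WW d c j) ^ d - WW d c j + X

lemma WW_eval (d : ℕ) (c t : k) (j : ℕ) :
    (WW d c j).eval t = (itp (X ^ d - X + C t) j).eval c := by
  induction j with
  | zero => simp [WW, itp_zero]
  | succ j ih => simp [WW, itp_succ, ih]

lemma WW_deg (d : ℕ) (hd : 2 ≤ d) (c : k) (j : ℕ) :
    (WW d c (j + 1)).Monic ∧ (WW d c (j + 1)).natDegree = d ^ j := by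
  induction j with
  | zero =>
    have : WW d c (0 + 1) = X + C (c ^ d - c) := by simp [WW]; ring
    rw [this]
    exact ⟨monic_X_add_C _, by rw [natDegree_X_add_C, pow_zero]⟩
  | succ j ih =>
    obtain ⟨h1, h2⟩ := ih
    have hpos : 1 ≤ d ^ j := Nat.one_le_pow _ _ (by omega)
    have hm : ((WW d c (j + 1)) ^ d).Monic := h1.pow d
    have hmd : ((WW d c (j + 1)) ^ d).natDegree = d ^ (j + 1) := by
      rw [h1.natDegree_pow, h2, pow_succ']
    have hlt1 : d ^ j < d ^ (j + 1) := Nat.pow_lt_pow_right (by omega) (by omega)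
    have hq : (X - WW d c (j + 1)).natDegree < d ^ (j + 1) := by
      refine lt_of_le_of_lt (natDegree_sub_le _ _) ?_
      rw [h2, natDegree_X]
      omega
    have he : WW d c (j + 1 + 1) = (WW d c (j + 1)) ^ d + (X - WW d c (j + 1)) := by
      rw [WW]; ring
    rw [he]
    have hdl : (X - WW d c (j + 1)).degree < ((WW d c (j + 1)) ^ d).degree :=
      degree_lt_degree (by rw [hmd]; exact hq)
    exact ⟨hm.add_of_left hdl, by rw [natDegree_add_eq_left_of_degree_lt hdl, hmd]⟩

lemma WW_inj (d : ℕ) (hd : 2 ≤ d) (hc : (d : k) ≠ 0) (hc1 : ((d - 1 : ℕ) : k) ≠ 0) (c c' : k)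
    (hcr : (d : k) * c ^ (d - 1) = 1) (hcr' : (d : k) * c' ^ (d - 1) = 1) (hne : c ≠ c') (j : ℕ) :
    WW d c (j + 1) ≠ WW d c' (j + 1) := by
  induction j with
  | zero =>
    intro h
    have h1 : c ^ d - c = c' ^ d - c' := by
      have := congrArg (eval 0) h
      simpa [WW] using this
    have e : ∀ x : k, (d : k) * x ^ (d - 1) = 1 → (d : k) * (x ^ d - x) = -((d - 1 : ℕ) : k) * x := by
      intro x hx
      have h2 : x ^ d = x ^ (d - 1) * x := by rw [← pow_succ, Nat.sub_add_cancel (by omega)]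
      rw [h2, mul_sub, ← mul_assoc, hx, Nat.cast_sub (by omega)]
      push_cast; ring
    have h3 := congrArg (fun y => (d : k) * y) h1
    simp only [e c hcr, e c' hcr'] at h3
    exact hne (mul_left_cancel₀ (neg_ne_zero.2 hc1) h3)
  | succ j ih =>
    intro h
    obtain ⟨h1, h2⟩ := WW_deg d hd c j
    obtain ⟨h1', h2'⟩ := WW_deg d hd c' j
    have hs : ∀ x : k, WW d x (j + 1 + 1) = (WW d x (j + 1)) ^ d - WW d x (j + 1) + X := fun x => by rw [WW]
    rw [hs, hs] at h
    generalize WW d c (j + 1) = A at *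
    generalize WW d c' (j + 1) = A' at *
    have h3 : A ^ d - A' ^ d = A - A' := by linear_combination h
    rw [← (Commute.all A A').geom_sum₂_mul d] at h3
    have h4 : (∑ i ∈ range d, A ^ i * A' ^ (d - 1 - i)) = 1 := by
      refine mul_right_cancel₀ (sub_ne_zero.2 ih) ?_
      rw [h3, one_mul]
    have h5 := congrArg (fun P => P.coeff (d ^ j * (d - 1))) h4
    simp only [finsetSum_coeff] at h5
    have h6 : ∀ i ∈ range d, (A ^ i * A' ^ (d - 1 - i)).coeff (d ^ j * (d - 1)) = 1 := by
      intro i hi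
      have hi := mem_range.1 hi
      have hmon : (A ^ i * A' ^ (d - 1 - i)).Monic := (h1.pow i).mul (h1'.pow _)
      have hdg : (A ^ i * A' ^ (d - 1 - i)).natDegree = d ^ j * (d - 1) := by
        rw [(h1.pow i).natDegree_mul (h1'.pow _), h1.natDegree_pow, h1'.natDegree_pow, h2, h2', ← add_mul]
        rw [mul_comm]; congr 1; omega
      rw [← hdg]; exact hmon
    rw [sum_congr rfl h6, sum_const, card_range, nsmul_eq_mul, mul_one, coeff_one, if_neg] at h5
    · exact hc h5
    · have : 0 < d ^ j * (d - 1) := Nat.mul_pos (Nat.pow_pos (by omega)) (by omega)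
      omega

lemma exists_example (d : ℕ) (hd : 2 ≤ d) (hc : (d : k) ≠ 0) (hc1 : ((d - 1 : ℕ) : k) ≠ 0) (N : ℕ) :
    ∃ φ : k[X], φ.natDegree = d ∧ DD φ d N ≠ 0 := by
  classical
  have hdegφ : ∀ t : k, (X ^ d - X + C t : k[X]).natDegree = d := by
    intro t
    rw [natDegree_add_C, natDegree_sub_eq_left_of_natDegree_lt, natDegree_X_pow]
    rw [natDegree_X_pow, natDegree_X]; omega
  have hder : ∀ t : k, derivative (X ^ d - X + C t : k[X]) = C (d : k) * X ^ (d - 1) - 1 := by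
    intro t
    rw [derivative_add, derivative_sub, derivative_X_pow, derivative_X, derivative_C, add_zero]
  set T : Finset (ℕ × k) := range N ×ˢ (C (d : k) * X ^ (d - 1) - 1 : k[X]).roots.toFinset with hT
  have hδ0 : (C (d : k) * X ^ (d - 1) - 1 : k[X]) ≠ 0 := by
    rw [← hder 0]
    exact deriv_ne_zero _ (by rw [hdegφ]; omega) (by rw [hdegφ]; exact hc)
  have hTr : ∀ c, c ∈ (C (d : k) * X ^ (d - 1) - 1 : k[X]).roots → (d : k) * c ^ (d - 1) = 1 := by
    intro c h
    have := (mem_roots hδ0).1 h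
    simpa [IsRoot, sub_eq_zero] using this
  have hsep : (C (d : k) * X ^ (d - 1) - 1 : k[X]).roots.Nodup := by
    apply nodup_roots
    refine ⟨-1, C ((d - 1 : ℕ) : k)⁻¹ * X, ?_⟩
    have e1 : derivative (C (d : k) * X ^ (d - 1) - 1 : k[X]) = C (d : k) * (C ((d - 1 : ℕ) : k) * X ^ (d - 1 - 1)) := by
      rw [derivative_sub, derivative_one, sub_zero, derivative_C_mul, derivative_X_pow]
    have e2 : (X : k[X]) * X ^ (d - 1 - 1) = X ^ (d - 1) := by
      rw [← pow_succ', Nat.sub_add_cancel (by omega)]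
    have e3 : (C ((d - 1 : ℕ) : k)⁻¹ : k[X]) * C ((d - 1 : ℕ) : k) = 1 := by
      rw [← C_mul, inv_mul_cancel₀ hc1, C_1]
    rw [e1]
    linear_combination (C (d : k) * X * X ^ (d - 1 - 1)) * e3 + (C (d : k)) * e2
  have hWne : ∀ a ∈ T, ∀ b ∈ T, a ≠ b → WW d a.2 (a.1 + 1) - WW d b.2 (b.1 + 1) ≠ 0 := by
    intro a ha b hb hab h
    rw [sub_eq_zero] at h
    have ha2 := hTr _ (Multiset.mem_toFinset.1 (mem_product.1 ha).2)
    have hb2 := hTr _ (Multiset.mem_toFinset.1 (mem_product.1 hb).2)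
    have hdeg := congrArg natDegree h
    rw [(WW_deg d hd _ _).2, (WW_deg d hd _ _).2] at hdeg
    have h1 := Nat.pow_right_injective hd hdeg
    have h2 : a.2 ≠ b.2 := fun h => hab (Prod.ext h1 h)
    rw [← h1] at h
    exact WW_inj d hd hc hc1 _ _ ha2 hb2 h2 _ h
  have hprod : (∏ x ∈ T.offDiag, (WW d x.1.2 (x.1.1 + 1) - WW d x.2.2 (x.2.1 + 1))) ≠ 0 := by
    refine prod_ne_zero_iff.2 fun x hx => ?_
    obtain ⟨h1, h2, h3⟩ := mem_offDiag.1 hx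
    exact hWne _ h1 _ h2 h3
  obtain ⟨t, ht⟩ : ∃ t : k, (∏ x ∈ T.offDiag, (WW d x.1.2 (x.1.1 + 1) - WW d x.2.2 (x.2.1 + 1))).eval t ≠ 0 := by
    by_contra hcon
    push Not at hcon
    exact hprod (Polynomial.funext fun t => by rw [hcon t, eval_zero])
  refine ⟨X ^ d - X + C t, hdegφ t, (DD_iff _ d (hdegφ t) hd hc N).2 ?_⟩
  rw [VV, hder]
  refine Multiset.Nodup.map_on ?_ ((Multiset.nodup_range N).product hsep)
  intro a ha b hb hab
  by_contra hne
  have ha' : a ∈ T := by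
    have := Multiset.mem_product.1 ha
    exact mem_product.2 ⟨mem_range.2 (Multiset.mem_range.1 this.1), Multiset.mem_toFinset.2 this.2⟩
  have hb' : b ∈ T := by
    have := Multiset.mem_product.1 hb
    exact mem_product.2 ⟨mem_range.2 (Multiset.mem_range.1 this.1), Multiset.mem_toFinset.2 this.2⟩
  apply ht
  rw [eval_prod]
  refine prod_eq_zero (i := (a, b)) (mem_offDiag.2 ⟨ha', hb', hne⟩) ?_
  rw [eval_sub, WW_eval, WW_eval, hab, sub_self]

end Fld
end PerAvg

set_option linter.unusedSectionVars false
set_option linter.unusedVariables false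

namespace PerAvg
open Finset Polynomial

/-- universal polynomial of degree `d` -/
noncomputable def univP (d : ℕ) : (MvPolynomial (Fin (d + 1)) ℤ)[X] :=
  ∑ i : Fin (d + 1), monomial (i : ℕ) (MvPolynomial.X i)

lemma univP_map {R : Type} [CommRing R] (d : ℕ) (f : R[X]) (hf : f.natDegree ≤ d) :
    (univP d).map (MvPolynomial.eval₂Hom (Int.castRingHom R) (fun i : Fin (d + 1) => f.coeff i)) = f := by
  rw [univP, Polynomial.map_sum]
  simp only [map_monomial, MvPolynomial.eval₂Hom_X']
  rw [Fin.sum_univ_eq_sum_range (fun i => monomial i (f.coeff i)) (d + 1)]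
  exact (as_sum_range' f (d + 1) (by omega)).symm

theorem bad_count (d N : ℕ) (hd : 2 ≤ d) : ∃ c : ℕ, ∀ (F : Type) [Field F] [Fintype F], (d : F) ≠ 0 →
    ((d - 1 : ℕ) : F) ≠ 0 →
    Set.ncard {f : F[X] | f.degree = (d : ℕ) ∧ DD f d N = 0} ≤ c * (Fintype.card F) ^ d := by
  classical
  refine ⟨(DD (univP d) d N).totalDegree, ?_⟩
  intro F _ _ hc hc1
  set D := DD (univP d) d N with hD
  set DF : MvPolynomial (Fin (d + 1)) F := MvPolynomial.map (Int.castRingHom F) D with hDF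
  have hev : ∀ f : F[X], f.natDegree ≤ d → MvPolynomial.eval (fun i : Fin (d + 1) => f.coeff i) DF = DD f d N := by
    intro f hf
    rw [hDF, MvPolynomial.eval_map]
    conv_rhs => rw [← univP_map d f hf, map_DD]
    rfl
  have hne : DF ≠ 0 := by
    have hcast : ∀ n : ℕ, (n : F) ≠ 0 → (n : AlgebraicClosure F) ≠ 0 := by
      intro n hn
      rw [← map_natCast (algebraMap F (AlgebraicClosure F))]
      exact (_root_.map_ne_zero _).2 hn
    obtain ⟨φ, hφd, hφ⟩ := exists_example (k := AlgebraicClosure F) d hd (hcast _ hc) (hcast _ hc1) N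
    intro h0
    apply hφ
    rw [← univP_map d φ hφd.le, map_DD, ← hD]
    have h1 : (MvPolynomial.eval₂Hom (Int.castRingHom (AlgebraicClosure F)) (fun i : Fin (d + 1) => φ.coeff i)) =
        (MvPolynomial.eval₂Hom (algebraMap F (AlgebraicClosure F)) (fun i : Fin (d + 1) => φ.coeff i)).comp
          (MvPolynomial.map (Int.castRingHom F)) := by
      apply MvPolynomial.ringHom_ext
      · intro r; simp
      · intro i; simp
    rw [h1, RingHom.comp_apply, ← hDF, h0, map_zero]
  have hdeg : DF.totalDegree ≤ D.totalDegree := by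
    rw [MvPolynomial.totalDegree, MvPolynomial.totalDegree]
    exact Finset.sup_mono (MvPolynomial.support_map_subset _ _)
  have hsz := MvPolynomial.schwartz_zippel_totalDegree hne (univ : Finset F)
  set Z := (Fintype.piFinset fun _ : Fin (d + 1) => (univ : Finset F)).filter (fun a => MvPolynomial.eval a DF = 0)
    with hZ
  have hq : 0 < Fintype.card F := Fintype.card_pos
  have hZc : Z.card ≤ DF.totalDegree * Fintype.card F ^ d := by
    rw [card_univ, div_le_div_iff₀ (by positivity) (by exact_mod_cast hq)] at hsz
    have h2 : Z.card * Fintype.card F ≤ DF.totalDegree * Fintype.card F ^ (d + 1) := by exact_mod_cast hsz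
    rw [pow_succ, ← mul_assoc] at h2
    exact Nat.le_of_mul_le_mul_right h2 hq
  refine le_trans ?_ (hZc.trans (Nat.mul_le_mul_right _ hdeg))
  rw [← Set.ncard_coe_finset]
  have hnd : ∀ f : F[X], f.degree = (d : ℕ) → f.natDegree ≤ d := fun f hf =>
    (natDegree_eq_of_degree_eq_some hf).le
  refine Set.ncard_le_ncard_of_injOn (fun f => fun i : Fin (d + 1) => f.coeff i) ?_ ?_ (finite_toSet _)
  · rintro f ⟨hf, hf0⟩
    refine mem_coe.2 (mem_filter.2 ⟨by simp, ?_⟩)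
    rw [hev f (hnd f hf), hf0]
  · rintro f ⟨hf, -⟩ g ⟨hg, -⟩ hfg
    ext i
    by_cases hi : i < d + 1
    · exact congrFun hfg ⟨i, hi⟩
    · rw [coeff_eq_zero_of_natDegree_lt (by have := hnd f hf; omega),
        coeff_eq_zero_of_natDegree_lt (by have := hnd g hg; omega)]

end PerAvg

set_option linter.unusedSectionVars false
set_option linter.unusedVariables false

namespace PerAvg
open Finset Polynomial

lemma degree_set {F : Type} [Field F] [Fintype F] (d : ℕ) :
    {f : F[X] | f.degree = (d : ℕ)}.Finite ∧
    {f : F[X] | f.degree = (d : ℕ)}.ncard + Fintype.card F ^ d = Fintype.card F ^ (d + 1) := by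
  have hcard : ∀ n, ((degreeLT F n : Submodule F F[X]) : Set F[X]).Finite ∧
      ((degreeLT F n : Submodule F F[X]) : Set F[X]).ncard = Fintype.card F ^ n := by
    intro n
    haveI : Finite (degreeLT F n) := Finite.of_equiv _ (degreeLTEquiv F n).symm.toEquiv
    refine ⟨Set.toFinite _, ?_⟩
    change Nat.card (degreeLT F n) = _
    rw [Nat.card_congr (degreeLTEquiv F n).toEquiv, Nat.card_eq_fintype_card, Fintype.card_fun, Fintype.card_fin]
  have hsub : ((degreeLT F d : Submodule F F[X]) : Set F[X]) ⊆ (degreeLT F (d + 1) : Submodule F F[X]) := by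
    exact degreeLT_mono (by omega)
  have heq : {f : F[X] | f.degree = (d : ℕ)} =
      ((degreeLT F (d + 1) : Submodule F F[X]) : Set F[X]) \ (degreeLT F d : Submodule F F[X]) := by
    ext f
    simp only [Set.mem_setOf_eq, Set.mem_sdiff, SetLike.mem_coe, mem_degreeLT, not_lt]
    constructor
    · intro h
      rw [h]
      exact ⟨by exact_mod_cast Nat.lt_succ_self d, le_rfl⟩
    · rintro ⟨h1, h2⟩
      refine le_antisymm ?_ h2
      have h0 : f ≠ 0 := by rintro rfl; simp at h2
      rw [degree_eq_natDegree h0] at h1 ⊢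
      have : f.natDegree < d + 1 := by exact_mod_cast h1
      exact_mod_cast Nat.lt_succ_iff.1 this
  constructor
  · rw [heq]; exact (hcard (d + 1)).1.subset Set.sdiff_subset
  · rw [heq, ← (hcard d).2, ← (hcard (d + 1)).2]
    exact Set.ncard_sdiff_add_ncard_of_subset hsub (hcard (d + 1)).1

lemma final_avg {α : Type} (S : Finset α) (good : α → Prop) [DecidablePred good] (P : α → ℕ) (Q d c Kc : ℕ) (ε : ℝ)
    (hε : 0 < ε) (hS : S.card + Q ^ d = Q ^ (d + 1)) (hP : ∀ f ∈ S, P f ≤ Q)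
    (hg : ∀ f ∈ S, good f → P f * Kc ≤ 7 * Q) (hK : 14 / ε < Kc) (hbad : (S.filter (fun f => ¬ good f)).card ≤ c * Q ^ d)
    (hQ : 2 * c / ε + 1 < Q) :
    (∑ f ∈ S, (P f : ℝ) / ((Q : ℝ) + 1)) / (S.card : ℝ) < ε := by
  have hK0 : (0 : ℝ) < Kc := lt_trans (by positivity) hK
  have hc0 : (0 : ℝ) ≤ 2 * c / ε := by positivity
  have hQ1 : (1 : ℝ) < Q := by linarith
  have hQ0 : (0 : ℝ) < Q := by linarith
  have hSr : (S.card : ℝ) = (Q : ℝ) ^ d * (Q - 1) := by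
    have : (S.card : ℝ) + (Q : ℝ) ^ d = (Q : ℝ) ^ (d + 1) := by exact_mod_cast hS
    rw [pow_succ] at this
    linarith
  have hQd : (0 : ℝ) < (Q : ℝ) ^ d := by positivity
  have hSpos : (0 : ℝ) < S.card := by
    rw [hSr]; exact mul_pos hQd (by linarith)
  rw [div_lt_iff₀ hSpos, ← sum_filter_add_sum_filter_not S good]
  have h1 : ∑ f ∈ S.filter good, (P f : ℝ) / ((Q : ℝ) + 1) ≤ S.card * (7 / Kc) := by
    calc _ ≤ (S.filter good).card • (7 / (Kc : ℝ)) := by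
          refine sum_le_card_nsmul _ _ _ fun f hf => ?_
          obtain ⟨hf1, hf2⟩ := mem_filter.1 hf
          rw [div_le_div_iff₀ (by linarith) hK0]
          have : (P f : ℝ) * Kc ≤ 7 * Q := by exact_mod_cast hg f hf1 hf2
          linarith
      _ ≤ _ := by
          rw [nsmul_eq_mul]
          have : ((S.filter good).card : ℝ) ≤ S.card := by exact_mod_cast card_filter_le _ _
          gcongr
  have h2 : ∑ f ∈ S.filter (fun f => ¬ good f), (P f : ℝ) / ((Q : ℝ) + 1) ≤ c * (Q : ℝ) ^ d := by
    calc _ ≤ (S.filter (fun f => ¬ good f)).card • (1 : ℝ) := by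
          refine sum_le_card_nsmul _ _ _ fun f hf => ?_
          obtain ⟨hf1, hf2⟩ := mem_filter.1 hf
          rw [div_le_one (by linarith)]
          have : (P f : ℝ) ≤ Q := by exact_mod_cast hP f hf1
          linarith
      _ ≤ _ := by
          rw [nsmul_eq_mul, mul_one]
          exact_mod_cast hbad
  have h3 : 7 / (Kc : ℝ) < ε / 2 := by
    rw [div_lt_iff₀ hε] at hK
    rw [div_lt_div_iff₀ hK0 (by norm_num)]
    linarith
  have h4 : c * (Q : ℝ) ^ d ≤ S.card * (ε / 2) := by
    rw [hSr]
    have h5 : 2 * (c : ℝ) / ε < Q - 1 := by linarith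
    rw [div_lt_iff₀ hε] at h5
    have h6 : (c : ℝ) ≤ (Q - 1) * (ε / 2) := by linarith
    calc c * (Q : ℝ) ^ d ≤ ((Q - 1) * (ε / 2)) * (Q : ℝ) ^ d := by gcongr
      _ = _ := by ring
  have h7 : (S.card : ℝ) * (7 / Kc) < S.card * (ε / 2) := by gcongr
  linarith

end PerAvg

theorem average_periodic_proportion_polynomials_tendsto_zero
    (q d : ℕ) (hq : ∃ p k : ℕ, p.Prime ∧ 0 < k ∧ q = p ^ k) (hd : 2 ≤ d)
    (hgcd : Nat.gcd q (Nat.factorial d) = 1) :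
    ∀ ε : ℝ, 0 < ε → ∃ J : ℕ, ∀ j : ℕ, J ≤ j → 1 ≤ j →
      ∀ (F : Type) [Field F] [Fintype F], Fintype.card F = q ^ j →
        (∑ᶠ f ∈ {f : Polynomial F | f.degree = (d : ℕ)},
            (Set.ncard {a : F | ∃ n : ℕ, 1 ≤ n ∧ (fun x => Polynomial.eval x f)^[n] a = a} : ℝ)
              / ((q : ℝ) ^ j + 1))
          / (Set.ncard {f : Polynomial F | f.degree = (d : ℕ)} : ℝ) < ε := by
  classical
  intro ε hε
  obtain ⟨p, k, hp, hk, rfl⟩ := hq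
  haveI : Fact p.Prime := ⟨hp⟩
  have hpd : ∀ n, 1 ≤ n → n ≤ d → ¬ p ∣ n := by
    intro n hn hnd h
    have h1 : p ∣ Nat.gcd (p ^ k) (Nat.factorial d) :=
      Nat.dvd_gcd (dvd_pow_self p hk.ne') (h.trans (Nat.dvd_factorial hn hnd))
    rw [hgcd] at h1
    exact hp.one_lt.ne' (Nat.dvd_one.1 h1)
  obtain ⟨Kc, hKc⟩ := exists_nat_gt (14 / ε)
  have hKpos : 1 ≤ Kc := by
    have : (0 : ℝ) < Kc := lt_trans (by positivity) hKc
    exact_mod_cast this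
  obtain ⟨N, hNdef⟩ : ∃ N, N = Kc * (d * Kc) ^ (d * Kc) := ⟨_, rfl⟩
  have hN1 : 1 ≤ N := by
    rw [hNdef]
    exact Nat.mul_pos hKpos (Nat.pow_pos (Nat.mul_pos (by omega) hKpos))
  obtain ⟨c, hc⟩ := PerAvg.bad_count d N hd
  obtain ⟨M, hM⟩ : ∃ M, M = d ^ N := ⟨_, rfl⟩
  obtain ⟨g, hg⟩ : ∃ g, g = M ^ M := ⟨_, rfl⟩
  obtain ⟨μ, hμ⟩ : ∃ μ, μ = g * g := ⟨_, rfl⟩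
  obtain ⟨c1, hc1⟩ : ∃ c1, c1 = (g + 1) * (g + M * (g * (p ^ μ + 2) + 1)) := ⟨_, rfl⟩
  obtain ⟨c0, hc0⟩ : ∃ c0, c0 = g * (3 * g + M * (g * (p ^ μ + 2) + 1)) := ⟨_, rfl⟩
  obtain ⟨c2, hc2⟩ := exists_nat_gt (2 * (c : ℝ) / ε + 1)
  refine ⟨(c1 + 1) * p ^ μ + c0 + M * Kc + c2, ?_⟩
  intro j hj hj1 F _ _ hF
  obtain ⟨Q, hQ⟩ : ∃ Q, Q = (p ^ k) ^ j := ⟨_, rfl⟩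
  have hq1 : 1 < p ^ k := Nat.one_lt_pow hk.ne' hp.one_lt
  have hQj : (c1 + 1) * p ^ μ + c0 + M * Kc + c2 < Q := by
    rw [hQ]; exact lt_of_le_of_lt hj (Nat.lt_pow_self hq1)
  have hpμ : 1 ≤ p ^ μ := Nat.one_le_pow _ _ hp.pos
  have hQe : Q = p ^ (k * j) := by rw [hQ, pow_mul]
  have hμe : μ ≤ k * j := by
    have h1 : p ^ μ ≤ p ^ (k * j) := by
      rw [← hQe]
      have := Nat.mul_le_mul_right (p ^ μ) (show 1 ≤ c1 + 1 by omega)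
      omega
    exact (Nat.pow_le_pow_iff_right hp.one_lt).1 h1
  obtain ⟨ν, hν⟩ := Nat.exists_eq_add_of_le hμe
  have hQν : Q = p ^ (μ + ν) := by rw [hQe, hν]
  have hFQ : Fintype.card F = p ^ (μ + ν) := by rw [hF, ← hQ, hQν]
  haveI : CharP F p := charP_of_card_eq_prime_pow hFQ
  have hcast : ∀ n : ℕ, 1 ≤ n → n ≤ d → (n : F) ≠ 0 := by
    intro n hn hnd h
    exact hpd n hn hnd ((CharP.cast_eq_zero_iff F p n).1 h)
  have hc1ν : c1 < p ^ ν := by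
    have h1 : (c1 + 1) * p ^ μ < p ^ ν * p ^ μ := by
      rw [← pow_add, add_comm ν μ, ← hQν]; omega
    have h2 := Nat.lt_of_mul_lt_mul_right h1
    omega
  have hggν : g * g * p ^ ν ≤ Q := by
    rw [hQν, pow_add]
    refine Nat.mul_le_mul_right _ ?_
    rw [hμ]; exact (Nat.lt_pow_self hp.one_lt).le
  obtain ⟨hfin, hcount⟩ := PerAvg.degree_set (F := F) d
  rw [finsum_mem_eq_finite_toFinset_sum _ hfin, Set.ncard_eq_toFinset_card _ hfin]
  have hQr : ((p ^ k : ℕ) : ℝ) ^ j = (Q : ℝ) := by rw [hQ]; push_cast; ring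
  rw [hQr]
  rw [Set.ncard_eq_toFinset_card _ hfin, hF, ← hQ] at hcount
  refine PerAvg.final_avg hfin.toFinset (fun f => PerAvg.DD f d N ≠ 0) _ Q d c Kc ε hε hcount ?_ ?_ hKc ?_ ?_
  · intro f _
    rw [hQ, ← hF, ← Nat.card_eq_fintype_card, ← Set.ncard_univ]
    exact Set.ncard_le_ncard (Set.subset_univ _) (Set.toFinite _)
  · intro f hf hgood
    have hfd : f.degree = (d : ℕ) := hfin.mem_toFinset.1 hf
    have hnd : f.natDegree = d := Polynomial.natDegree_eq_of_degree_eq_some hfd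
    have hdF : (d : F) ≠ 0 := hcast d (by omega) le_rfl
    have hdk : (d : AlgebraicClosure F) ≠ 0 := by
      rw [← map_natCast (algebraMap F (AlgebraicClosure F))]
      exact (_root_.map_ne_zero _).2 hdF
    have hndk : (f.map (algebraMap F (AlgebraicClosure F))).natDegree = d := by
      rw [Polynomial.natDegree_map, hnd]
    have hV : (PerAvg.VV (f.map (algebraMap F (AlgebraicClosure F))) N).Nodup := by
      rw [← PerAvg.DD_iff _ d hndk hd hdk N, PerAvg.map_DD]
      exact (_root_.map_ne_zero _).2 hgood
    have h1 := PerAvg.per_bound f d hnd hd N Kc hNdef.ge hN1 hdF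
      (fun m hm hmN => PerAvg.good_of_nodup _ d hndk hd hdk N hV m hm hmN) p μ ν hFQ M g hM hg (by rw [← hc1]; exact hc1ν)
    rw [← hc0, ← hQν] at h1
    omega
  · have h1 := hc F (hcast d (by omega) le_rfl) (hcast (d - 1) (by omega) (by omega))
    rw [hF, ← hQ] at h1
    refine le_trans ?_ h1
    rw [← Set.ncard_coe_finset]
    refine Set.ncard_le_ncard ?_ (hfin.subset fun f hf => hf.1)
    intro f hf
    obtain ⟨h2, h3⟩ := Finset.mem_filter.1 (Finset.mem_coe.1 hf)
    exact ⟨hfin.mem_toFinset.1 h2, not_not.1 h3⟩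
  · refine lt_trans hc2 ?_
    exact_mod_cast (show c2 < Q by omega)
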